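/- arXiv:2106.08635 — 2 statements merged into one kernel-verified Lean document; each statement's English description precedes it below -/
import Mathlib

section
/- Let f, g be smooth vector fields on an open subset M of ℝ³ and ξ₀ ∈ M. The control-affine system ξ̇ = f(ξ) + g(ξ)u is locally feedback equivalent at ξ₀ to a quadratic control-affine system Σ_q if and only if: (C1) the vectors g(ξ₀), [g,f](ξ₀), [g,[g,f]](ξ₀) are linearly independent; and (C2) on a neighbourhood of ξ₀ where (C1) holds, writing ad_g³f = ρ·ad_g²f + τ·ad_g f + σ·g for the unique smooth functions ρ, τ, σ, the function χ = 3L_gρ − 2ρ² − 9τ satisfies L_gχ − (2/3)ρχ = 0. -/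
noncomputable section

open Set

/-- `ℝ³`, with coordinates `ξ = (x, w)`, `x ∈ ℝ²`, `w ∈ ℝ`. -/
abbrev M3 := (ℝ × ℝ) × ℝ

/-- Lie bracket `[A,B](ξ) = DB(ξ)A(ξ) − DA(ξ)B(ξ)` of vector fields on `ℝ³`. -/
def lieB (A B : M3 → M3) : M3 → M3 :=
  fun ξ => fderiv ℝ B ξ (A ξ) - fderiv ℝ A ξ (B ξ)

/-- Lie derivative `L_A h = Dh·A` of a function along a vector field. -/
def lieD (A : M3 → M3) (h : M3 → ℝ) : M3 → ℝ :=
  fun ξ => fderiv ℝ h ξ (A ξ)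

/-- Local feedback equivalence at `ξ₀` of the control-affine system `ξ̇ = f + g u` with the
system `ξ̇ = f' + g' u'` defined on `V`: there are a local diffeomorphism `Φ` and smooth
`α, β` with `β` nonvanishing such that `Φ∗(f + α g) = f'` and `Φ∗(β g) = g'`. -/
def FbEquivAff (f g : M3 → M3) (ξ₀ : M3) (f' g' : M3 → M3) (V : Set M3) : Prop :=
  ∃ (Φ : M3 → M3) (α β : M3 → ℝ) (U : Set M3),
    IsOpen U ∧ ξ₀ ∈ U ∧
    ContDiffOn ℝ (⊤ : ℕ∞) Φ U ∧ (∀ ξ ∈ U, Function.Bijective (fderiv ℝ Φ ξ)) ∧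
    (∀ ξ ∈ U, Φ ξ ∈ V) ∧
    ContDiffOn ℝ (⊤ : ℕ∞) α U ∧ ContDiffOn ℝ (⊤ : ℕ∞) β U ∧ (∀ ξ ∈ U, β ξ ≠ 0) ∧
    (∀ ξ ∈ U, fderiv ℝ Φ ξ (f ξ + α ξ • g ξ) = f' (Φ ξ)) ∧
    (∀ ξ ∈ U, fderiv ℝ Φ ξ (β ξ • g ξ) = g' (Φ ξ))

/-- `(f, g)` is, locally at `ξ₀`, feedback equivalent to a quadratic control-affine system
`Σ_q : ẋ = F(x,w), ẇ = u` where `F` is smooth, `∂²F/∂w²` and `∂F/∂w` are linearly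
independent at every point, and `∂³F/∂w³ = τ_q(x)·∂F/∂w` with `τ_q` smooth, depending on
`x` only. -/
def QuadratizableAt (f g : M3 → M3) (ξ₀ : M3) : Prop :=
  ∃ (F : (ℝ × ℝ) → ℝ → ℝ × ℝ) (τq : (ℝ × ℝ) → ℝ) (V : Set M3),
    IsOpen V ∧
    ContDiffOn ℝ (⊤ : ℕ∞) (fun p : M3 => F p.1 p.2) V ∧
    ContDiffOn ℝ (⊤ : ℕ∞) τq (Prod.fst '' V) ∧
    (∀ ξ ∈ V, LinearIndependent ℝ ![deriv (deriv (F ξ.1)) ξ.2, deriv (F ξ.1) ξ.2]) ∧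
    (∀ ξ ∈ V, deriv (deriv (deriv (F ξ.1))) ξ.2 = τq ξ.1 • deriv (F ξ.1) ξ.2) ∧
    FbEquivAff f g ξ₀
      (fun ξ => ((F ξ.1 ξ.2, (0 : ℝ)) : M3))
      (fun _ => (((0 : ℝ × ℝ), (1 : ℝ)) : M3)) V

/-- pointwise application of continuous families of operators. -/
def opC (K : Type) [TopologicalSpace K] [CompactSpace K] (E F : Type) [NormedAddCommGroup E]
    [NormedSpace ℝ E] [NormedAddCommGroup F] [NormedSpace ℝ F] :
    C(K, E →L[ℝ] F) →L[ℝ] C(K, E) →L[ℝ] C(K, F) :=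
  LinearMap.mkContinuous₂
    (LinearMap.mk₂ ℝ (fun (A : C(K, E →L[ℝ] F)) (h : C(K, E)) =>
        (⟨fun k => A k (h k), by fun_prop⟩ : C(K, F)))
      (by intros; ext; simp) (by intros; ext; simp) (by intros; ext; simp) (by intros; ext; simp))
    1 (by
      intro A h
      rw [ContinuousMap.norm_le _ (by positivity)]
      intro k
      simp only [LinearMap.mk₂_apply, ContinuousMap.coe_mk, one_mul]
      exact (A k).le_of_opNorm_le_of_le (A.norm_coe_le_norm k) (h.norm_coe_le_norm k))

theorem opC_apply {K : Type} [TopologicalSpace K] [CompactSpace K] {E F : Type}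
    [NormedAddCommGroup E]
    [NormedSpace ℝ E] [NormedAddCommGroup F] [NormedSpace ℝ F] (A : C(K, E →L[ℝ] F))
    (h : C(K, E)) (k : K) : opC K E F A h k = A k (h k) := rfl

theorem nem_hasFDerivAt {K : Type} [TopologicalSpace K] [CompactSpace K] {E F : Type}
    [NormedAddCommGroup E] [NormedSpace ℝ E] [NormedAddCommGroup F] [NormedSpace ℝ F]
    (G : C(E, F)) (G' : C(E, E →L[ℝ] F)) (h : ∀ x, HasFDerivAt G (G' x) x) (γ : C(K, E)) :
    HasFDerivAt (fun γ : C(K, E) => G.comp γ) (opC K E F (G'.comp γ)) γ := by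
  rw [hasFDerivAt_iff_isLittleO_nhds_zero, Asymptotics.isLittleO_iff]
  intro ε hε
  have hc := (ContinuousMap.continuous_postcomp (X := K) G').continuousAt (x := γ)
  obtain ⟨δ, hδ, hc⟩ := (Metric.continuousAt_iff (α := C(K, E)) (β := C(K, E →L[ℝ] F))
    (f := fun γ => G'.comp γ) (a := γ)).1 hc ε hε
  filter_upwards [Metric.ball_mem_nhds (0 : C(K, E)) hδ] with η hη
  rw [mem_ball_zero_iff] at hη
  rw [ContinuousMap.norm_le _ (by positivity)]
  intro k
  have hηk : ‖η k‖ ≤ ‖η‖ := η.norm_coe_le_norm k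
  have key : ∀ y ∈ Metric.ball (γ k) δ, ‖G' y - G' (γ k)‖ ≤ ε := by
    intro y hy
    have hy' : ‖y - γ k‖ < δ := by rwa [mem_ball_iff_norm] at hy
    have h1 : dist (γ + ContinuousMap.const K (y - γ k)) γ < δ := by
      rw [dist_eq_norm, add_sub_cancel_left]
      refine lt_of_le_of_lt ?_ hy'
      rw [ContinuousMap.norm_le _ (by positivity)]
      intro x; simp
    have h2 := hc h1
    have h3 := ContinuousMap.dist_apply_le_dist (f := G'.comp (γ + ContinuousMap.const K (y - γ k)))
      (g := G'.comp γ) k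
    simp only [ContinuousMap.comp_apply, ContinuousMap.add_apply, ContinuousMap.const_apply,
      add_sub_cancel, dist_eq_norm] at h3
    exact h3.trans h2.le
  have := (convex_ball (γ k) δ).norm_image_sub_le_of_norm_hasFDerivWithin_le'
    (f := G) (f' := G') (φ := G' (γ k)) (C := ε)
    (fun x _ => (h x).hasFDerivWithinAt) key (Metric.mem_ball_self hδ)
    (y := γ k + η k) (by rw [mem_ball_iff_norm, add_sub_cancel_left]; linarith)
  rw [add_sub_cancel_left] at this
  refine le_trans ?_ (this.trans (by gcongr))
  simp [opC_apply]

theorem nem_contDiff {K : Type} [TopologicalSpace K] [CompactSpace K] {E : Type}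
    [NormedAddCommGroup E] [NormedSpace ℝ E] (n : ℕ) :
    ∀ {F : Type} [NormedAddCommGroup F] [NormedSpace ℝ F]
    (G : C(E, F)) (_ : ContDiff ℝ n G),
    ContDiff ℝ n (fun γ : C(K, E) => G.comp γ) := by
  induction n with
  | zero =>
    intro F _ _ G hG
    simpa using (ContinuousMap.continuous_postcomp (X := K) G)
  | succ n ih =>
    intro F _ _ G hG
    have hG' := hG
    simp only [Nat.cast_add, Nat.cast_one] at hG' ⊢
    rw [contDiff_succ_iff_hasFDerivAt] at hG' ⊢
    obtain ⟨G', h1, h2⟩ := hG'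
    refine ⟨fun γ => opC K E F ((⟨G', h1.continuous⟩ : C(E, E →L[ℝ] F)).comp γ),
      ?_, fun γ => nem_hasFDerivAt G ⟨G', h1.continuous⟩ h2 γ⟩
    have h3 := ih (⟨G', h1.continuous⟩ : C(E, E →L[ℝ] F)) h1
    have h4 : ContDiff ℝ n (fun A => opC K E F A) := by
      refine IsBoundedLinearMap.contDiff ?_
      exact ContinuousLinearMap.isBoundedLinearMap (𝕜 := ℝ) (E := C(K, E →L[ℝ] F))
        (F := C(K, E) →L[ℝ] C(K, F)) (opC K E F)
    exact h4.comp h3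

theorem nem_smooth {K : Type} [TopologicalSpace K] [CompactSpace K] {E : Type}
    [NormedAddCommGroup E] [NormedSpace ℝ E] 
    {F : Type} [NormedAddCommGroup F] [NormedSpace ℝ F]
    (G : C(E, F)) (h : ContDiff ℝ (⊤ : ℕ∞) G) :
    ContDiff ℝ (⊤ : ℕ∞) (fun γ : C(K, E) => G.comp γ) :=
  contDiff_infty.2 fun n => nem_contDiff n G (contDiff_infty.1 h n)

/-- Integration from `0`. -/
def intC (E : Type) [NormedAddCommGroup E] [NormedSpace ℝ E] :
    C(Icc (0:ℝ) 1, E) →L[ℝ] C(Icc (0:ℝ) 1, E) :=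
  LinearMap.mkContinuous
    { toFun := fun γ => ⟨fun s => ∫ r in (0:ℝ)..s, IccExtend zero_le_one γ r, by
        have : Continuous (fun s : ℝ => ∫ r in (0:ℝ)..s, IccExtend (zero_le_one (α := ℝ)) γ r) :=
          intervalIntegral.continuous_primitive
          (fun a b => (γ.continuous.Icc_extend').intervalIntegrable a b) 0
        exact this.comp continuous_subtype_val⟩
      map_add' := by
        intro γ η
        ext s
        simp only [ContinuousMap.coe_mk, ContinuousMap.add_apply]
        rw [← intervalIntegral.integral_add
          ((γ.continuous.Icc_extend').intervalIntegrable _ _)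
          ((η.continuous.Icc_extend').intervalIntegrable _ _)]
        rfl
      map_smul' := by
        intro c γ
        ext s
        simp only [ContinuousMap.coe_mk, ContinuousMap.smul_apply, RingHom.id_apply]
        rw [← intervalIntegral.integral_smul]
        rfl }
    1 (by
      intro γ
      rw [ContinuousMap.norm_le _ (by positivity)]
      intro s
      have := intervalIntegral.norm_integral_le_of_norm_le_const (a := 0) (b := (s:ℝ))
        (f := IccExtend zero_le_one γ) (C := ‖γ‖) (fun x _ => γ.norm_coe_le_norm _)
      refine this.trans ?_
      rw [mul_comm]
      have h1 := s.2.1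
      have h2 := s.2.2
      gcongr
      rw [sub_zero, abs_of_nonneg h1]; exact h2)

theorem intC_apply {E : Type} [NormedAddCommGroup E] [NormedSpace ℝ E]
   (γ : C(Icc (0:ℝ) 1, E)) (s : Icc (0:ℝ) 1) :
   intC E γ s = ∫ r in (0:ℝ)..s, IccExtend zero_le_one γ r := rfl

theorem intC_norm {E : Type} [NormedAddCommGroup E] [NormedSpace ℝ E]
   (γ : C(Icc (0:ℝ) 1, E)) : ‖intC E γ‖ ≤ ‖γ‖ := by
  have := LinearMap.mkContinuous_norm_le (_ : C(Icc (0:ℝ) 1, E) →ₗ[ℝ] C(Icc (0:ℝ) 1, E))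
    zero_le_one _ |> (intC E).le_of_opNorm_le (c := 1)
  simpa using this γ

theorem inv_smooth {X Y : Type} [NormedAddCommGroup X] [NormedSpace ℝ X] [CompleteSpace X]
    [NormedAddCommGroup Y] [NormedSpace ℝ Y] [CompleteSpace Y] (H : X → Y) (O : Set X)
    (hO : IsOpen O) (hH : ContDiffOn ℝ (⊤ : ℕ∞) H O) (a : X) (ha : a ∈ O) (e : X ≃L[ℝ] Y)
    (he : HasFDerivAt H (e : X →L[ℝ] Y) a) :
    ∃ φ : OpenPartialHomeomorph X Y, a ∈ φ.source ∧ φ.source ⊆ O ∧ (∀ x, φ x = H x) ∧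
      (∀ x ∈ φ.source, ∃ e' : X ≃L[ℝ] Y, HasFDerivAt H (e' : X →L[ℝ] Y) x) ∧
      ContDiffOn ℝ (⊤ : ℕ∞) φ.symm φ.target := by
  have hat : ∀ x ∈ O, ContDiffAt ℝ (⊤ : ℕ∞) H x := fun x hx => hH.contDiffAt (hO.mem_nhds hx)
  let φ0 := (hat a ha).toOpenPartialHomeomorph H he (by simp)
  have hcont : ContinuousAt (fderiv ℝ H) a :=
    ((hat a ha).fderiv_right (m := 0) (by simp)).continuousAt
  have hnh : ∀ᶠ x in nhds a, fderiv ℝ H x ∈ range ((↑) : (X ≃L[ℝ] Y) → X →L[ℝ] Y) := by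
    apply hcont.eventually
    rw [he.fderiv]
    exact ContinuousLinearEquiv.nhds e
  obtain ⟨O', hO's, hO', haO'⟩ := eventually_nhds_iff.1 hnh
  refine ⟨φ0.restrOpen (O ∩ O') (hO.inter hO'), ?_, ?_, ?_, ?_, ?_⟩
  · rw [OpenPartialHomeomorph.restrOpen_source]
    exact ⟨(hat a ha).mem_toOpenPartialHomeomorph_source he (by simp), ha, haO'⟩
  · rw [OpenPartialHomeomorph.restrOpen_source]
    exact fun x hx => hx.2.1
  · intro x; rfl
  · intro x hx
    rw [OpenPartialHomeomorph.restrOpen_source] at hx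
    obtain ⟨e', he'⟩ := hO's x hx.2.2
    exact ⟨e', he' ▸ ((hat x hx.2.1).differentiableAt (by simp)).hasFDerivAt⟩
  · intro y hy
    set φ := φ0.restrOpen (O ∩ O') (hO.inter hO')
    have hx := φ.map_target hy
    rw [OpenPartialHomeomorph.restrOpen_source] at hx
    obtain ⟨e', he'⟩ := hO's _ hx.2.2
    have h1 : HasFDerivAt H (e' : X →L[ℝ] Y) (φ.symm y) :=
      he' ▸ ((hat _ hx.2.1).differentiableAt (by simp)).hasFDerivAt
    exact (φ.contDiffAt_symm hy h1 (hat _ hx.2.1)).contDiffWithinAt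

theorem cutoff {E F : Type} [NormedAddCommGroup E] [NormedSpace ℝ E] [FiniteDimensional ℝ E]
    [NormedAddCommGroup F] [NormedSpace ℝ F] (G : E → F) (O : Set E) (hO : IsOpen O)
    (hG : ContDiffOn ℝ (⊤ : ℕ∞) G O) (p : E) (hp : p ∈ O) :
    ∃ G' : E → F, ContDiff ℝ (⊤ : ℕ∞) G' ∧ (∃ L, LipschitzWith L G') ∧ G' =ᶠ[nhds p] G := by
  obtain ⟨r, hr, hrO⟩ := Metric.isOpen_iff.1 hO p hp
  let b : ContDiffBump p := ⟨r/4, r/2, by positivity, by linarith⟩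
  have hsub : tsupport b ⊆ O := by
    rw [b.tsupport_eq]
    refine subset_trans ?_ hrO
    exact Metric.closedBall_subset_ball (by change r/2 < r; linarith)
  have hsm : ContDiff ℝ (⊤ : ℕ∞) (fun x => b x • G x) := by
    rw [contDiff_iff_contDiffAt]
    intro x
    by_cases hx : x ∈ tsupport b
    · exact b.contDiff.contDiffAt.smul (hG.contDiffAt (hO.mem_nhds (hsub hx)))
    · have : (fun x => b x • G x) =ᶠ[nhds x] fun _ => 0 := by
        filter_upwards [(isClosed_tsupport b).isOpen_compl.mem_nhds hx] with y hy
        rw [image_eq_zero_of_notMem_tsupport hy, zero_smul]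
      exact contDiffAt_const.congr_of_eventuallyEq this
  refine ⟨fun x => b x • G x, hsm, ?_, ?_⟩
  · exact ContDiff.lipschitzWith_of_hasCompactSupport (b.hasCompactSupport.smul_right) hsm (by simp)
  · filter_upwards [b.eventuallyEq_one] with x hx
    simp [hx]

/-- constant functions. -/
def constC (K : Type) [TopologicalSpace K] [CompactSpace K] (E : Type) [NormedAddCommGroup E]
    [NormedSpace ℝ E] : E →L[ℝ] C(K, E) :=
  LinearMap.mkContinuous
    { toFun := fun x => ContinuousMap.const K x
      map_add' := by intros; ext; simp
      map_smul' := by intros; ext; simp } 1 (by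
        intro x
        rw [ContinuousMap.norm_le _ (by positivity)]
        intro k; simp)

theorem flow_exists {E : Type} [NormedAddCommGroup E] [NormedSpace ℝ E] [CompleteSpace E]
    (G : E → E) (hG : ContDiff ℝ (⊤ : ℕ∞) G) (L : NNReal) (hL : LipschitzWith L G) (x0 : E) :
    ∃ (Ψ : E × ℝ → E) (O : Set (E × ℝ)), IsOpen O ∧ (x0, 0) ∈ O ∧ ContDiffOn ℝ (⊤ : ℕ∞) Ψ O ∧
      (∀ p ∈ O, p.2 = 0 → Ψ p = p.1) ∧
      ∀ p ∈ O, HasDerivAt (fun t => Ψ (p.1, t)) (G (Ψ p)) p.2 := by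
  let I := Icc (0:ℝ) 1
  let Gc : C(E, E) := ⟨G, hG.continuous⟩
  let R : (E × ℝ) × C(I, E) → C(I, E) := fun q => constC I E q.1.1 + q.1.2 • intC E (Gc.comp q.2)
  have hN : ContDiff ℝ (⊤ : ℕ∞) (fun γ : C(I, E) => Gc.comp γ) := nem_smooth Gc hG
  have hJ : ContDiff ℝ (⊤ : ℕ∞) (fun γ : C(I, E) => intC E (Gc.comp γ)) :=
    (intC E).contDiff.comp hN
  have hR : ContDiff ℝ (⊤ : ℕ∞) R := by
    refine ((constC I E).contDiff.comp (contDiff_fst.comp contDiff_fst)).add ?_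
    exact (contDiff_snd.comp contDiff_fst).smul (hJ.comp contDiff_snd)
  let H : (E × ℝ) × C(I, E) → (E × ℝ) × C(I, E) := fun q => (q.1, q.2 - R q)
  have hH : ContDiff ℝ (⊤ : ℕ∞) H := contDiff_fst.prodMk (contDiff_snd.sub hR)
  let a : (E × ℝ) × C(I, E) := ((x0, 0), constC I E x0)
  let c0 : C(I, E) := intC E (Gc.comp a.2)
  let T : (E × ℝ) →L[ℝ] C(I, E) := (constC I E).comp (ContinuousLinearMap.fst ℝ E ℝ) +
    (ContinuousLinearMap.snd ℝ E ℝ).smulRight c0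
  let e1 : (E × ℝ) × C(I, E) →L[ℝ] (E × ℝ) × C(I, E) :=
    (ContinuousLinearMap.fst ℝ _ _).prod
      (ContinuousLinearMap.snd ℝ _ _ - T.comp (ContinuousLinearMap.fst ℝ _ _))
  let e2 : (E × ℝ) × C(I, E) →L[ℝ] (E × ℝ) × C(I, E) :=
    (ContinuousLinearMap.fst ℝ _ _).prod
      (ContinuousLinearMap.snd ℝ _ _ + T.comp (ContinuousLinearMap.fst ℝ _ _))
  let e : ((E × ℝ) × C(I, E)) ≃L[ℝ] ((E × ℝ) × C(I, E)) :=
    ContinuousLinearEquiv.equivOfInverse e1 e2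
    (fun x => by ext <;> simp [e1, e2]) (fun x => by ext <;> simp [e1, e2])
  have hRd : HasFDerivAt R (T.comp (ContinuousLinearMap.fst ℝ _ _)) a := by
    have h1 : HasFDerivAt (fun q : (E × ℝ) × C(I, E) => constC I E q.1.1)
        (((constC I E).comp (ContinuousLinearMap.fst ℝ E ℝ)).comp
          (ContinuousLinearMap.fst ℝ _ _)) a :=
      (((constC I E).comp (ContinuousLinearMap.fst ℝ E ℝ)).comp
          (ContinuousLinearMap.fst ℝ (E × ℝ) C(I, E))).hasFDerivAt
    have h2 : HasFDerivAt (fun q : (E × ℝ) × C(I, E) => q.1.2)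
        ((ContinuousLinearMap.snd ℝ E ℝ).comp (ContinuousLinearMap.fst ℝ _ _)) a :=
      ((ContinuousLinearMap.snd ℝ E ℝ).comp
        (ContinuousLinearMap.fst ℝ (E × ℝ) C(I, E))).hasFDerivAt
    have h3 : DifferentiableAt ℝ (fun q : (E × ℝ) × C(I, E) => intC E (Gc.comp q.2)) a :=
      ((hJ.comp contDiff_snd).differentiable (by simp)) a
    have h4 := h1.add (h2.smul h3.hasFDerivAt)
    refine h4.congr_fderiv ?_
    ext q <;> simp [T, a, c0]
  have he : HasFDerivAt H (e : _ →L[ℝ] _) a := by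
    have h1 : HasFDerivAt (fun q : (E × ℝ) × C(I, E) => q.1)
      (ContinuousLinearMap.fst ℝ _ _) a := hasFDerivAt_fst
    have h2 : HasFDerivAt (fun q : (E × ℝ) × C(I, E) => q.2)
      (ContinuousLinearMap.snd ℝ _ _) a := hasFDerivAt_snd
    exact h1.prodMk (h2.sub hRd)
  obtain ⟨φ, haφ, -, hφH, -, hφs⟩ := inv_smooth H univ isOpen_univ hH.contDiffOn a (mem_univ _) e he
  have hHa : φ a = ((x0, 0), 0) := by
    rw [hφH]; simp [H, R, a]
  have hta : (((x0, 0), 0) : (E × ℝ) × C(I, E)) ∈ φ.target := hHa ▸ φ.map_source haφ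
  have hnh : ∀ᶠ q : E × ℝ in nhds (x0, 0), (q, (0 : C(I, E))) ∈ φ.target ∧ |q.2| * L < 1 := by
    apply Filter.Eventually.and
    · exact (Continuous.continuousAt (by fun_prop) :
        ContinuousAt (fun q : E × ℝ => (q, (0 : C(I, E)))) (x0, 0)).eventually
        (φ.open_target.mem_nhds hta)
    · have : Continuous (fun q : E × ℝ => |q.2| * L) := by fun_prop
      exact this.continuousAt.eventually (gt_mem_nhds (by simp))
  obtain ⟨r, hr, hball⟩ := Metric.eventually_nhds_iff_ball.1 hnh
  have hmem : ∀ x t, (x, t) ∈ Metric.ball ((x0, 0) : E × ℝ) r ↔ x ∈ Metric.ball x0 r ∧ |t| < r := by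
    intro x t
    rw [← ball_prod_same]
    simp
  let γ : E × ℝ → C(I, E) := fun q => (φ.symm (q, 0)).2
  have hγ : ∀ q ∈ Metric.ball ((x0, 0) : E × ℝ) r, γ q = R (q, γ q) := by
    intro q hq
    have h1 := φ.right_inv (hball q hq).1
    rw [hφH] at h1
    have h2 := congrArg Prod.fst h1
    have h3 := congrArg Prod.snd h1
    simp only [H] at h2 h3
    have h4 : φ.symm (q, 0) = (q, γ q) := Prod.ext h2 rfl
    rw [h4] at h3
    exact sub_eq_zero.1 h3
  have huniq : ∀ q : E × ℝ, |q.2| * L < 1 → ∀ γ1 γ2, γ1 = R (q, γ1) → γ2 = R (q, γ2) → γ1 = γ2 := by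
    intro q hq γ1 γ2 h1 h2
    have h3 : ‖γ1 - γ2‖ ≤ (|q.2| * L) * ‖γ1 - γ2‖ := by
      have h4 : γ1 - γ2 = q.2 • intC E (Gc.comp γ1 - Gc.comp γ2) := by
        rw [map_sub, smul_sub]
        conv_lhs => rw [h1, h2]
        simp [R]
      have h5 : ‖Gc.comp γ1 - Gc.comp γ2‖ ≤ L * ‖γ1 - γ2‖ := by
        rw [ContinuousMap.norm_le _ (by positivity)]
        intro k
        have h6 := hL.dist_le_mul (γ1 k) (γ2 k)
        rw [dist_eq_norm, dist_eq_norm] at h6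
        refine h6.trans ?_
        gcongr
        exact (γ1 - γ2).norm_coe_le_norm k
      calc ‖γ1 - γ2‖ = |q.2| * ‖intC E (Gc.comp γ1 - Gc.comp γ2)‖ := by
            conv_lhs => rw [h4]
            rw [norm_smul, Real.norm_eq_abs]
        _ ≤ |q.2| * (L * ‖γ1 - γ2‖) := by
            gcongr
            exact (intC_norm _).trans h5
        _ = _ := by ring
    have h6 : ‖γ1 - γ2‖ = 0 := by
      have := norm_nonneg (γ1 - γ2)
      nlinarith
    exact sub_eq_zero.1 (norm_eq_zero.1 h6)
  let one : I := ⟨1, by norm_num, le_refl 1⟩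
  let Ψ : E × ℝ → E := fun q => γ q one
  have hscale : ∀ x t, (x, t) ∈ Metric.ball ((x0, 0) : E × ℝ) r → ∀ c : I,
      γ (x, t) c = Ψ (x, t * c) := by
    intro x t hxt c
    have hc0 := c.2.1
    have hc1 := c.2.2
    have hmem' : (x, t * c) ∈ Metric.ball ((x0, 0) : E × ℝ) r := by
      rw [hmem] at hxt ⊢
      refine ⟨hxt.1, lt_of_le_of_lt ?_ hxt.2⟩
      rw [abs_mul, abs_of_nonneg hc0]
      exact mul_le_of_le_one_right (abs_nonneg _) hc1
    let m : C(I, I) := ⟨fun s => ⟨c * s, mul_nonneg hc0 s.2.1, mul_le_one₀ hc1 s.2.1 s.2.2⟩,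
      by fun_prop⟩
    have h1 : (γ (x, t)).comp m = R ((x, t * c), (γ (x, t)).comp m) := by
      ext s
      have h2 := DFunLike.congr_fun (hγ _ hxt) (m s)
      simp only [R, ContinuousMap.add_apply, ContinuousMap.smul_apply, intC_apply] at h2 ⊢
      rw [ContinuousMap.comp_apply, h2]
      congr 1
      rw [mul_smul]
      congr 1
      have h3 := intervalIntegral.smul_integral_comp_mul_left (a := 0) (b := s)
        (fun r => IccExtend zero_le_one (Gc.comp (γ (x, t))) r) (c : ℝ)
      rw [mul_zero] at h3
      refine h3.symm.trans ?_
      congr 1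
      apply intervalIntegral.integral_congr
      intro u hu
      rw [uIcc_of_le s.2.1] at hu
      have hu' : u ∈ Icc (0:ℝ) 1 := ⟨hu.1, hu.2.trans s.2.2⟩
      have hcu : c * u ∈ Icc (0:ℝ) 1 := (m ⟨u, hu'⟩).2
      simp only
      rw [IccExtend_of_mem _ _ hu', IccExtend_of_mem _ _ hcu]
      rfl
    have h4 := huniq (x, t * c) (hball _ hmem').2 _ _ h1 (hγ _ hmem')
    have h5 := DFunLike.congr_fun h4 one
    simp only [Ψ, ← h5, ContinuousMap.comp_apply]
    congr 1
    exact Subtype.ext (mul_one _).symm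
  have hsm : ContDiffOn ℝ (⊤ : ℕ∞) Ψ (Metric.ball ((x0, 0) : E × ℝ) r) := by
    have h1 : ContDiffOn ℝ (⊤ : ℕ∞) (fun q => φ.symm (q, 0)) (Metric.ball ((x0, 0) : E × ℝ) r) :=
      hφs.comp (contDiff_id.prodMk contDiff_const).contDiffOn (fun q hq => (hball q hq).1)
    have h2 : ContDiffOn ℝ (⊤ : ℕ∞) γ (Metric.ball ((x0, 0) : E × ℝ) r) :=
      contDiff_snd.comp_contDiffOn h1
    exact (ContinuousMap.evalCLM ℝ one : C(I, E) →L[ℝ] E).contDiff.comp_contDiffOn h2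
  have hint : ∀ x t, (x, t) ∈ Metric.ball ((x0, 0) : E × ℝ) r →
      Ψ (x, t) = x + ∫ s in (0:ℝ)..t, G (Ψ (x, s)) := by
    intro x t hxt
    have h2 := DFunLike.congr_fun (hγ _ hxt) one
    simp only [R, ContinuousMap.add_apply, ContinuousMap.smul_apply, intC_apply] at h2
    refine h2.trans ?_
    congr 1
    have h3 := intervalIntegral.smul_integral_comp_mul_left (a := 0) (b := 1)
        (fun s => G (Ψ (x, s))) t
    rw [mul_zero, mul_one] at h3
    rw [← h3]
    congr 1
    apply intervalIntegral.integral_congr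
    intro u hu
    rw [uIcc_of_le zero_le_one] at hu
    simp only
    rw [IccExtend_of_mem _ _ hu, ← hscale x t hxt ⟨u, hu⟩]
    rfl
  refine ⟨Ψ, Metric.ball (x0, 0) r, Metric.isOpen_ball, Metric.mem_ball_self hr, hsm, ?_, ?_⟩
  · rintro ⟨x, t⟩ hp rfl
    rw [hint x 0 hp]; simp
  · rintro ⟨x, t⟩ hp
    have hx := ((hmem x t).1 hp).1
    have ht := ((hmem x t).1 hp).2
    have hcon : ContinuousOn (fun s => G (Ψ (x, s))) (Metric.ball 0 r) := by
      refine hG.continuous.comp_continuousOn (hsm.continuousOn.comp (by fun_prop) ?_)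
      intro s hs
      exact (hmem x s).2 ⟨hx, by simpa using hs⟩
    have htb : t ∈ Metric.ball (0:ℝ) r := by simpa using ht
    have h0b : (0:ℝ) ∈ Metric.ball (0:ℝ) r := Metric.mem_ball_self hr
    have hd := intervalIntegral.integral_hasDerivAt_right (a := 0) (b := t)
      (f := fun s => G (Ψ (x, s)))
      ((hcon.mono ((convex_ball (0:ℝ) r).ordConnected.uIcc_subset h0b htb)).intervalIntegrable)
      (hcon.stronglyMeasurableAtFilter Metric.isOpen_ball t htb)
      (hcon.continuousAt (Metric.isOpen_ball.mem_nhds htb))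
    refine (hd.const_add x).congr_of_eventuallyEq ?_
    filter_upwards [Metric.isOpen_ball.mem_nhds htb] with s hs
    exact hint x s ((hmem x s).2 ⟨hx, by simpa using hs⟩)

theorem hasDerivAt_w {F : Type} [NormedAddCommGroup F] [NormedSpace ℝ F] {Θ : M3 → F} {y : M3}
    (h : DifferentiableAt ℝ Θ y) :
    HasDerivAt (fun t => Θ (y.1, t)) (fderiv ℝ Θ y ((0, 0), 1)) y.2 := by
  have h1 : HasDerivAt (fun t : ℝ => ((y.1, t) : M3)) ((0, 0), 1) y.2 :=
    (hasDerivAt_const _ _).prodMk (hasDerivAt_id _)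
  exact HasFDerivAt.comp_hasDerivAt y.2 (f := fun t : ℝ => ((y.1, t) : M3)) h.hasFDerivAt h1

theorem flowbox (U : Set M3) (hU : IsOpen U) (ξ₀ : M3) (hξ₀ : ξ₀ ∈ U) (g : M3 → M3) (ρ : M3 → ℝ)
    (hg : ContDiffOn ℝ (⊤ : ℕ∞) g U) (hρ : ContDiffOn ℝ (⊤ : ℕ∞) ρ U) (c1 c2 : M3)
    (hlin : LinearIndependent ℝ ![g ξ₀, c1, c2]) :
    ∃ (φ : OpenPartialHomeomorph M3 M3) (b : M3 → ℝ), (0 : M3) ∈ φ.source ∧ φ 0 = ξ₀ ∧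
      φ.target ⊆ U ∧ ContDiffOn ℝ (⊤ : ℕ∞) φ φ.source ∧ ContDiffOn ℝ (⊤ : ℕ∞) φ.symm φ.target ∧
      ContDiffOn ℝ (⊤ : ℕ∞) b φ.source ∧ (∀ y, b y ≠ 0) ∧
      (∀ y ∈ φ.source, fderiv ℝ φ y ((0, 0), 1) = b y • g (φ y)) ∧
      (∀ y ∈ φ.source, fderiv ℝ b y ((0, 0), 1) = -(ρ (φ y) / 3) * b y ^ 2) := by
  let G : M3 × ℝ → M3 × ℝ := fun p => (Real.exp p.2 • g p.1, -(ρ p.1 / 3) * Real.exp p.2)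
  have hUo : IsOpen (U ×ˢ (univ : Set ℝ)) := hU.prod isOpen_univ
  have hG : ContDiffOn ℝ (⊤ : ℕ∞) G (U ×ˢ univ) := by
    have h1 : ContDiffOn ℝ (⊤ : ℕ∞) (fun p : M3 × ℝ => g p.1) (U ×ˢ univ) :=
      hg.comp contDiff_fst.contDiffOn (fun p hp => hp.1)
    have h2 : ContDiffOn ℝ (⊤ : ℕ∞) (fun p : M3 × ℝ => ρ p.1) (U ×ˢ univ) :=
      hρ.comp contDiff_fst.contDiffOn (fun p hp => hp.1)
    have h3 : ContDiffOn ℝ (⊤ : ℕ∞) (fun p : M3 × ℝ => Real.exp p.2) (U ×ˢ univ) :=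
      (Real.contDiff_exp.comp contDiff_snd).contDiffOn
    exact (h3.smul h1).prodMk ((h2.div_const 3).neg.mul h3)
  obtain ⟨G', hG's, ⟨L, hL⟩, hGG'⟩ := cutoff G _ hUo hG (ξ₀, 0) ⟨hξ₀, mem_univ _⟩
  obtain ⟨N, hNG, hN, hN0⟩ := eventually_nhds_iff.1 hGG'
  obtain ⟨Ψ, O, hO, hO0, hΨ, hΨ0, hΨt⟩ := flow_exists G' hG's L hL ((ξ₀, 0) : M3 × ℝ)
  let ι : M3 → (M3 × ℝ) × ℝ := fun y => ((ξ₀ + y.1.1 • c1 + y.1.2 • c2, 0), y.2)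
  have hι : ContDiff ℝ (⊤ : ℕ∞) ι := by
    simp only [ι]; fun_prop
  have hι0 : ι 0 = ((ξ₀, 0), 0) := by simp [ι]
  let Θ : M3 → M3 × ℝ := fun y => Ψ (ι y)
  have hιO : IsOpen (ι ⁻¹' O) := hO.preimage hι.continuous
  have hΘ : ContDiffOn ℝ (⊤ : ℕ∞) Θ (ι ⁻¹' O) := hΨ.comp hι.contDiffOn (fun y hy => hy)
  let O1 := ι ⁻¹' O ∩ Θ ⁻¹' (N ∩ U ×ˢ univ)
  have hO1 : IsOpen O1 := hΘ.continuousOn.isOpen_inter_preimage hιO (hN.inter hUo)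
  have hΘ0 : Θ 0 = (ξ₀, 0) := by
    simp only [Θ, hι0]
    exact hΨ0 _ hO0 rfl
  have h0O1 : (0 : M3) ∈ O1 := by
    refine ⟨?_, ?_⟩
    · rw [mem_preimage, hι0]; exact hO0
    · rw [mem_preimage, hΘ0]; exact ⟨hN0, hξ₀, mem_univ _⟩
  have hdiff : ∀ y ∈ O1, DifferentiableAt ℝ Θ y := fun y hy =>
    (hΘ.contDiffAt (hιO.mem_nhds hy.1)).differentiableAt (by simp)
  have hw : ∀ y ∈ O1, fderiv ℝ Θ y ((0, 0), 1) = G (Θ y) := by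
    intro y hy
    have h1 := hasDerivAt_w (hdiff y hy)
    have h2 := hΨt (ι y) hy.1
    rw [← hNG _ hy.2.1]
    exact h1.unique h2
  let θ : M3 → M3 := fun y => (Θ y).1
  let b : M3 → ℝ := fun y => Real.exp (Θ y).2
  have hθs : ContDiffOn ℝ (⊤ : ℕ∞) θ O1 := contDiff_fst.comp_contDiffOn (hΘ.mono inter_subset_left)
  have hbs : ContDiffOn ℝ (⊤ : ℕ∞) b O1 :=
    (Real.contDiff_exp.comp contDiff_snd).comp_contDiffOn (hΘ.mono inter_subset_left)
  have hθd : ∀ y ∈ O1, HasFDerivAt θ ((ContinuousLinearMap.fst ℝ M3 ℝ).comp (fderiv ℝ Θ y)) y :=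
    fun y hy => (hdiff y hy).hasFDerivAt.fst
  have hbd : ∀ y ∈ O1, HasFDerivAt b
      (Real.exp (Θ y).2 • (ContinuousLinearMap.snd ℝ M3 ℝ).comp (fderiv ℝ Θ y)) y :=
    fun y hy => (hdiff y hy).hasFDerivAt.snd.exp
  have hθw : ∀ y ∈ O1, fderiv ℝ θ y ((0, 0), 1) = b y • g (θ y) := by
    intro y hy
    rw [(hθd y hy).fderiv, ContinuousLinearMap.comp_apply, hw y hy]
    rfl
  have hbw : ∀ y ∈ O1, fderiv ℝ b y ((0, 0), 1) = -(ρ (θ y) / 3) * b y ^ 2 := by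
    intro y hy
    rw [(hbd y hy).fderiv, smul_apply, ContinuousLinearMap.comp_apply, hw y hy]
    simp only [G, b, θ, ContinuousLinearMap.coe_snd', smul_eq_mul]
    ring
  -- derivative at zero
  have hθx : ∀ p q : ℝ, fderiv ℝ θ 0 ((p, q), 0) = p • c1 + q • c2 := by
    intro p q
    have h1 : HasDerivAt (fun t : ℝ => (((t * p, t * q), 0) : M3)) ((p, q), 0) 0 := by
      have hp : HasDerivAt (fun t : ℝ => t * p) p 0 := by
        simpa using (hasDerivAt_id (0:ℝ)).mul_const p
      have hq : HasDerivAt (fun t : ℝ => t * q) q 0 := by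
        simpa using (hasDerivAt_id (0:ℝ)).mul_const q
      exact (hp.prodMk hq).prodMk (hasDerivAt_const _ _)
    have h2 : HasFDerivAt θ (fderiv ℝ θ 0) (((0 * p, 0 * q), 0) : M3) := by
      have : (((0 * p, 0 * q), 0) : M3) = 0 := by simp
      rw [this]
      exact (hθd 0 h0O1).differentiableAt.hasFDerivAt
    have h3 := HasFDerivAt.comp_hasDerivAt (0:ℝ)
      (f := fun t : ℝ => (((t * p, t * q), 0) : M3)) h2 h1
    have h4 : HasDerivAt (fun t : ℝ => ξ₀ + (t * p) • c1 + (t * q) • c2) (p • c1 + q • c2) 0 := by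
      have hp : HasDerivAt (fun t : ℝ => (t * p) • c1) (p • c1) 0 := by
        have := ((hasDerivAt_id (0:ℝ)).mul_const p).smul_const c1
        simpa using this
      have hq : HasDerivAt (fun t : ℝ => (t * q) • c2) (q • c2) 0 := by
        have := ((hasDerivAt_id (0:ℝ)).mul_const q).smul_const c2
        simpa using this
      exact (hp.const_add ξ₀).add hq
    refine h3.unique (h4.congr_of_eventuallyEq ?_)
    have hc : ContinuousAt (fun t : ℝ => (((t * p, t * q), 0) : M3)) 0 := h1.continuousAt
    have hev : ∀ᶠ t in nhds (0:ℝ), (((t * p, t * q), 0) : M3) ∈ O1 := by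
      apply hc.eventually
      change ∀ᶠ y in nhds (((0 * p, 0 * q), 0) : M3), y ∈ O1
      have : (((0 * p, 0 * q), 0) : M3) = 0 := by simp
      rw [this]
      exact hO1.mem_nhds h0O1
    filter_upwards [hev] with t ht
    have := hΨ0 _ ht.1 rfl
    exact congrArg Prod.fst this
  have hinj : Function.Injective (fderiv ℝ θ 0) := by
    rw [injective_iff_map_eq_zero]
    rintro ⟨⟨p, q⟩, r⟩ h
    have hdec : (((p, q), r) : M3) = ((p, q), 0) + r • ((0, 0), 1) := by simp
    rw [hdec, map_add, map_smul, hθx, hθw 0 h0O1] at h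
    have hb0 : b 0 = 1 := by simp [b, hΘ0]
    have hθ0 : θ 0 = ξ₀ := by simp [θ, hΘ0]
    rw [hb0, hθ0, one_smul] at h
    rw [Fintype.linearIndependent_iff] at hlin
    have h5 := hlin ![r, p, q] (by
      rw [Fin.sum_univ_three]
      simp only [Matrix.cons_val_zero, Matrix.cons_val_one, Matrix.cons_val]
      rw [← h]; abel)
    have e0 := h5 0
    have e1 := h5 1
    have e2 := h5 2
    simp at e0 e1 e2
    simp [e0, e1, e2]
  let e : M3 ≃L[ℝ] M3 :=
    (LinearEquiv.ofInjectiveEndo (fderiv ℝ θ 0 : M3 →ₗ[ℝ] M3) hinj).toContinuousLinearEquiv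
  have he : HasFDerivAt θ (e : M3 →L[ℝ] M3) 0 := by
    refine (hθd 0 h0O1).differentiableAt.hasFDerivAt.congr_fderiv ?_
    ext <;> rfl
  obtain ⟨φ, h0φ, hφO, hφθ, -, hφs⟩ := inv_smooth θ O1 hO1 hθs 0 h0O1 e he
  have hφθ' : (φ : M3 → M3) = θ := funext hφθ
  refine ⟨φ, b, h0φ, ?_, ?_, ?_, hφs, hbs.mono hφO, fun y => (Real.exp_pos _).ne', ?_, ?_⟩
  · rw [hφθ]; simp [θ, hΘ0]
  · intro ξ hξ
    rw [← φ.right_inv hξ, hφθ]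
    exact (hφO (φ.map_target hξ)).2.2.1
  · rw [hφθ']; exact hθs.mono hφO
  · intro y hy; rw [hφθ']; exact hθw y (hφO hy)
  · intro y hy; rw [hφθ']; exact hbw y (hφO hy)

theorem lieB_smooth {O : Set M3} (hO : IsOpen O) {A B : M3 → M3}
    (hA : ContDiffOn ℝ (⊤ : ℕ∞) A O) (hB : ContDiffOn ℝ (⊤ : ℕ∞) B O) :
    ContDiffOn ℝ (⊤ : ℕ∞) (lieB A B) O := by
  have h1 : ContDiffOn ℝ (⊤ : ℕ∞) (fderiv ℝ B) O := hB.fderiv_of_isOpen hO (by simp)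
  have h2 : ContDiffOn ℝ (⊤ : ℕ∞) (fderiv ℝ A) O := hA.fderiv_of_isOpen hO (by simp)
  exact (h1.clm_apply hA).sub (h2.clm_apply hB)

theorem lieD_smooth {O : Set M3} (hO : IsOpen O) {A : M3 → M3} {h : M3 → ℝ}
    (hA : ContDiffOn ℝ (⊤ : ℕ∞) A O) (hh : ContDiffOn ℝ (⊤ : ℕ∞) h O) :
    ContDiffOn ℝ (⊤ : ℕ∞) (lieD A h) O := by
  have h1 : ContDiffOn ℝ (⊤ : ℕ∞) (fderiv ℝ h) O := hh.fderiv_of_isOpen hO (by simp)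
  exact h1.clm_apply hA

theorem sm_diff {O : Set M3} (hO : IsOpen O) {F : Type} [NormedAddCommGroup F] [NormedSpace ℝ F]
    {A : M3 → F} (hA : ContDiffOn ℝ (⊤ : ℕ∞) A O) {ξ : M3} (hξ : ξ ∈ O) : DifferentiableAt ℝ A ξ :=
  (hA.contDiffAt (hO.mem_nhds hξ)).differentiableAt (by simp)

theorem fderiv_congr_on {O : Set M3} (hO : IsOpen O) {F : Type} [NormedAddCommGroup F]
    [NormedSpace ℝ F] {A B : M3 → F} (h : ∀ ξ ∈ O, A ξ = B ξ) {ξ : M3} (hξ : ξ ∈ O) :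
    fderiv ℝ A ξ = fderiv ℝ B ξ := by
  apply Filter.EventuallyEq.fderiv_eq
  filter_upwards [hO.mem_nhds hξ] with η hη using h η hη

theorem lieB_congr {O : Set M3} (hO : IsOpen O) {A A' B B' : M3 → M3}
    (hA : ∀ ξ ∈ O, A ξ = A' ξ) (hB : ∀ ξ ∈ O, B ξ = B' ξ) {ξ : M3} (hξ : ξ ∈ O) :
    lieB A B ξ = lieB A' B' ξ := by
  simp only [lieB, fderiv_congr_on hO hA hξ, fderiv_congr_on hO hB hξ, hA ξ hξ, hB ξ hξ]

theorem lieD_congr {O : Set M3} (hO : IsOpen O) {A : M3 → M3} {h h' : M3 → ℝ}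
    (hh : ∀ ξ ∈ O, h ξ = h' ξ) {ξ : M3} (hξ : ξ ∈ O) :
    lieD A h ξ = lieD A h' ξ := by
  simp only [lieD, fderiv_congr_on hO hh hξ]

theorem lieD_mul {A : M3 → M3} {h k : M3 → ℝ} {ξ : M3} (hh : DifferentiableAt ℝ h ξ)
    (hk : DifferentiableAt ℝ k ξ) :
    lieD A (fun η => h η * k η) ξ = h ξ * lieD A k ξ + k ξ * lieD A h ξ := by
  simp only [lieD]
  rw [fderiv_fun_mul hh hk]
  simp

theorem lieD_const_mul {A : M3 → M3} {h : M3 → ℝ} {ξ : M3} (c : ℝ)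
    (hh : DifferentiableAt ℝ h ξ) :
    lieD A (fun η => c * h η) ξ = c * lieD A h ξ := by
  simp only [lieD]
  rw [fderiv_const_mul hh]
  simp

theorem lieD_vec {A B : M3 → M3} {h : M3 → ℝ} {ξ : M3} {c : ℝ} (hAB : A ξ = c • B ξ) :
    lieD A h ξ = c * lieD B h ξ := by
  simp [lieD, hAB]

theorem lie_step {O : Set M3} (hO : IsOpen O) {G g X Y Z : M3 → M3} {b p q s : M3 → ℝ}
    (hg : ContDiffOn ℝ (⊤ : ℕ∞) g O) (hY : ContDiffOn ℝ (⊤ : ℕ∞) Y O)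
    (hZ : ContDiffOn ℝ (⊤ : ℕ∞) Z O)
    (hb : ContDiffOn ℝ (⊤ : ℕ∞) b O) (hp : ContDiffOn ℝ (⊤ : ℕ∞) p O)
    (hq : ContDiffOn ℝ (⊤ : ℕ∞) q O) (hs : ContDiffOn ℝ (⊤ : ℕ∞) s O)
    (hG : ∀ ξ ∈ O, G ξ = b ξ • g ξ)
    (hX : ∀ ξ ∈ O, X ξ = p ξ • Y ξ + q ξ • Z ξ + s ξ • g ξ) :
    ∃ s' : M3 → ℝ, ContDiffOn ℝ (⊤ : ℕ∞) s' O ∧ ∀ ξ ∈ O, lieB G X ξ =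
      (b ξ * p ξ) • lieB g Y ξ + (b ξ * lieD g p ξ) • Y ξ + (b ξ * q ξ) • lieB g Z ξ
        + (b ξ * lieD g q ξ) • Z ξ + s' ξ • g ξ := by
  have hXs : ContDiffOn ℝ (⊤ : ℕ∞) X O :=
    (((hp.smul hY).add (hq.smul hZ)).add (hs.smul hg)).congr hX
  refine ⟨fun ξ => b ξ * lieD g s ξ - lieD X b ξ,
    (hb.mul (lieD_smooth hO hg hs)).sub (lieD_smooth hO hXs hb), ?_⟩
  intro ξ hξ
  have dg := (sm_diff hO hg hξ).hasFDerivAt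
  have dY := (sm_diff hO hY hξ).hasFDerivAt
  have dZ := (sm_diff hO hZ hξ).hasFDerivAt
  have db := (sm_diff hO hb hξ).hasFDerivAt
  have dp := (sm_diff hO hp hξ).hasFDerivAt
  have dq := (sm_diff hO hq hξ).hasFDerivAt
  have ds := (sm_diff hO hs hξ).hasFDerivAt
  have e1 : fderiv ℝ G ξ = b ξ • fderiv ℝ g ξ + (fderiv ℝ b ξ).smulRight (g ξ) := by
    rw [fderiv_congr_on hO hG hξ]
    exact (db.smul dg).fderiv
  have e2 : fderiv ℝ X ξ = (p ξ • fderiv ℝ Y ξ + (fderiv ℝ p ξ).smulRight (Y ξ))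
      + (q ξ • fderiv ℝ Z ξ + (fderiv ℝ q ξ).smulRight (Z ξ))
      + (s ξ • fderiv ℝ g ξ + (fderiv ℝ s ξ).smulRight (g ξ)) := by
    rw [fderiv_congr_on hO hX hξ]
    exact (((dp.smul dY).add (dq.smul dZ)).add (ds.smul dg)).fderiv
  simp only [lieB, lieD]
  rw [e1, e2, hG ξ hξ]
  simp only [add_apply, smul_apply, ContinuousLinearMap.smulRight_apply,
    map_smul]
  rw [hX ξ hξ]
  simp only [map_add, map_smul, smul_eq_mul]
  module

theorem feedback {O : Set M3} (hO : IsOpen O) {f g H G : M3 → M3} {a b : M3 → ℝ}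
    (hf : ContDiffOn ℝ (⊤ : ℕ∞) f O) (hg : ContDiffOn ℝ (⊤ : ℕ∞) g O)
    (ha : ContDiffOn ℝ (⊤ : ℕ∞) a O) (hb : ContDiffOn ℝ (⊤ : ℕ∞) b O)
    (hH : ∀ ξ ∈ O, H ξ = f ξ + a ξ • g ξ) (hG : ∀ ξ ∈ O, G ξ = b ξ • g ξ) :
    ∃ s1 s2 s3 : M3 → ℝ, ContDiffOn ℝ (⊤ : ℕ∞) s1 O ∧ ContDiffOn ℝ (⊤ : ℕ∞) s2 O ∧
      ContDiffOn ℝ (⊤ : ℕ∞) s3 O ∧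
      (∀ ξ ∈ O, lieB G H ξ = b ξ • lieB g f ξ + s1 ξ • g ξ) ∧
      (∀ ξ ∈ O, lieB G (lieB G H) ξ = (b ξ * b ξ) • lieB g (lieB g f) ξ +
        (b ξ * lieD g b ξ) • lieB g f ξ + s2 ξ • g ξ) ∧
      (∀ ξ ∈ O, lieB G (lieB G (lieB G H)) ξ = (b ξ ^ 3) • lieB g (lieB g (lieB g f)) ξ +
        (3 * b ξ ^ 2 * lieD g b ξ) • lieB g (lieB g f) ξ +
        (b ξ * lieD g (fun η => b η * lieD g b η) ξ) • lieB g f ξ + s3 ξ • g ξ) := by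
  have h1 := lieB_smooth hO hg hf
  have h2 := lieB_smooth hO hg h1
  have c0 : ContDiffOn ℝ (⊤ : ℕ∞) (fun _ : M3 => (0:ℝ)) O := contDiffOn_const
  have c1 : ContDiffOn ℝ (⊤ : ℕ∞) (fun _ : M3 => (1:ℝ)) O := contDiffOn_const
  have hLb := lieD_smooth hO hg hb
  have z0 : ∀ ξ, lieD g (fun _ => (0:ℝ)) ξ = 0 := by intro ξ; simp [lieD]
  have z1 : ∀ ξ, lieD g (fun _ => (1:ℝ)) ξ = 0 := by intro ξ; simp [lieD]
  obtain ⟨s1, hs1, e1⟩ := lie_step (X := H) hO hg hf hf hb c1 c0 ha hG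
    (fun ξ hξ => by rw [hH ξ hξ]; module)
  have e1' : ∀ ξ ∈ O, lieB G H ξ = b ξ • lieB g f ξ + s1 ξ • g ξ := by
    intro ξ hξ
    rw [e1 ξ hξ, z0, z1]; module
  obtain ⟨s2, hs2, e2⟩ := lie_step (X := lieB G H) hO hg h1 h1 hb hb c0 hs1 hG
    (fun ξ hξ => by rw [e1' ξ hξ]; module)
  have e2' : ∀ ξ ∈ O, lieB G (lieB G H) ξ = (b ξ * b ξ) • lieB g (lieB g f) ξ +
        (b ξ * lieD g b ξ) • lieB g f ξ + s2 ξ • g ξ := by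
    intro ξ hξ
    rw [e2 ξ hξ, z0]; module
  obtain ⟨s3, hs3, e3⟩ := lie_step (X := lieB G (lieB G H)) (p := fun ξ => b ξ * b ξ)
    (q := fun ξ => b ξ * lieD g b ξ) hO hg h2 h1 hb (hb.mul hb) (hb.mul hLb) hs2 hG e2'
  refine ⟨s1, s2, s3, hs1, hs2, hs3, e1', e2', ?_⟩
  intro ξ hξ
  rw [e3 ξ hξ, lieD_mul (sm_diff hO hb hξ) (sm_diff hO hb hξ)]
  module

theorem LI_tri {u v w u' v' w' : M3} (h : LinearIndependent ℝ ![u, v, w]) {b p q s r t : ℝ}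
    (hb : b ≠ 0) (hp : p ≠ 0) (hq : q ≠ 0) (hu : u' = b • u) (hv : v' = p • v + s • u)
    (hw : w' = q • w + r • v + t • u) : LinearIndependent ℝ ![u', v', w'] := by
  subst hu hv hw
  rw [Fintype.linearIndependent_iff] at h ⊢
  intro c hc
  rw [Fin.sum_univ_three] at hc
  simp only [Matrix.cons_val_zero, Matrix.cons_val_one, Matrix.cons_val] at hc
  have h1 := h ![c 0 * b + c 1 * s + c 2 * t, c 1 * p + c 2 * r, c 2 * q] (by
    rw [Fin.sum_univ_three]
    simp only [Matrix.cons_val_zero, Matrix.cons_val_one, Matrix.cons_val]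
    rw [← hc]; module)
  have e0 := h1 0
  have e1 := h1 1
  have e2 := h1 2
  simp only [Matrix.cons_val_zero, Matrix.cons_val_one, Matrix.cons_val] at e0 e1 e2
  have k2 : c 2 = 0 := by simpa [hq] using e2
  have k1 : c 1 = 0 := by simpa [k2, hp] using e1
  have k0 : c 0 = 0 := by simpa [k2, k1, hb] using e0
  intro i
  fin_cases i <;> assumption

theorem LI_vert {v w : ℝ × ℝ} : LinearIndependent ℝ ![(((0, 0), 1) : M3), (v, 0), (w, 0)] ↔
    LinearIndependent ℝ ![w, v] := by
  rw [Fintype.linearIndependent_iff, Fintype.linearIndependent_iff]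
  constructor
  · intro h c hc
    rw [Fin.sum_univ_two] at hc
    simp only [Matrix.cons_val_zero, Matrix.cons_val_one] at hc
    have h1 := h ![0, c 1, c 0] (by
      rw [Fin.sum_univ_three]
      simp only [Matrix.cons_val_zero, Matrix.cons_val_one, Matrix.cons_val]
      refine Prod.ext ?_ (by simp)
      change ((0:ℝ) • ((0, 0) : ℝ × ℝ)) + c 1 • v + c 0 • w = 0
      rw [← hc]
      module)
    have e1 := h1 1
    have e2 := h1 2
    simp only [Matrix.cons_val_one, Matrix.cons_val] at e1 e2
    intro i
    fin_cases i <;> assumption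
  · intro h c hc
    rw [Fin.sum_univ_three] at hc
    simp only [Matrix.cons_val_zero, Matrix.cons_val_one, Matrix.cons_val] at hc
    have k0 : c 0 = 0 := by simpa using congrArg Prod.snd hc
    have hc1 := congrArg Prod.fst hc
    have h1 := h ![c 2, c 1] (by
      rw [Fin.sum_univ_two]
      simp only [Matrix.cons_val_zero, Matrix.cons_val_one]
      rw [add_comm]
      simpa [k0] using hc1)
    have e1 := h1 0
    have e2 := h1 1
    simp only [Matrix.cons_val_zero, Matrix.cons_val_one] at e1 e2
    intro i
    fin_cases i <;> assumption

theorem lie_related {Φ A1 A2 B1 B2 : M3 → M3} {O V : Set M3} (hO : IsOpen O) (hV : IsOpen V)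
    (hΦ : ContDiffOn ℝ (⊤ : ℕ∞) Φ O) (hOV : ∀ ξ ∈ O, Φ ξ ∈ V)
    (hA1 : ContDiffOn ℝ (⊤ : ℕ∞) A1 O) (hA2 : ContDiffOn ℝ (⊤ : ℕ∞) A2 O)
    (hB1 : ContDiffOn ℝ (⊤ : ℕ∞) B1 V) (hB2 : ContDiffOn ℝ (⊤ : ℕ∞) B2 V)
    (h1 : ∀ ξ ∈ O, fderiv ℝ Φ ξ (A1 ξ) = B1 (Φ ξ))
    (h2 : ∀ ξ ∈ O, fderiv ℝ Φ ξ (A2 ξ) = B2 (Φ ξ)) {ξ : M3} (hξ : ξ ∈ O) :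
    fderiv ℝ Φ ξ (lieB A1 A2 ξ) = lieB B1 B2 (Φ ξ) := by
  have h := VectorField.fderiv_apply_lieBracket (V := A1) (W := A2)
    (hΦ.contDiffAt (hO.mem_nhds hξ)) (by simp only [minSmoothness_of_isRCLikeNormedField]; exact WithTop.coe_le_coe.2 (le_top : (2:ℕ∞) ≤ ⊤))
    (sm_diff hO hA2 hξ) (sm_diff hO hA1 hξ)
  have e1 : fderiv ℝ (fun x => fderiv ℝ Φ x (A1 x)) ξ
      = (fderiv ℝ B1 (Φ ξ)).comp (fderiv ℝ Φ ξ) := by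
    rw [fderiv_congr_on hO h1 hξ]
    exact fderiv_comp ξ (sm_diff hV hB1 (hOV ξ hξ)) (sm_diff hO hΦ hξ)
  have e2 : fderiv ℝ (fun x => fderiv ℝ Φ x (A2 x)) ξ
      = (fderiv ℝ B2 (Φ ξ)).comp (fderiv ℝ Φ ξ) := by
    rw [fderiv_congr_on hO h2 hξ]
    exact fderiv_comp ξ (sm_diff hV hB2 (hOV ξ hξ)) (sm_diff hO hΦ hξ)
  rw [e1, e2] at h
  simp only [ContinuousLinearMap.comp_apply] at h
  rw [h1 ξ hξ, h2 ξ hξ] at h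
  exact h

/-- derivative in the last variable. -/
def dw (P : M3 → ℝ × ℝ) : M3 → ℝ × ℝ := fun y => deriv (fun t => P (y.1, t)) y.2

theorem dw_smooth {V : Set M3} (hV : IsOpen V) {P : M3 → ℝ × ℝ}
    (hP : ContDiffOn ℝ (⊤ : ℕ∞) P V) : ContDiffOn ℝ (⊤ : ℕ∞) (dw P) V := by
  have h1 : ContDiffOn ℝ (⊤ : ℕ∞) (fderiv ℝ P) V := hP.fderiv_of_isOpen hV (by simp)
  have h2 : ContDiffOn ℝ (⊤ : ℕ∞) (fun y => fderiv ℝ P y ((0, 0), 1)) V :=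
    h1.clm_apply contDiffOn_const
  exact h2.congr fun y hy => (hasDerivAt_w (sm_diff hV hP hy)).deriv

theorem push {Φ G H : M3 → M3} {O V : Set M3} (hO : IsOpen O) (hV : IsOpen V)
    (hΦ : ContDiffOn ℝ (⊤ : ℕ∞) Φ O) (hOV : ∀ ξ ∈ O, Φ ξ ∈ V)
    (hG : ContDiffOn ℝ (⊤ : ℕ∞) G O) (hH : ContDiffOn ℝ (⊤ : ℕ∞) H O)
    {P : M3 → ℝ × ℝ} (hP : ContDiffOn ℝ (⊤ : ℕ∞) P V)
    (h1 : ∀ ξ ∈ O, fderiv ℝ Φ ξ (G ξ) = ((0, 0), 1))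
    (h2 : ∀ ξ ∈ O, fderiv ℝ Φ ξ (H ξ) = (P (Φ ξ), 0)) :
    ∀ ξ ∈ O, fderiv ℝ Φ ξ (lieB G H ξ) = (dw P (Φ ξ), 0) := by
  intro ξ hξ
  rw [lie_related (B1 := fun _ => ((0, 0), 1)) (B2 := fun y => (P y, 0)) hO hV hΦ hOV hG hH
    contDiffOn_const (hP.prodMk contDiffOn_const) h1 h2 hξ]
  have hd := sm_diff hV hP (hOV ξ hξ)
  have h3 : HasFDerivAt (fun y => ((P y, 0) : M3)) ((fderiv ℝ P (Φ ξ)).prod 0) (Φ ξ) :=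
    hd.hasFDerivAt.prodMk (hasFDerivAt_const (0:ℝ) _)
  simp only [lieB]
  rw [h3.fderiv, dw, (hasDerivAt_w hd).deriv]
  simp

theorem fwd_alg {O : Set M3} (hO : IsOpen O) {f g H G : M3 → M3} {a b β T : M3 → ℝ}
    (hH : ContDiffOn ℝ (⊤ : ℕ∞) H O) (hG : ContDiffOn ℝ (⊤ : ℕ∞) G O)
    (ha : ContDiffOn ℝ (⊤ : ℕ∞) a O) (hb : ContDiffOn ℝ (⊤ : ℕ∞) b O)
    (hβ : ContDiffOn ℝ (⊤ : ℕ∞) β O) (hT : ContDiffOn ℝ (⊤ : ℕ∞) T O)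
    (hbβ : ∀ ξ ∈ O, b ξ * β ξ = 1)
    (hfH : ∀ ξ ∈ O, f ξ = H ξ + a ξ • G ξ) (hgG : ∀ ξ ∈ O, g ξ = b ξ • G ξ)
    (hLT : ∀ ξ ∈ O, lieD G T ξ = 0)
    (h3 : ∀ ξ ∈ O, lieB G (lieB G (lieB G H)) ξ = T ξ • lieB G H ξ)
    {ξ₀ : M3} (hξ₀ : ξ₀ ∈ O)
    (hLI : LinearIndependent ℝ ![G ξ₀, lieB G H ξ₀, lieB G (lieB G H) ξ₀]) :
    LinearIndependent ℝ ![g ξ₀, lieB g f ξ₀, lieB g (lieB g f) ξ₀] ∧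
      ∃ (ρ τ σ : M3 → ℝ),
          ContDiffOn ℝ (⊤ : ℕ∞) ρ O ∧ ContDiffOn ℝ (⊤ : ℕ∞) τ O ∧ ContDiffOn ℝ (⊤ : ℕ∞) σ O ∧
          (∀ ξ ∈ O, lieB g (lieB g (lieB g f)) ξ
            = ρ ξ • lieB g (lieB g f) ξ + τ ξ • lieB g f ξ + σ ξ • g ξ) ∧
          (∀ ξ ∈ O, lieD g (fun η => 3 * lieD g ρ η - 2 * ρ η ^ 2 - 9 * τ η) ξ
            - (2 / 3) * ρ ξ * (3 * lieD g ρ ξ - 2 * ρ ξ ^ 2 - 9 * τ ξ) = 0) := by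
  obtain ⟨s1, s2, s3, hs1, hs2, hs3, e1, e2, e3⟩ := feedback hO hH hG ha hb hfH hgG
  have hb0 : ∀ ξ ∈ O, b ξ ≠ 0 := fun ξ hξ h => by
    have := hbβ ξ hξ
    rw [h] at this; simp at this
  have hLb := lieD_smooth hO hG hb
  have hLLb := lieD_smooth hO hG hLb
  refine ⟨LI_tri hLI (hb0 _ hξ₀) (hb0 _ hξ₀) (mul_ne_zero (hb0 _ hξ₀) (hb0 _ hξ₀))
    (hgG _ hξ₀) (e1 _ hξ₀) (e2 _ hξ₀), ?_⟩
  have hρ : ContDiffOn ℝ (⊤ : ℕ∞) (fun η => 3 * lieD G b η) O := contDiffOn_const.mul hLb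
  have hτ : ContDiffOn ℝ (⊤ : ℕ∞) (fun η => b η ^ 2 * T η + b η * lieD G (lieD G b) η
      - 2 * lieD G b η ^ 2) O :=
    (((hb.pow 2).mul hT).add (hb.mul hLLb)).sub (contDiffOn_const.mul (hLb.pow 2))
  have hχ : ∀ ξ ∈ O, 3 * lieD g (fun η => 3 * lieD G b η) ξ - 2 * (3 * lieD G b ξ) ^ 2
      - 9 * (b ξ ^ 2 * T ξ + b ξ * lieD G (lieD G b) ξ - 2 * lieD G b ξ ^ 2)
      = -9 * (b ξ * (b ξ * T ξ)) := by
    intro ξ hξ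
    rw [lieD_vec (hgG ξ hξ), lieD_const_mul 3 (sm_diff hO hLb hξ)]
    ring
  refine ⟨fun η => 3 * lieD G b η, fun η => b η ^ 2 * T η + b η * lieD G (lieD G b) η
      - 2 * lieD G b η ^ 2, fun η => (s3 η - (3 * lieD G b η) * s2 η
      - (b η ^ 2 * T η + b η * lieD G (lieD G b) η - 2 * lieD G b η ^ 2) * s1 η) * β η,
      hρ, hτ, ((hs3.sub (hρ.mul hs2)).sub (hτ.mul hs1)).mul hβ, ?_, ?_⟩
  · intro ξ hξ
    have k : ∀ c : ℝ, (c * β ξ) • g ξ = c • G ξ := by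
      intro c
      rw [hgG ξ hξ, smul_smul]
      congr 1
      have := hbβ ξ hξ
      linear_combination c * this
    simp only [k]
    rw [e3 ξ hξ, e2 ξ hξ, e1 ξ hξ, h3 ξ hξ, lieD_mul (sm_diff hO hb hξ) (sm_diff hO hLb hξ)]
    module
  · intro ξ hξ
    rw [lieD_congr hO hχ hξ]
    simp only [hχ ξ hξ]
    have d1 := sm_diff hO hb hξ
    have d2 := sm_diff hO hT hξ
    rw [lieD_vec (hgG ξ hξ), lieD_const_mul (-9) (d1.fun_mul (d1.fun_mul d2)), lieD_mul d1 (d1.fun_mul d2),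
      lieD_mul d1 d2, hLT ξ hξ]
    ring

theorem forward (U : Set M3) (hU : IsOpen U) (ξ₀ : M3) (hξ₀ : ξ₀ ∈ U)
    (f g : M3 → M3) (hf : ContDiffOn ℝ (⊤ : ℕ∞) f U) (hg : ContDiffOn ℝ (⊤ : ℕ∞) g U)
    (hQ : QuadratizableAt f g ξ₀) :
      (LinearIndependent ℝ ![g ξ₀, lieB g f ξ₀, lieB g (lieB g f) ξ₀] ∧
        ∃ (ρ τ σ : M3 → ℝ) (V : Set M3), IsOpen V ∧ ξ₀ ∈ V ∧ V ⊆ U ∧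
          ContDiffOn ℝ (⊤ : ℕ∞) ρ V ∧ ContDiffOn ℝ (⊤ : ℕ∞) τ V ∧ ContDiffOn ℝ (⊤ : ℕ∞) σ V ∧
          (∀ ξ ∈ V, lieB g (lieB g (lieB g f)) ξ
            = ρ ξ • lieB g (lieB g f) ξ + τ ξ • lieB g f ξ + σ ξ • g ξ) ∧
          (∀ ξ ∈ V, lieD g (fun η => 3 * lieD g ρ η - 2 * ρ η ^ 2 - 9 * τ η) ξ
            - (2 / 3) * ρ ξ * (3 * lieD g ρ ξ - 2 * ρ ξ ^ 2 - 9 * τ ξ) = 0)) := by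
  obtain ⟨F, τq, V, hV, hF, hτq, hLI, hF3, Φ, α, β, U', hU', hξ₀', hΦ, hbij, hΦV, hα, hβ, hβ0,
    hΦf, hΦg⟩ := hQ
  set O := U ∩ U' with hOdef
  have hO : IsOpen O := hU.inter hU'
  have hξO : ξ₀ ∈ O := ⟨hξ₀, hξ₀'⟩
  have hf' := hf.mono (inter_subset_left (t := U'))
  have hg' := hg.mono (inter_subset_left (t := U'))
  have hΦ' := hΦ.mono (inter_subset_right (s := U))
  have hα' := hα.mono (inter_subset_right (s := U))
  have hβ' := hβ.mono (inter_subset_right (s := U))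
  let H : M3 → M3 := fun ξ => f ξ + α ξ • g ξ
  let G : M3 → M3 := fun ξ => β ξ • g ξ
  have hH : ContDiffOn ℝ (⊤ : ℕ∞) H O := hf'.add (hα'.smul hg')
  have hG : ContDiffOn ℝ (⊤ : ℕ∞) G O := hβ'.smul hg'
  let P : M3 → ℝ × ℝ := fun p => F p.1 p.2
  have hOV : ∀ ξ ∈ O, Φ ξ ∈ V := fun ξ hξ => hΦV ξ hξ.2
  have p0 : ∀ ξ ∈ O, fderiv ℝ Φ ξ (H ξ) = (P (Φ ξ), 0) := fun ξ hξ => hΦf ξ hξ.2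
  have pG : ∀ ξ ∈ O, fderiv ℝ Φ ξ (G ξ) = ((0, 0), 1) := fun ξ hξ => hΦg ξ hξ.2
  have hH1 := lieB_smooth hO hG hH
  have hH2 := lieB_smooth hO hG hH1
  have hP1 := dw_smooth hV hF
  have hP2 := dw_smooth hV hP1
  have p1 := push hO hV hΦ' hOV hG hH hF pG p0
  have p2 := push hO hV hΦ' hOV hG hH1 hP1 pG p1
  have p3 := push hO hV hΦ' hOV hG hH2 hP2 pG p2
  have hfst : IsOpen (Prod.fst '' V) := isOpenMap_fst V hV
  have hΦfst : ContDiffOn ℝ (⊤ : ℕ∞) (fun ξ => (Φ ξ).1) O := hΦ'.fst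
  let T : M3 → ℝ := fun ξ => τq (Φ ξ).1
  have hT : ContDiffOn ℝ (⊤ : ℕ∞) T O :=
    hτq.comp hΦfst (fun ξ hξ => mem_image_of_mem _ (hOV ξ hξ))
  have hLT : ∀ ξ ∈ O, lieD G T ξ = 0 := by
    intro ξ hξ
    have dq : HasFDerivAt τq (fderiv ℝ τq (Φ ξ).1) (Φ ξ).1 :=
      ((hτq.contDiffAt (hfst.mem_nhds (mem_image_of_mem _ (hOV ξ hξ)))).differentiableAt
        (by simp)).hasFDerivAt
    have d1 := (sm_diff hO hΦ' hξ).hasFDerivAt.fst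
    have d2 : HasFDerivAt T _ ξ := HasFDerivAt.comp ξ dq d1
    simp only [lieD]
    rw [d2.fderiv]
    simp only [ContinuousLinearMap.comp_apply]
    rw [pG ξ hξ]
    exact map_zero _
  have hA3 : ∀ ξ ∈ O, lieB G (lieB G (lieB G H)) ξ = T ξ • lieB G H ξ := by
    intro ξ hξ
    apply (hbij ξ hξ.2).1
    rw [map_smul, p3 ξ hξ, p1 ξ hξ]
    have : dw (dw (dw P)) (Φ ξ) = T ξ • dw P (Φ ξ) := hF3 _ (hOV ξ hξ)
    change (dw (dw (dw P)) (Φ ξ), (0:ℝ)) = T ξ • (dw P (Φ ξ), (0:ℝ))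
    rw [this]; simp
  have hLI0 : LinearIndependent ℝ ![G ξ₀, lieB G H ξ₀, lieB G (lieB G H) ξ₀] := by
    apply LinearIndependent.of_comp (fderiv ℝ Φ ξ₀).toLinearMap
    have : (⇑(fderiv ℝ Φ ξ₀).toLinearMap ∘ ![G ξ₀, lieB G H ξ₀, lieB G (lieB G H) ξ₀])
        = ![((0, 0), 1), (dw P (Φ ξ₀), 0), (dw (dw P) (Φ ξ₀), 0)] := by
      funext i
      fin_cases i
      · exact pG ξ₀ hξO
      · exact p1 ξ₀ hξO
      · exact p2 ξ₀ hξO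
    rw [this]
    exact LI_vert.2 (hLI _ (hOV ξ₀ hξO))
  have hβi : ContDiffOn ℝ (⊤ : ℕ∞) (fun ξ => (β ξ)⁻¹) O := hβ'.inv (fun ξ hξ => hβ0 ξ hξ.2)
  obtain ⟨r1, ρ, τ, σ, r2⟩ := fwd_alg (f := f) (g := g) (a := fun ξ => -(α ξ) * (β ξ)⁻¹) hO hH hG
    (hα'.neg.mul hβi) hβi hβ' hT
    (fun ξ hξ => inv_mul_cancel₀ (hβ0 ξ hξ.2))
    (fun ξ hξ => by
      simp only [H, G, smul_smul]
      rw [mul_assoc, inv_mul_cancel₀ (hβ0 ξ hξ.2)]; module)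
    (fun ξ hξ => by
      simp only [G, smul_smul]
      rw [inv_mul_cancel₀ (hβ0 ξ hξ.2), one_smul])
    hLT hA3 hξO hLI0
  exact ⟨r1, ρ, τ, σ, O, hO, hξO, inter_subset_left, r2⟩

theorem bwd_alg {O : Set M3} (hO : IsOpen O) {f g H G : M3 → M3} {α β ρ τ σ : M3 → ℝ}
    (hf : ContDiffOn ℝ (⊤ : ℕ∞) f O) (hg : ContDiffOn ℝ (⊤ : ℕ∞) g O)
    (hα : ContDiffOn ℝ (⊤ : ℕ∞) α O) (hβ : ContDiffOn ℝ (⊤ : ℕ∞) β O)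
    (hρ : ContDiffOn ℝ (⊤ : ℕ∞) ρ O) (hτ : ContDiffOn ℝ (⊤ : ℕ∞) τ O)
    (hβ0 : ∀ ξ ∈ O, β ξ ≠ 0)
    (hH : ∀ ξ ∈ O, H ξ = f ξ + α ξ • g ξ) (hG : ∀ ξ ∈ O, G ξ = β ξ • g ξ)
    (hLβ : ∀ ξ ∈ O, lieD g β ξ = -(ρ ξ / 3) * β ξ)
    (h3 : ∀ ξ ∈ O, lieB g (lieB g (lieB g f)) ξ
            = ρ ξ • lieB g (lieB g f) ξ + τ ξ • lieB g f ξ + σ ξ • g ξ)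
    (hχ : ∀ ξ ∈ O, lieD g (fun η => 3 * lieD g ρ η - 2 * ρ η ^ 2 - 9 * τ η) ξ
            - (2 / 3) * ρ ξ * (3 * lieD g ρ ξ - 2 * ρ ξ ^ 2 - 9 * τ ξ) = 0)
    (hLI : ∀ ξ ∈ O, LinearIndependent ℝ ![g ξ, lieB g f ξ, lieB g (lieB g f) ξ]) :
    (∀ ξ ∈ O, LinearIndependent ℝ ![G ξ, lieB G H ξ, lieB G (lieB G H) ξ]) ∧
    ∃ T : M3 → ℝ, ContDiffOn ℝ (⊤ : ℕ∞) T O ∧ (∀ ξ ∈ O, lieD g T ξ = 0) ∧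
      ∀ ξ ∈ O, ∃ c : ℝ, lieB G (lieB G (lieB G H)) ξ = T ξ • lieB G H ξ + c • G ξ := by
  obtain ⟨s1, s2, s3, hs1, hs2, hs3, e1, e2, e3⟩ := feedback hO hf hg hα hβ hH hG
  refine ⟨fun ξ hξ => LI_tri (hLI ξ hξ) (hβ0 ξ hξ) (hβ0 ξ hξ) (mul_ne_zero (hβ0 ξ hξ) (hβ0 ξ hξ))
    (hG ξ hξ) (e1 ξ hξ) (e2 ξ hξ), ?_⟩
  have hLρ := lieD_smooth hO hg hρ
  have hχs : ContDiffOn ℝ (⊤ : ℕ∞) (fun η => 3 * lieD g ρ η - 2 * ρ η ^ 2 - 9 * τ η) O :=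
    ((contDiffOn_const.mul hLρ).sub (contDiffOn_const.mul (hρ.pow 2))).sub
      (contDiffOn_const.mul hτ)
  refine ⟨fun ξ => (-1/9) * (β ξ * (β ξ * (3 * lieD g ρ ξ - 2 * ρ ξ ^ 2 - 9 * τ ξ))),
    contDiffOn_const.mul (hβ.mul (hβ.mul hχs)), ?_, ?_⟩
  · intro ξ hξ
    have d1 := sm_diff hO hβ hξ
    have d2 := sm_diff hO hχs hξ
    rw [lieD_const_mul (-1/9) (d1.fun_mul (d1.fun_mul d2)), lieD_mul d1 (d1.fun_mul d2), lieD_mul d1 d2,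
      hLβ ξ hξ]
    have := hχ ξ hξ
    linear_combination (-1/9 * β ξ * β ξ) * this
  · intro ξ hξ
    have d1 := sm_diff hO hβ hξ
    have d2 := sm_diff hO hρ hξ
    have k1 : ∀ η ∈ O, β η * lieD g β η = (-1/3) * (ρ η * (β η * β η)) := by
      intro η hη
      rw [hLβ η hη]; ring
    have k2 : lieD g (fun η => β η * lieD g β η) ξ
        = β ξ ^ 2 * (-(lieD g ρ ξ) / 3 + 2 * ρ ξ ^ 2 / 9) := by
      rw [lieD_congr hO k1 hξ, lieD_const_mul (-1/3) (d2.fun_mul (d1.fun_mul d1)),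
        lieD_mul d2 (d1.fun_mul d1), lieD_mul d1 d1, hLβ ξ hξ]
      ring
    have k : ∀ c : ℝ, c • g ξ = (c * (β ξ)⁻¹) • G ξ := by
      intro c
      rw [hG ξ hξ, smul_smul, mul_assoc, inv_mul_cancel₀ (hβ0 ξ hξ), mul_one]
    refine ⟨(β ξ ^ 3 * σ ξ + s3 ξ - ((-1/9) * (β ξ * (β ξ * (3 * lieD g ρ ξ - 2 * ρ ξ ^ 2
      - 9 * τ ξ)))) * s1 ξ) * (β ξ)⁻¹, ?_⟩
    rw [← k, e3 ξ hξ, e1 ξ hξ, h3 ξ hξ, k2, hLβ ξ hξ]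
    module

theorem backward (U : Set M3) (hU : IsOpen U) (ξ₀ : M3)
    (f g : M3 → M3) (hf : ContDiffOn ℝ (⊤ : ℕ∞) f U) (hg : ContDiffOn ℝ (⊤ : ℕ∞) g U)
    (hLI : LinearIndependent ℝ ![g ξ₀, lieB g f ξ₀, lieB g (lieB g f) ξ₀])
    (ρ τ σ : M3 → ℝ) (V : Set M3) (hV : IsOpen V) (hξV : ξ₀ ∈ V) (hVU : V ⊆ U)
    (hρ : ContDiffOn ℝ (⊤ : ℕ∞) ρ V) (hτ : ContDiffOn ℝ (⊤ : ℕ∞) τ V)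
    (h3 : ∀ ξ ∈ V, lieB g (lieB g (lieB g f)) ξ
            = ρ ξ • lieB g (lieB g f) ξ + τ ξ • lieB g f ξ + σ ξ • g ξ)
    (hχ : ∀ ξ ∈ V, lieD g (fun η => 3 * lieD g ρ η - 2 * ρ η ^ 2 - 9 * τ η) ξ
            - (2 / 3) * ρ ξ * (3 * lieD g ρ ξ - 2 * ρ ξ ^ 2 - 9 * τ ξ) = 0) :
    QuadratizableAt f g ξ₀ := by
  have hfV := hf.mono hVU
  have hgV := hg.mono hVU
  obtain ⟨φ, b, h0s, hφ0, hφV, hφs, hφsymm, hbs, hb0, hφw, hbw⟩ :=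
    flowbox V hV ξ₀ hξV g ρ hgV hρ (lieB g f ξ₀) (lieB g (lieB g f) ξ₀) hLI
  have ha1 := lieB_smooth hV hgV hfV
  have ha2 := lieB_smooth hV hgV ha1
  let N : Set M3 := V ∩ (fun ξ => ![g ξ, lieB g f ξ, lieB g (lieB g f) ξ]) ⁻¹'
    {v | LinearIndependent ℝ v}
  have hN : IsOpen N := by
    apply ContinuousOn.isOpen_inter_preimage _ hV isOpen_setOfPred_linearIndependent
    rw [continuousOn_pi]
    intro i
    fin_cases i
    · exact hgV.continuousOn
    · exact ha1.continuousOn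
    · exact ha2.continuousOn
  have hξN : ξ₀ ∈ N := ⟨hξV, hLI⟩
  have hS : IsOpen (φ.source ∩ φ ⁻¹' N) := φ.isOpen_inter_preimage hN
  have h0S : (0 : M3) ∈ φ.source ∩ φ ⁻¹' N := ⟨h0s, by simpa [hφ0] using hξN⟩
  obtain ⟨r, hr, hball⟩ := Metric.isOpen_iff.1 hS 0 h0S
  let Y : Set M3 := Metric.ball 0 r
  have hY : IsOpen Y := Metric.isOpen_ball
  let Φ : M3 → M3 := φ.symm
  let O : Set M3 := φ.target ∩ Φ ⁻¹' Y
  have hO : IsOpen O := φ.symm.isOpen_inter_preimage hY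
  have hYs : Y ⊆ φ.source := fun y hy => (hball hy).1
  have hOt : O ⊆ φ.target := inter_subset_left
  have hOY : ∀ ξ ∈ O, Φ ξ ∈ Y := fun ξ hξ => hξ.2
  have hφΦ : ∀ ξ ∈ O, φ (Φ ξ) = ξ := fun ξ hξ => φ.right_inv hξ.1
  have hΦφ : ∀ y ∈ Y, Φ (φ y) = y := fun y hy => φ.left_inv (hYs hy)
  have hφO : ∀ y ∈ Y, φ y ∈ O := fun y hy =>
    ⟨φ.map_source (hYs hy), by change Φ (φ y) ∈ Y; rw [hΦφ y hy]; exact hy⟩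
  have hON : O ⊆ N := fun ξ hξ => by
    have := (hball (hOY ξ hξ)).2
    rwa [mem_preimage, hφΦ ξ hξ] at this
  have hOV : O ⊆ V := fun ξ hξ => (hON hξ).1
  have hξO : ξ₀ ∈ O := by
    have := hφO 0 (Metric.mem_ball_self hr)
    rwa [hφ0] at this
  have hΦs : ContDiffOn ℝ (⊤ : ℕ∞) Φ O := hφsymm.mono hOt
  have hφY : ContDiffOn ℝ (⊤ : ℕ∞) φ Y := hφs.mono hYs
  have hbY : ContDiffOn ℝ (⊤ : ℕ∞) b Y := hbs.mono hYs
  have inv1 : ∀ ξ ∈ O, ∀ v, fderiv ℝ φ (Φ ξ) (fderiv ℝ Φ ξ v) = v := by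
    intro ξ hξ v
    have d1 := (sm_diff hO hΦs hξ).hasFDerivAt
    have d2 := (sm_diff hY hφY (hOY ξ hξ)).hasFDerivAt
    have d3 : HasFDerivAt (fun η => φ (Φ η)) _ ξ := HasFDerivAt.comp ξ d2 d1
    have d4 := fderiv_congr_on hO hφΦ hξ
    rw [d3.fderiv, fderiv_fun_id] at d4
    have := congrArg (fun L : M3 →L[ℝ] M3 => L v) d4
    simpa using this
  have inv2 : ∀ ξ ∈ O, ∀ v, fderiv ℝ Φ ξ (fderiv ℝ φ (Φ ξ) v) = v := by
    intro ξ hξ v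
    have hy := hOY ξ hξ
    have d1 := (sm_diff hY hφY hy).hasFDerivAt
    have d2 := (sm_diff hO hΦs (hφO _ hy)).hasFDerivAt
    have d3 : HasFDerivAt (fun η => Φ (φ η)) _ (Φ ξ) := HasFDerivAt.comp (Φ ξ) d2 d1
    have d4 := fderiv_congr_on hY hΦφ hy
    rw [d3.fderiv, fderiv_fun_id, hφΦ ξ hξ] at d4
    have := congrArg (fun L : M3 →L[ℝ] M3 => L v) d4
    simpa using this
  have hbij : ∀ ξ ∈ O, Function.Bijective (fderiv ℝ Φ ξ) := fun ξ hξ =>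
    Function.bijective_iff_has_inverse.2 ⟨fderiv ℝ φ (Φ ξ), inv1 ξ hξ, inv2 ξ hξ⟩
  let β : M3 → ℝ := fun ξ => b (Φ ξ)
  have hβ : ContDiffOn ℝ (⊤ : ℕ∞) β O := hbY.comp hΦs hOY
  have hβ0 : ∀ ξ ∈ O, β ξ ≠ 0 := fun ξ _ => hb0 _
  have hfO := hfV.mono hOV
  have hgO := hgV.mono hOV
  let G : M3 → M3 := fun ξ => β ξ • g ξ
  have hG : ContDiffOn ℝ (⊤ : ℕ∞) G O := hβ.smul hgO
  have pG : ∀ ξ ∈ O, fderiv ℝ Φ ξ (G ξ) = ((0, 0), 1) := by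
    intro ξ hξ
    have := hφw (Φ ξ) (hYs (hOY ξ hξ))
    rw [hφΦ ξ hξ] at this
    change fderiv ℝ Φ ξ (b (Φ ξ) • g ξ) = _
    rw [← this, inv2 ξ hξ]
  have pg : ∀ ξ ∈ O, fderiv ℝ Φ ξ (g ξ) = (β ξ)⁻¹ • ((0, 0), 1) := by
    intro ξ hξ
    rw [← pG ξ hξ, ← map_smul]
    simp only [G]
    rw [smul_smul, inv_mul_cancel₀ (hβ0 ξ hξ), one_smul]
  have hLβ : ∀ ξ ∈ O, lieD g β ξ = -(ρ ξ / 3) * β ξ := by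
    intro ξ hξ
    have d1 := (sm_diff hO hΦs hξ).hasFDerivAt
    have d2 := (sm_diff hY hbY (hOY ξ hξ)).hasFDerivAt
    have d3 : HasFDerivAt β _ ξ := HasFDerivAt.comp ξ d2 d1
    simp only [lieD]
    rw [d3.fderiv, ContinuousLinearMap.comp_apply, pg ξ hξ, map_smul, hbw _ (hYs (hOY ξ hξ)),
      hφΦ ξ hξ]
    have := hβ0 ξ hξ
    change (β ξ)⁻¹ * (-(ρ ξ / 3) * β ξ ^ 2) = _
    field_simp
  let D : M3 → M3 := fun ξ => fderiv ℝ Φ ξ (f ξ)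
  have hD : ContDiffOn ℝ (⊤ : ℕ∞) D O :=
    (hΦs.fderiv_of_isOpen hO (by simp) : ContDiffOn ℝ (⊤ : ℕ∞) (fderiv ℝ Φ) O).clm_apply hfO
  let α : M3 → ℝ := fun ξ => -(β ξ * (D ξ).2)
  have hα : ContDiffOn ℝ (⊤ : ℕ∞) α O := (hβ.mul hD.snd).neg
  let H : M3 → M3 := fun ξ => f ξ + α ξ • g ξ
  have hH : ContDiffOn ℝ (⊤ : ℕ∞) H O := hfO.add (hα.smul hgO)
  let F : (ℝ × ℝ) → ℝ → ℝ × ℝ := fun x w => (D (φ (x, w))).1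
  let P : M3 → ℝ × ℝ := fun p => F p.1 p.2
  have hP : ContDiffOn ℝ (⊤ : ℕ∞) P Y := (hD.comp hφY hφO).fst
  have p0 : ∀ ξ ∈ O, fderiv ℝ Φ ξ (H ξ) = (P (Φ ξ), 0) := by
    intro ξ hξ
    have e : P (Φ ξ) = (D ξ).1 := by
      change (D (φ (Φ ξ))).1 = _
      rw [hφΦ ξ hξ]
    rw [e]
    simp only [H]
    rw [map_add, map_smul, pg ξ hξ, smul_smul]
    have e2 : α ξ * (β ξ)⁻¹ = -(D ξ).2 := by
      have := hβ0 ξ hξ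
      simp only [α]
      field_simp
    rw [e2]
    change D ξ + _ = _
    ext <;> simp
  obtain ⟨hLI2, T, hT, hLT, hA3⟩ := bwd_alg (H := H) (G := G) (σ := σ) hO hfO hgO hα hβ
    (hρ.mono hOV) (hτ.mono hOV) hβ0 (fun _ _ => rfl) (fun _ _ => rfl) hLβ
    (fun ξ hξ => h3 ξ (hOV hξ)) (fun ξ hξ => hχ ξ (hOV hξ)) (fun ξ hξ => (hON hξ).2)
  have hH1 := lieB_smooth hO hG hH
  have hH2 := lieB_smooth hO hG hH1
  have hP1 := dw_smooth hY hP
  have hP2 := dw_smooth hY hP1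
  have p1 := push hO hY hΦs hOY hG hH hP pG p0
  have p2 := push hO hY hΦs hOY hG hH1 hP1 pG p1
  have p3 := push hO hY hΦs hOY hG hH2 hP2 pG p2
  have memY : ∀ x : ℝ × ℝ, ∀ w : ℝ, (x, w) ∈ Y ↔ ‖x‖ < r ∧ w ∈ Metric.ball (0:ℝ) r := by
    intro x w
    simp only [Y, mem_ball_zero_iff, Prod.norm_mk, max_lt_iff]
  have hTφ : ContDiffOn ℝ (⊤ : ℕ∞) (fun y => T (φ y)) Y := hT.comp hφY hφO
  have hTw : ∀ y ∈ Y, fderiv ℝ (fun y => T (φ y)) y ((0, 0), 1) = 0 := by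
    intro y hy
    have d1 := (sm_diff hY hφY hy).hasFDerivAt
    have d2 := (sm_diff hO hT (hφO y hy)).hasFDerivAt
    have d3 : HasFDerivAt (fun y => T (φ y)) _ y := HasFDerivAt.comp y d2 d1
    rw [d3.fderiv, ContinuousLinearMap.comp_apply, hφw y (hYs hy), map_smul]
    have := hLT _ (hφO y hy)
    simp only [lieD] at this
    rw [this, smul_zero]
  have hTc : ∀ x : ℝ × ℝ, ∀ w : ℝ, (x, w) ∈ Y → T (φ (x, w)) = T (φ (x, 0)) := by
    intro x w hxw
    have hx := (memY x w).1 hxw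
    have hd : ∀ t ∈ Metric.ball (0:ℝ) r, HasDerivAt (fun t => T (φ (x, t))) 0 t := by
      intro t ht
      have hy : (x, t) ∈ Y := (memY x t).2 ⟨hx.1, ht⟩
      have := hasDerivAt_w (sm_diff hY hTφ hy)
      rwa [hTw _ hy] at this
    exact Metric.isOpen_ball.is_const_of_deriv_eq_zero
      (convex_ball (0:ℝ) r).isPreconnected
      (fun t ht => (hd t ht).differentiableAt.differentiableWithinAt)
      (fun t ht => (hd t ht).deriv) hx.2 (Metric.mem_ball_self hr)
  refine ⟨F, fun x => T (φ (x, 0)), Y, hY, hP, ?_, ?_, ?_, Φ, α, β, O, hO, hξO, hΦs, hbij, hOY,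
    hα, hβ, hβ0, p0, pG⟩
  · have hmap : MapsTo (fun x : ℝ × ℝ => ((x, 0) : M3)) (Prod.fst '' Y) Y := by
      rintro _ ⟨⟨x, w⟩, hy, rfl⟩
      exact (memY x 0).2 ⟨((memY x w).1 hy).1, Metric.mem_ball_self hr⟩
    have hs : ContDiff ℝ (⊤ : ℕ∞) (fun x : ℝ × ℝ => ((x, 0) : M3)) :=
      contDiff_id.prodMk contDiff_const
    exact hTφ.comp hs.contDiffOn hmap
  · intro y hy
    change LinearIndependent ℝ ![dw (dw P) y, dw P y]
    have hξ := hφO y hy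
    have q1 := p1 _ hξ
    have q2 := p2 _ hξ
    have qG := pG _ hξ
    rw [hΦφ y hy] at q1 q2
    rw [← LI_vert]
    have h := (hLI2 _ hξ).map' (fderiv ℝ Φ (φ y)).toLinearMap
      (LinearMap.ker_eq_bot.2 (hbij _ hξ).1)
    have e : (⇑(fderiv ℝ Φ (φ y)).toLinearMap ∘
        ![G (φ y), lieB G H (φ y), lieB G (lieB G H) (φ y)])
        = ![((0, 0), 1), (dw P y, 0), (dw (dw P) y, 0)] := by
      funext i
      fin_cases i
      · exact qG
      · exact q1
      · exact q2
    rw [e] at h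
    exact h
  · rintro ⟨x, w⟩ hy
    change dw (dw (dw P)) (x, w) = T (φ (x, 0)) • dw P (x, w)
    have hξ := hφO _ hy
    have q1 := p1 _ hξ
    have q3 := p3 _ hξ
    have qG := pG _ hξ
    rw [hΦφ _ hy] at q1 q3
    obtain ⟨c, hc⟩ := hA3 _ hξ
    rw [hc, map_add, map_smul, map_smul, q1, qG, hTc x w hy] at q3
    have q4 : T (φ (x, 0)) • dw P (x, w) + c • ((0, 0) : ℝ × ℝ) = dw (dw (dw P)) (x, w) :=
      congrArg Prod.fst q3
    rw [← q4]
    simp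

/-- a control-affine system `ξ̇ = f(ξ) + g(ξ)u` on an open subset of `ℝ³` is
locally feedback equivalent at `ξ₀` to a quadratic control-affine system `Σ_q` if and only if
(C1) `g(ξ₀), [g,f](ξ₀), [g,[g,f]](ξ₀)` are linearly independent, and (C2) the structure
functions `ρ, τ` in `ad_g³f = ρ·ad_g²f + τ·ad_g f + σ·g` satisfy
`L_g χ − (2/3)ρχ = 0` near `ξ₀`, where `χ = 3 L_g ρ − 2ρ² − 9τ`. -/
theorem stmt_5 (U : Set M3) (hU : IsOpen U) (ξ₀ : M3) (hξ₀ : ξ₀ ∈ U)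
    (f g : M3 → M3) (hf : ContDiffOn ℝ (⊤ : ℕ∞) f U) (hg : ContDiffOn ℝ (⊤ : ℕ∞) g U) :
    QuadratizableAt f g ξ₀ ↔
      (LinearIndependent ℝ ![g ξ₀, lieB g f ξ₀, lieB g (lieB g f) ξ₀] ∧
        ∃ (ρ τ σ : M3 → ℝ) (V : Set M3), IsOpen V ∧ ξ₀ ∈ V ∧ V ⊆ U ∧
          ContDiffOn ℝ (⊤ : ℕ∞) ρ V ∧ ContDiffOn ℝ (⊤ : ℕ∞) τ V ∧ ContDiffOn ℝ (⊤ : ℕ∞) σ V ∧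
          (∀ ξ ∈ V, lieB g (lieB g (lieB g f)) ξ
            = ρ ξ • lieB g (lieB g f) ξ + τ ξ • lieB g f ξ + σ ξ • g ξ) ∧
          (∀ ξ ∈ V, lieD g (fun η => 3 * lieD g ρ η - 2 * ρ η ^ 2 - 9 * τ η) ξ
            - (2 / 3) * ρ ξ * (3 * lieD g ρ ξ - 2 * ρ ξ ^ 2 - 9 * τ ξ) = 0)) := by
  constructor
  · exact forward U hU ξ₀ hξ₀ f g hf hg
  · rintro ⟨hLI, ρ, τ, σ, V, hV, hξV, hVU, hρ, hτ, -, h3, hχ⟩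
    exact backward U hU ξ₀ f g hf hg hLI ρ τ σ V hV hξV hVU hρ hτ h3 hχ
end
end

section
/- Let f, g be smooth vector fields on an open subset of ℝ³, ξ₀ a point where g, [g,f], [g,[g,f]] are linearly independent, and suppose the structure functions ρ, τ defined by ad_g³f = ρ·ad_g²f + τ·ad_g f + σ·g satisfy L_gχ − (2/3)ρχ = 0 near ξ₀, where χ = 3L_gρ − 2ρ² − 9τ. Then, locally around ξ₀: the system ξ̇ = f + gu is feedback equivalent to an elliptic system Σ_E (second extension of ẋ = A(x)cos w + B(x)sin w + C(x), with A, B, C smooth vector fields on ℝ², A(x) and B(x) linearly independent) if and only if χ(ξ₀) > 0; it is feedback equivalent to a hyperbolic system Σ_H (second extension of ẋ = A cosh w + B sinh w + C, A∧B ≠ 0) if and only if χ(ξ₀) < 0; and it is feedback equivalent to a parabolic system Σ_P (second extension of ẋ = A w² + B w + C, A∧B ≠ 0) if and only if χ ≡ 0 on a neighbourhood of ξ₀. -/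
noncomputable section

open Set

/-- Feedback equivalence at `ξ₀` to a second extension `ẋ = F(x,w), ẇ = u`, where
`F x w = c₁(w) • A x + c₂(w) • B x + C x` for given scalar shape functions `c₁, c₂` and
smooth vector fields `A, B, C` on `ℝ²` with `A ∧ B ≠ 0`. -/
def EquivToQuadClass (f g : M3 → M3) (ξ₀ : M3) (c₁ c₂ : ℝ → ℝ) : Prop :=
  ∃ (A B C : (ℝ × ℝ) → ℝ × ℝ) (V2 : Set (ℝ × ℝ)), IsOpen V2 ∧
    ContDiffOn ℝ (⊤ : ℕ∞) A V2 ∧ ContDiffOn ℝ (⊤ : ℕ∞) B V2 ∧ ContDiffOn ℝ (⊤ : ℕ∞) C V2 ∧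
    (∀ x ∈ V2, LinearIndependent ℝ ![A x, B x]) ∧
    FbEquivAff f g ξ₀
      (fun ξ => ((c₁ ξ.2 • A ξ.1 + c₂ ξ.2 • B ξ.1 + C ξ.1, (0 : ℝ)) : M3))
      (fun _ => (((0 : ℝ × ℝ), (1 : ℝ)) : M3)) (V2 ×ˢ univ)

namespace FlowAux
open Filter Topology
open scoped ContDiff unitInterval

/-- Pointwise application of an operator-valued continuous map. -/
def applyCLM {K E F G : Type} [TopologicalSpace K] [CompactSpace K]
    [NormedAddCommGroup E] [NormedSpace ℝ E] [NormedAddCommGroup F] [NormedSpace ℝ F]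
    [NormedAddCommGroup G] [NormedSpace ℝ G] (B : G →L[ℝ] E →L[ℝ] F) :
    C(K, G) →L[ℝ] C(K, E) →L[ℝ] C(K, F) :=
  LinearMap.mkContinuous₂
    (LinearMap.mk₂ ℝ (fun (a : C(K, G)) (h : C(K, E)) =>
        (⟨fun t => B (a t) (h t), (B.continuous.comp a.continuous).clm_apply h.continuous⟩ : C(K, F)))
      (fun a b h => by ext; simp) (fun c a h => by ext; simp)
      (fun a h k => by ext; simp) (fun c a h => by ext; simp)) ‖B‖
    (fun a h => by
      rw [ContinuousMap.norm_le _ (by positivity)]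
      intro t
      have h1 := B.le_opNorm₂ (a t) (h t)
      have h2 := a.norm_coe_le_norm t
      have h3 := h.norm_coe_le_norm t
      simp only [LinearMap.mk₂_apply, ContinuousMap.coe_mk]
      calc ‖B (a t) (h t)‖ ≤ ‖B‖ * ‖a t‖ * ‖h t‖ := h1
        _ ≤ _ := by gcongr)

lemma applyCLM_apply {K E F G : Type} [TopologicalSpace K] [CompactSpace K]
    [NormedAddCommGroup E] [NormedSpace ℝ E] [NormedAddCommGroup F] [NormedSpace ℝ F]
    [NormedAddCommGroup G] [NormedSpace ℝ G] (B : G →L[ℝ] E →L[ℝ] F)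
    (a : C(K, G)) (h : C(K, E)) (t : K) : applyCLM B a h t = B (a t) (h t) := rfl

/-- The superposition operator. -/
def sup {K E F : Type} [TopologicalSpace K] [TopologicalSpace E] [TopologicalSpace F]
    (v : E → F) (hv : Continuous v) (γ : C(K, E)) : C(K, F) := ⟨fun t => v (γ t), hv.comp γ.continuous⟩

lemma continuous_sup {K E F : Type} [TopologicalSpace K] [TopologicalSpace E] [TopologicalSpace F]
    (v : E → F) (hv : Continuous v) : Continuous (sup (K := K) v hv) :=
  ContinuousMap.continuous_postcomp ⟨v, hv⟩

lemma hasFDerivAt_sup {K E F G : Type} [TopologicalSpace K] [CompactSpace K]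
    [NormedAddCommGroup E] [NormedSpace ℝ E] [NormedAddCommGroup F] [NormedSpace ℝ F]
    [NormedAddCommGroup G] [NormedSpace ℝ G] (B : G →L[ℝ] E →L[ℝ] F)
    (hB : ∀ a, ‖B a‖ ≤ ‖a‖)
    (v : E → F) (hv : Continuous v) (v' : E → G) (hd : ∀ x, HasFDerivAt v (B (v' x)) x)
    (hv' : Continuous v') (γ : C(K, E)) :
    HasFDerivAt (sup (K := K) v hv) (applyCLM B (sup (K := K) v' hv' γ)) γ := by
  rw [hasFDerivAt_iff_isLittleO_nhds_zero, Asymptotics.isLittleO_iff]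
  intro c hc
  have hcont := (continuous_sup (K := K) v' hv').continuousAt (x := γ)
  obtain ⟨δ, hδ, H⟩ := (Metric.continuousAt_iff (α := C(K, E)) (β := C(K, G))).1 hcont c hc
  filter_upwards [Metric.ball_mem_nhds (0 : C(K, E)) hδ] with h hh
  rw [mem_ball_zero_iff] at hh
  rw [ContinuousMap.norm_le _ (by positivity)]
  intro t
  have key : ‖v (γ t + h t) - v (γ t) - B (v' (γ t)) (γ t + h t - γ t)‖
      ≤ c * ‖γ t + h t - γ t‖ := by
    refine (convex_segment (𝕜 := ℝ) (γ t) (γ t + h t)).norm_image_sub_le_of_norm_fderiv_le'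
      (fun x _ => (hd x).differentiableAt) ?_ (left_mem_segment ℝ _ _) (right_mem_segment ℝ _ _)
    intro y hy
    rw [segment_eq_image'] at hy
    obtain ⟨s, hs, rfl⟩ := hy
    have h1 : dist (γ + s • h) γ < δ := by
      rw [dist_eq_norm, add_sub_cancel_left, norm_smul, Real.norm_of_nonneg hs.1]
      nlinarith [hs.2, norm_nonneg h]
    have h2 := (H h1).le
    rw [dist_eq_norm, ContinuousMap.norm_le _ hc.le] at h2
    have h3 := h2 t
    rw [(hd _).fderiv, ← map_sub]
    refine (hB _).trans ?_
    simpa [sup] using h3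
  have h4 : ‖h t‖ ≤ ‖h‖ := h.norm_coe_le_norm t
  simp only [add_sub_cancel_left] at key
  calc _ = ‖v (γ t + h t) - v (γ t) - B (v' (γ t)) (h t)‖ := by
        simp [sup, applyCLM_apply]
    _ ≤ c * ‖h t‖ := key
    _ ≤ c * ‖h‖ := by gcongr

lemma contDiff_sup_nat {K E : Type} [TopologicalSpace K] [CompactSpace K]
    [NormedAddCommGroup E] [NormedSpace ℝ E] (n : ℕ) :
    ∀ {F : Type} [NormedAddCommGroup F] [NormedSpace ℝ F]
    (v : E → F) (hv : Continuous v) (_ : ContDiff ℝ ∞ v),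
    ContDiff ℝ n (sup (K := K) v hv) := by
  induction n with
  | zero =>
    intro F _ _ v hv h
    exact contDiff_zero.2 (continuous_sup v hv)
  | succ n ih =>
    intro F _ _ v hv h
    have h' : ContDiff ℝ ∞ (fderiv ℝ v) := h.fderiv_right (by simp)
    have hd := hasFDerivAt_sup (K := K) (G := E →L[ℝ] F) (ContinuousLinearMap.id ℝ _)
      (fun a => le_rfl) v hv (fderiv ℝ v)
      (fun x => (h.differentiable (by simp) x).hasFDerivAt) h'.continuous
    have hih := ih (F := E →L[ℝ] F) (fderiv ℝ v) h'.continuous h'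
    have : ((n + 1 : ℕ) : WithTop ℕ∞) = (n : WithTop ℕ∞) + 1 := by push_cast; rfl
    rw [this, contDiff_succ_iff_hasFDerivAt]
    exact ⟨_, (ContinuousLinearMap.contDiff _).comp hih, hd⟩

lemma contDiff_sup {K E F : Type} [TopologicalSpace K] [CompactSpace K]
    [NormedAddCommGroup E] [NormedSpace ℝ E] [NormedAddCommGroup F] [NormedSpace ℝ F]
    (v : E → F) (h : ContDiff ℝ ∞ v) :
    ContDiff ℝ ∞ (sup (K := K) v h.continuous) :=
  contDiff_infty.2 fun n => contDiff_sup_nat n v _ h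

/-- inverse function theorem, smooth version on a neighbourhood -/
lemma exists_inverse {E F : Type} [NormedAddCommGroup E] [NormedSpace ℝ E] [CompleteSpace E]
    [NormedAddCommGroup F] [NormedSpace ℝ F] (f : E → F) (U : Set E) (hU : IsOpen U)
    (hf : ContDiffOn ℝ ∞ f U) (a : E) (ha : a ∈ U) (f' : E ≃L[ℝ] F)
    (hf' : HasFDerivAt f (f' : E →L[ℝ] F) a) :
    ∃ e : OpenPartialHomeomorph E F, a ∈ e.source ∧ e.source ⊆ U ∧ (⇑e = f) ∧
      ContDiffOn ℝ ∞ e.symm e.target ∧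
      ∀ x ∈ e.source, ∃ fx : E ≃L[ℝ] F, HasFDerivAt f (fx : E →L[ℝ] F) x := by
  have hfa : ContDiffAt ℝ ∞ f a := hf.contDiffAt (hU.mem_nhds ha)
  have hc : ContinuousAt (fderiv ℝ f) a :=
    ((hf.fderiv_of_isOpen (m := ∞) hU (by simp)).contDiffAt (hU.mem_nhds ha)).continuousAt
  have hev : ∀ᶠ x in 𝓝 a, fderiv ℝ f x ∈ range ((↑) : (E ≃L[ℝ] F) → E →L[ℝ] F) := by
    apply hc
    rw [hf'.fderiv]
    exact ContinuousLinearEquiv.nhds f'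
  obtain ⟨V, hVs, hV, haV⟩ := mem_nhds_iff.1 hev
  let e0 := hfa.toOpenPartialHomeomorph f hf' (by simp)
  have hae0 : a ∈ e0.source := hfa.mem_toOpenPartialHomeomorph_source hf' (by simp)
  have hO : IsOpen (U ∩ V) := hU.inter hV
  let e := e0.restrOpen (U ∩ V) hO
  have hes : e.source = e0.source ∩ (U ∩ V) := e0.restrOpen_source _ hO
  have hef : (⇑e = f) := rfl
  have hder : ∀ x ∈ e.source, ∃ fx : E ≃L[ℝ] F, HasFDerivAt f (fx : E →L[ℝ] F) x := by
    intro x hx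
    rw [hes] at hx
    obtain ⟨fx, hfx⟩ := hVs hx.2.2
    refine ⟨fx, ?_⟩
    rw [hfx]
    exact ((hf.contDiffAt (hU.mem_nhds hx.2.1)).differentiableAt (by simp)).hasFDerivAt
  refine ⟨e, ?_, ?_, hef, ?_, hder⟩
  · rw [hes]; exact ⟨hae0, ha, haV⟩
  · rw [hes]; exact fun x hx => hx.2.1
  · intro y hy
    have hx := e.map_target hy
    obtain ⟨fx, hfx⟩ := hder _ hx
    rw [hes] at hx
    exact (e.contDiffAt_symm hy hfx (hf.contDiffAt (hU.mem_nhds hx.2.1))).contDiffWithinAt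

/-- Primitive operator on `C([0,1],E)`. -/
def primFun {E : Type} [NormedAddCommGroup E] [NormedSpace ℝ E] (γ : C(I, E)) : C(I, E) :=
  ⟨fun t => ∫ r in (0:ℝ)..t, γ (projIcc 0 1 zero_le_one r), by
    have h : Continuous fun r : ℝ => γ (projIcc 0 1 zero_le_one r) :=
      γ.continuous.comp continuous_projIcc
    exact (intervalIntegral.continuous_primitive (fun a b => h.intervalIntegrable a b) 0).comp
      continuous_subtype_val⟩

def prim {E : Type} [NormedAddCommGroup E] [NormedSpace ℝ E] : C(I, E) →L[ℝ] C(I, E) :=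
  LinearMap.mkContinuous
    { toFun := primFun
      map_add' := fun a b => by
        ext t
        have h : ∀ γ : C(I, E), Continuous fun r : ℝ => γ (projIcc 0 1 zero_le_one r) :=
          fun γ => γ.continuous.comp continuous_projIcc
        simp only [primFun, ContinuousMap.coe_mk, ContinuousMap.add_apply]
        exact intervalIntegral.integral_add ((h a).intervalIntegrable _ _)
          ((h b).intervalIntegrable _ _)
      map_smul' := fun c a => by
        ext t
        simp [primFun] } 1
    (fun γ => by
      rw [ContinuousMap.norm_le _ (by positivity)]
      intro t
      simp only [LinearMap.coe_mk, AddHom.coe_mk, primFun, ContinuousMap.coe_mk]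
      calc _ ≤ ‖γ‖ * |(t:ℝ) - 0| :=
            intervalIntegral.norm_integral_le_of_norm_le_const
              (fun r _ => γ.norm_coe_le_norm _)
        _ ≤ 1 * ‖γ‖ := by
            rw [sub_zero, abs_of_nonneg t.2.1]
            nlinarith [t.2.2, norm_nonneg γ])

lemma prim_apply {E : Type} [NormedAddCommGroup E] [NormedSpace ℝ E] (γ : C(I, E)) (t : I) :
    prim γ t = ∫ r in (0:ℝ)..t, γ (projIcc 0 1 zero_le_one r) := rfl

/-- The map whose zero set (in the second slot) is the graph of the time-rescaled flow. -/
def gmap {E : Type} [NormedAddCommGroup E] [NormedSpace ℝ E] (v : E → E) (hv : ContDiff ℝ ∞ v)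
    (q : (E × ℝ) × C(I, E)) : (E × ℝ) × C(I, E) :=
  (q.1, q.2 - ContinuousMap.const I q.1.1 - q.1.2 • prim (sup v hv.continuous q.2))

/-- Constants as a continuous linear map. -/
def constL (E : Type) [NormedAddCommGroup E] [NormedSpace ℝ E] : E →L[ℝ] C(I, E) :=
  LinearMap.mkContinuous
    { toFun := fun x => ContinuousMap.const I x
      map_add' := fun a b => by ext; simp
      map_smul' := fun c a => by ext; simp } 1
    (fun x => by
      rw [ContinuousMap.norm_le _ (by positivity)]
      intro t
      simp)

lemma contDiff_gmap {E : Type} [NormedAddCommGroup E] [NormedSpace ℝ E] (v : E → E)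
    (hv : ContDiff ℝ ∞ v) : ContDiff ℝ ∞ (gmap v hv) := by
  have h1 : ContDiff ℝ ∞ (fun q : (E × ℝ) × C(I, E) => constL E q.1.1) :=
    (constL E).contDiff.comp (contDiff_fst.comp contDiff_fst)
  have h2 : ContDiff ℝ ∞ (fun q : (E × ℝ) × C(I, E) => prim (sup v hv.continuous q.2)) :=
    prim.contDiff.comp ((contDiff_sup v hv).comp contDiff_snd)
  exact contDiff_fst.prodMk ((contDiff_snd.sub h1).sub
    ((contDiff_snd.comp contDiff_fst).smul h2))

lemma hasFDerivAt_gmap {E : Type} [NormedAddCommGroup E] [NormedSpace ℝ E] (v : E → E)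
    (hv : ContDiff ℝ ∞ v) (x₀ : E) : ∃ e : ((E × ℝ) × C(I, E)) ≃L[ℝ] ((E × ℝ) × C(I, E)),
    HasFDerivAt (gmap v hv) (e : ((E × ℝ) × C(I, E)) →L[ℝ] ((E × ℝ) × C(I, E)))
      ((x₀, 0), ContinuousMap.const I x₀) := by
  set N := fun q : (E × ℝ) × C(I, E) => prim (sup v hv.continuous q.2) with hN
  set q₀ : (E × ℝ) × C(I, E) := ((x₀, 0), ContinuousMap.const I x₀) with hq₀
  have hNd : HasFDerivAt N (fderiv ℝ N q₀) q₀ := by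
    have h2 : ContDiff ℝ ∞ N :=
      prim.contDiff.comp ((contDiff_sup v hv).comp contDiff_snd)
    exact (h2.differentiable (by simp) q₀).hasFDerivAt
  let T : (E × ℝ) →L[ℝ] C(I, E) := -((constL E).comp (ContinuousLinearMap.fst ℝ E ℝ))
    - (ContinuousLinearMap.snd ℝ E ℝ).smulRight (N q₀)
  let e := (ContinuousLinearEquiv.refl ℝ (E × ℝ)).skewProd (ContinuousLinearEquiv.refl ℝ C(I, E)) T
  refine ⟨e, ?_⟩
  have hfs : HasFDerivAt (fun q : (E × ℝ) × C(I, E) => q.1)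
    (ContinuousLinearMap.fst ℝ (E × ℝ) C(I, E)) q₀ := hasFDerivAt_fst
  have hsn : HasFDerivAt (fun q : (E × ℝ) × C(I, E) => q.2)
    (ContinuousLinearMap.snd ℝ (E × ℝ) C(I, E)) q₀ := hasFDerivAt_snd
  have hc : HasFDerivAt (fun q : (E × ℝ) × C(I, E) => constL E q.1.1)
    ((constL E).comp ((ContinuousLinearMap.fst ℝ E ℝ).comp (ContinuousLinearMap.fst ℝ (E × ℝ) C(I, E)))) q₀ :=
    (constL E).hasFDerivAt.comp q₀ ((ContinuousLinearMap.fst ℝ E ℝ).hasFDerivAt.comp q₀ hfs)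
  have hs : HasFDerivAt (fun q : (E × ℝ) × C(I, E) => q.1.2)
    ((ContinuousLinearMap.snd ℝ E ℝ).comp (ContinuousLinearMap.fst ℝ (E × ℝ) C(I, E))) q₀ :=
    (ContinuousLinearMap.snd ℝ E ℝ).hasFDerivAt.comp q₀ hfs
  have := hfs.prodMk ((hsn.sub hc).sub (hs.smul hNd))
  refine this.congr_fderiv ?_
  ext1 
  · ext p <;> simp [e, T, hq₀]
  · ext p <;> simp [e, T, hq₀]

lemma eq_of_gmap {E : Type} [NormedAddCommGroup E] [NormedSpace ℝ E] {v : E → E}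
    {hv : ContDiff ℝ ∞ v} {p : E × ℝ} {γ : C(I, E)} (h : gmap v hv (p, γ) = (p, 0)) (t : I) :
    γ t = p.1 + p.2 • ∫ r in (0:ℝ)..t, v (γ (projIcc 0 1 zero_le_one r)) := by
  have h1 := congrArg (fun q => q.2 t) h
  simp only [gmap, ContinuousMap.sub_apply, ContinuousMap.smul_apply, prim_apply, sup,
    ContinuousMap.coe_mk, ContinuousMap.const_apply, ContinuousMap.zero_apply] at h1
  rw [sub_sub, sub_eq_zero] at h1
  exact h1

/-- Rescaling of the time interval. -/
def rescale {E : Type} [TopologicalSpace E] (γ : C(I, E)) (t : I) : C(I, E) :=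
  ⟨fun r => γ (t * r), γ.continuous.comp (continuous_const.mul continuous_id)⟩

lemma gmap_rescale {E : Type} [NormedAddCommGroup E] [NormedSpace ℝ E] {v : E → E}
    {hv : ContDiff ℝ ∞ v} {p : E × ℝ} {γ : C(I, E)} (h : gmap v hv (p, γ) = (p, 0)) (t : I) :
    gmap v hv ((p.1, p.2 * t), rescale γ t) = ((p.1, p.2 * t), 0) := by
  refine Prod.ext rfl ?_
  ext r
  have h1 := eq_of_gmap h (t * r)
  simp only [gmap, ContinuousMap.sub_apply, ContinuousMap.smul_apply, prim_apply, sup,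
    ContinuousMap.coe_mk, ContinuousMap.const_apply, ContinuousMap.zero_apply, rescale]
  rw [sub_sub, sub_eq_zero, h1, mul_smul]
  congr 2
  have h2 : ∫ u in (0:ℝ)..r, v (γ (t * projIcc 0 1 zero_le_one u))
      = ∫ u in (0:ℝ)..r, v (γ (projIcc 0 1 zero_le_one (t * u))) := by
    apply intervalIntegral.integral_congr
    intro u hu
    rw [uIcc_of_le r.2.1] at hu
    have hu1 : u ∈ Icc (0:ℝ) 1 := ⟨hu.1, hu.2.trans r.2.2⟩
    have hu2 : (t:ℝ) * u ∈ Icc (0:ℝ) 1 :=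
      ⟨mul_nonneg t.2.1 hu1.1, mul_le_one₀ t.2.2 hu1.1 hu1.2⟩
    simp only [projIcc_of_mem _ hu1, projIcc_of_mem _ hu2]
    rfl
  rw [h2]
  have := intervalIntegral.smul_integral_comp_mul_left (a := 0) (b := (r:ℝ))
    (fun u => v (γ (projIcc 0 1 zero_le_one u))) (t:ℝ)
  rw [this]
  simp

lemma hasDerivWithinAt_of_gmap {E : Type} [NormedAddCommGroup E] [NormedSpace ℝ E]
    [CompleteSpace E] {v : E → E}
    {hv : ContDiff ℝ ∞ v} {p : E × ℝ} {γ : C(I, E)} (h : gmap v hv (p, γ) = (p, 0)) (t : I) :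
    HasDerivWithinAt (fun r => γ (projIcc 0 1 zero_le_one r)) (p.2 • v (γ t)) (Icc 0 1) t := by
  have hc : Continuous fun r : ℝ => v (γ (projIcc 0 1 zero_le_one r)) :=
    hv.continuous.comp (γ.continuous.comp continuous_projIcc)
  have h1 : HasDerivAt (fun r : ℝ => p.1 + p.2 • ∫ u in (0:ℝ)..r, v (γ (projIcc 0 1 zero_le_one u)))
      (p.2 • v (γ (projIcc 0 1 zero_le_one (t:ℝ)))) t :=
    ((hc.integral_hasStrictDerivAt 0 t).hasDerivAt.const_smul p.2).const_add p.1
  rw [projIcc_val] at h1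
  refine h1.hasDerivWithinAt.congr_of_mem ?_ t.2
  intro r hr
  have := eq_of_gmap h ⟨r, hr⟩
  rw [projIcc_of_mem _ hr]
  exact this

theorem exists_flow {E : Type} [NormedAddCommGroup E] [NormedSpace ℝ E]
    [CompleteSpace E] (v : E → E) (hv : ContDiff ℝ ∞ v) (x₀ : E) :
    ∃ (φ : E × ℝ → E) (W : Set (E × ℝ)), IsOpen W ∧ (x₀, 0) ∈ W ∧ ContDiffOn ℝ ∞ φ W ∧
      (∀ x, (x, 0) ∈ W → φ (x, 0) = x) ∧
      ∀ p ∈ W, fderiv ℝ φ p (0, 1) = v (φ p) := by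
  obtain ⟨D, hD⟩ := hasFDerivAt_gmap v hv x₀
  obtain ⟨e, hmem, -, hcoe, hsymm, -⟩ := exists_inverse (gmap v hv) univ isOpen_univ
    (contDiff_gmap v hv).contDiffOn _ (mem_univ _) D hD
  set q₀ : (E × ℝ) × C(I, E) := ((x₀, 0), ContinuousMap.const I x₀) with hq₀
  obtain ⟨δ, hδ, hball⟩ := Metric.isOpen_iff.1 e.open_source _ hmem
  have hg0 : e q₀ = ((x₀, 0), 0) := by
    rw [hcoe]; simp [gmap, hq₀]
  let Γ : E × ℝ → C(I, E) := fun p => (e.symm (p, 0)).2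
  let W0 : Set (E × ℝ) := (fun p => ((p, 0) : (E × ℝ) × C(I, E))) ⁻¹' e.target
  have hW0 : IsOpen W0 := e.open_target.preimage (by fun_prop)
  have hΓ : ContDiffOn ℝ ∞ Γ W0 := by
    have : ContDiffOn ℝ ∞ (fun p : E × ℝ => e.symm (p, 0)) W0 :=
      hsymm.comp (contDiff_id.prodMk contDiff_const).contDiffOn (fun p hp => hp)
    exact contDiff_snd.comp_contDiffOn this
  let W : Set (E × ℝ) := (W0 ∩ Γ ⁻¹' Metric.ball (ContinuousMap.const I x₀) δ)
    ∩ Metric.ball (x₀, 0) δ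
  have hW : IsOpen W :=
    (hΓ.continuousOn.isOpen_inter_preimage hW0 Metric.isOpen_ball).inter Metric.isOpen_ball
  -- characterization
  have hmk : ∀ p ∈ W, gmap v hv (p, Γ p) = (p, 0) := by
    intro p hp
    have h1 : e (e.symm (p, 0)) = (p, 0) := e.right_inv hp.1.1
    rw [hcoe] at h1
    have h2 : (e.symm (p, 0)).1 = p := by
      have := congrArg Prod.fst h1
      exact this
    have h3 : e.symm (p, 0) = (p, Γ p) := Prod.ext h2 rfl
    rw [← h3]; exact h1
  have huniq : ∀ p γ, p ∈ Metric.ball ((x₀, 0) : E × ℝ) δ →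
      γ ∈ Metric.ball (ContinuousMap.const I x₀) δ → gmap v hv (p, γ) = (p, 0) →
      p ∈ W ∧ Γ p = γ := by
    intro p γ hp hγ hg
    have hs : (p, γ) ∈ e.source := by
      apply hball
      rw [hq₀, ← ball_prod_same]
      exact ⟨hp, hγ⟩
    have h1 : e (p, γ) = (p, 0) := by rw [hcoe]; exact hg
    have h2 : e.symm (p, 0) = (p, γ) := by rw [← h1]; exact e.left_inv hs
    have h3 : Γ p = γ := by simp only [Γ, h2]
    refine ⟨⟨⟨?_, ?_⟩, hp⟩, h3⟩
    · change (p, 0) ∈ e.target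
      rw [← h1]; exact e.map_source hs
    · change Γ p ∈ Metric.ball (ContinuousMap.const I x₀) δ
      rw [h3]; exact hγ
  have hx0 : (x₀, 0) ∈ W := by
    refine (huniq (x₀, 0) (ContinuousMap.const I x₀) (Metric.mem_ball_self hδ)
      (Metric.mem_ball_self hδ) ?_).1
    rw [← hcoe]; exact hg0
  let ev : C(I, E) →L[ℝ] E := ContinuousMap.evalCLM ℝ (1 : I)
  let φ : E × ℝ → E := fun p => Γ p 1
  have hφ : ContDiffOn ℝ ∞ φ W :=
    (ev.contDiff.comp_contDiffOn hΓ).mono (fun p hp => hp.1.1)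
  have hscale : ∀ p ∈ W, ∀ t : I, (p.1, p.2 * (t:ℝ)) ∈ W ∧ φ (p.1, p.2 * t) = Γ p t := by
    intro p hp t
    have hb : (p.1, p.2 * (t:ℝ)) ∈ Metric.ball ((x₀, 0) : E × ℝ) δ := by
      have := hp.2
      rw [← ball_prod_same] at this ⊢
      refine ⟨this.1, ?_⟩
      have h2 := this.2
      simp only [Metric.mem_ball, dist_zero_right, Real.norm_eq_abs] at h2 ⊢
      rw [abs_mul, abs_of_nonneg t.2.1]
      have := mul_le_mul_of_nonneg_left t.2.2 (abs_nonneg p.2)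
      linarith
    have hγb : rescale (Γ p) t ∈ Metric.ball (ContinuousMap.const I x₀) δ := by
      have h1 : Γ p ∈ Metric.ball (ContinuousMap.const I x₀) δ := hp.1.2
      rw [Metric.mem_ball, ContinuousMap.dist_lt_iff hδ] at h1 ⊢
      intro r
      exact h1 (t * r)
    obtain ⟨h1, h2⟩ := huniq _ _ hb hγb (gmap_rescale (hmk p hp) t)
    refine ⟨h1, ?_⟩
    simp only [φ, h2, rescale, ContinuousMap.coe_mk, mul_one]
  refine ⟨φ, W, hW, hx0, hφ, ?_, ?_⟩
  · intro x hx
    have := eq_of_gmap (hmk _ hx) 1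
    simpa using this
  · have key : ∀ p ∈ W, p.2 ≠ 0 → ∀ t : I,
        fderiv ℝ φ (p.1, p.2 * (t:ℝ)) (0, 1) = v (φ (p.1, p.2 * t)) := by
      intro p hp hp2 t
      obtain ⟨h1, h2⟩ := hscale p hp t
      have hd := hasDerivWithinAt_of_gmap (hmk p hp) t
      have hdφ : HasFDerivAt φ (fderiv ℝ φ (p.1, p.2 * (t:ℝ))) (p.1, p.2 * (t:ℝ)) :=
        ((hφ.contDiffAt (hW.mem_nhds h1)).differentiableAt (by simp)).hasFDerivAt
      have hl : HasDerivAt (fun r : ℝ => (p.1, p.2 * r)) ((0 : E), p.2) (t : ℝ) := by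
        have := (hasDerivAt_const (t:ℝ) p.1).prodMk ((hasDerivAt_id (t:ℝ)).const_mul p.2)
        simpa using this
      have h3 := (hdφ.comp_hasDerivAt (t:ℝ) hl).hasDerivWithinAt (s := Icc (0:ℝ) 1)
      have h4 : HasDerivWithinAt (fun r => Γ p (projIcc 0 1 zero_le_one r))
          (fderiv ℝ φ (p.1, p.2 * (t:ℝ)) (0, p.2)) (Icc 0 1) t := by
        refine h3.congr_of_mem ?_ t.2
        intro r hr
        rw [projIcc_of_mem _ hr]
        exact ((hscale p hp ⟨r, hr⟩).2).symm
      have h5 := (uniqueDiffOn_Icc (zero_lt_one' ℝ) _ t.2).eq_deriv _ h4 hd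
      have h6 : ((0 : E), p.2) = p.2 • ((0 : E), (1:ℝ)) := by simp
      rw [h6, map_smul] at h5
      rw [h2]
      exact smul_right_injective E hp2 h5
    intro p hp
    by_cases hp2 : p.2 = 0
    · have hev : ∀ᶠ s in 𝓝[≠] (0:ℝ), (p.1, s) ∈ W := by
        have : Tendsto (fun s : ℝ => (p.1, s)) (𝓝[≠] 0) (𝓝 p) := by
          have h : Tendsto (fun s : ℝ => (p.1, s)) (𝓝 0) (𝓝 (p.1, 0)) :=
            Continuous.tendsto (by fun_prop) 0
          rw [← hp2] at h ⊢
          exact h.mono_left nhdsWithin_le_nhds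
        exact this (hW.mem_nhds hp)
      obtain ⟨s, hs, hs0⟩ := (hev.and self_mem_nhdsWithin).exists
      have := key _ hs hs0 0
      have hp' : p = (p.1, 0) := Prod.ext rfl hp2
      rw [hp']
      simpa using this
    · have := key p hp hp2 1
      simpa using this

end FlowAux
namespace FlowAux
open Filter Topology
open scoped ContDiff unitInterval

lemma contDiff_cutoff {E F : Type} [NormedAddCommGroup E] [NormedSpace ℝ E] [FiniteDimensional ℝ E]
    [NormedAddCommGroup F] [NormedSpace ℝ F] (x₀ : E) (U : Set E) (hU : IsOpen U) (b : ContDiffBump x₀)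
    (hb : Metric.closedBall x₀ b.rOut ⊆ U) (v : E → F) (hv : ContDiffOn ℝ ∞ v U) :
    ContDiff ℝ ∞ (fun x => b x • v x) := by
  rw [contDiff_iff_contDiffAt]
  intro x
  by_cases hx : x ∈ U
  · exact b.contDiffAt.smul (hv.contDiffAt (hU.mem_nhds hx))
  · have hx' : x ∈ (tsupport b)ᶜ := by
      rw [b.tsupport_eq]; exact fun h => hx (hb h)
    have : (fun x => b x • v x) =ᶠ[𝓝 x] fun _ => 0 := by
      filter_upwards [(isClosed_tsupport b).isOpen_compl.mem_nhds hx'] with y hy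
      rw [image_eq_zero_of_notMem_tsupport hy, zero_smul]
    exact contDiffAt_const.congr_of_eventuallyEq this

theorem exists_flowbox (v : M3 → M3) (r : M3 → ℝ) (U : Set M3) (hU : IsOpen U) (ξ₀ : M3)
    (hξ₀ : ξ₀ ∈ U) (hv : ContDiffOn ℝ ∞ v U) (hr : ContDiffOn ℝ ∞ r U) (hv0 : v ξ₀ ≠ 0) :
    ∃ (e : OpenPartialHomeomorph M3 M3) (z : M3 → ℝ), ξ₀ ∈ e.source ∧ e.source ⊆ U ∧
      ContDiffOn ℝ ∞ e e.source ∧ ContDiffOn ℝ ∞ e.symm e.target ∧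
      ContDiffOn ℝ ∞ z e.source ∧ (∀ ξ ∈ e.source, Function.Bijective (fderiv ℝ e ξ)) ∧
      (∀ ξ ∈ e.source, fderiv ℝ e ξ (v ξ) = (0, 1)) ∧
      (∀ ξ ∈ e.source, fderiv ℝ z ξ (v ξ) = r ξ) ∧
      (∀ q ∈ e.target, fderiv ℝ e.symm q (0, 1) = v (e.symm q)) := by
  obtain ⟨R, hR, hRU⟩ := Metric.isOpen_iff.1 hU _ hξ₀
  let b : ContDiffBump ξ₀ := ⟨R / 4, R / 2, by positivity, by linarith⟩
  have hbU : Metric.closedBall ξ₀ b.rOut ⊆ U :=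
    (Metric.closedBall_subset_ball (by change R / 2 < R; linarith)).trans hRU
  let N : Set M3 := Metric.ball ξ₀ (R / 4)
  have hN : IsOpen N := Metric.isOpen_ball
  have hNU : N ⊆ U := (Metric.ball_subset_ball (by linarith)).trans hRU
  have hbN : ∀ ξ ∈ N, b ξ = 1 := fun ξ hξ => b.one_of_mem_closedBall (Metric.ball_subset_closedBall hξ)
  have hvc := contDiff_cutoff ξ₀ U hU b hbU v hv
  have hrc := contDiff_cutoff ξ₀ U hU b hbU r hr
  let vE : M3 × ℝ → M3 × ℝ := fun p => (b p.1 • v p.1, b p.1 • r p.1)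
  have hvE : ContDiff ℝ ∞ vE := (hvc.comp contDiff_fst).prodMk (hrc.comp contDiff_fst)
  obtain ⟨φ, W, hW, hx0, hφ, hφ0, hφd⟩ := exists_flow vE hvE (ξ₀, 0)
  obtain ⟨L, hL⟩ : ∃ L : M3 ≃L[ℝ] M3, L (0, 1) = v ξ₀ :=
    SeparatingDual.exists_continuousLinearEquiv_apply_eq (R := ℝ) (by simp) hv0
  let ι : M3 → (M3 × ℝ) × ℝ := fun q => ((ξ₀ + L (q.1, 0), 0), q.2)
  let ι' : M3 →L[ℝ] (M3 × ℝ) × ℝ :=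
    (((L : M3 →L[ℝ] M3).comp ((ContinuousLinearMap.fst ℝ (ℝ × ℝ) ℝ).prod 0)).prod 0).prod
      (ContinuousLinearMap.snd ℝ (ℝ × ℝ) ℝ)
  have hι' : ∀ q, HasFDerivAt ι ι' q := by
    intro q
    have h : ι = fun q => ι' q + ((ξ₀, 0), 0) := by
      funext q; simp [ι, ι', add_comm]
    rw [h]
    exact ι'.hasFDerivAt.add_const _
  have hι : ContDiff ℝ ∞ ι := by
    have h : ι = fun q => ι' q + ((ξ₀, 0), 0) := by
      funext q; simp [ι, ι', add_comm]
    rw [h]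
    exact ι'.contDiff.add contDiff_const
  let Ψ' : M3 → M3 × ℝ := fun q => φ (ι q)
  have hO : IsOpen (ι ⁻¹' W) := hW.preimage hι.continuous
  have hΨ' : ContDiffOn ℝ ∞ Ψ' (ι ⁻¹' W) := hφ.comp hι.contDiffOn (fun q hq => hq)
  let O : Set M3 := (ι ⁻¹' W) ∩ (fun q => (Ψ' q).1) ⁻¹' N
  have hOo : IsOpen O := (hΨ'.continuousOn.fst).isOpen_inter_preimage hO hN
  let Ψ : M3 → M3 := fun q => (Ψ' q).1
  have hι0 : ι 0 = ((ξ₀, 0), 0) := by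
    have : ((0 : M3).1, (0:ℝ)) = (0 : M3) := rfl
    simp [ι, this]
  have h0W : ι 0 ∈ W := by rw [hι0]; exact hx0
  have hΨ'0 : Ψ' 0 = (ξ₀, 0) := by
    change φ (ι 0) = _
    rw [hι0]; exact hφ0 _ hx0
  have h0O : (0 : M3) ∈ O := by
    refine ⟨h0W, ?_⟩
    change (Ψ' 0).1 ∈ N
    rw [hΨ'0]; exact Metric.mem_ball_self (by positivity)
  have hΨ'd : ∀ q ∈ O, HasFDerivAt Ψ' ((fderiv ℝ φ (ι q)).comp ι') q := by
    intro q hq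
    exact ((hφ.contDiffAt (hW.mem_nhds hq.1)).differentiableAt (by simp)).hasFDerivAt.comp q (hι' q)
  have hΨ'1 : ∀ q ∈ O, fderiv ℝ Ψ' q (0, 1) = (v (Ψ q), r (Ψ q)) := by
    intro q hq
    rw [(hΨ'd q hq).fderiv]
    have h1 : ι' (0, 1) = (0, 1) := by
      have : ((0 : ℝ × ℝ), (0:ℝ)) = (0 : M3) := rfl
      simp [ι', this]
    rw [ContinuousLinearMap.comp_apply, h1, hφd _ hq.1]
    have h2 : b (Ψ q) = 1 := hbN _ hq.2
    change (b (Ψ q) • v (Ψ q), b (Ψ q) • r (Ψ q)) = _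
    rw [h2, one_smul, one_smul]
  have hΨc : ContDiffOn ℝ ∞ Ψ O := contDiff_fst.comp_contDiffOn (hΨ'.mono (fun q hq => hq.1))
  have hΨd : ∀ q ∈ O, HasFDerivAt Ψ ((ContinuousLinearMap.fst ℝ M3 ℝ).comp (fderiv ℝ Ψ' q)) q := by
    intro q hq
    exact (ContinuousLinearMap.fst ℝ M3 ℝ).hasFDerivAt.comp q (hΨ'd q hq).differentiableAt.hasFDerivAt
  have hΨL : HasFDerivAt Ψ (L : M3 →L[ℝ] M3) 0 := by
    have h := hΨd 0 h0O
    refine h.congr_fderiv ?_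
    refine ContinuousLinearMap.ext fun q => ?_
    have hq : q = (q.1, 0) + q.2 • ((0 : ℝ × ℝ), (1:ℝ)) := by ext <;> simp
    have h1 : fderiv ℝ Ψ 0 (q.1, 0) = L (q.1, 0) := by
      have hl : HasDerivAt (fun s : ℝ => s • ((q.1, 0) : M3)) ((q.1, 0) : M3) 0 := by
        simpa using (hasDerivAt_id (0:ℝ)).smul_const ((q.1, 0) : M3)
      have hΨ0 : HasFDerivAt Ψ (fderiv ℝ Ψ 0) ((0:ℝ) • ((q.1, 0) : M3)) := by
        rw [zero_smul]; exact h.differentiableAt.hasFDerivAt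
      have h2 := hΨ0.comp_hasDerivAt (0:ℝ) hl
      have h3 : HasDerivAt (fun s : ℝ => ξ₀ + s • L (q.1, 0)) (L (q.1, 0)) 0 := by
        simpa using ((hasDerivAt_id (0:ℝ)).smul_const (L (q.1, 0))).const_add ξ₀
      refine h2.unique (h3.congr_of_eventuallyEq ?_)
      have hc : ContinuousAt (fun s : ℝ => s • ((q.1, 0) : M3)) 0 := hl.continuousAt
      have : ∀ᶠ s in 𝓝 (0:ℝ), s • ((q.1, 0) : M3) ∈ ι ⁻¹' W := by
        apply hc
        change ι ⁻¹' W ∈ 𝓝 ((0:ℝ) • ((q.1, 0) : M3))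
        rw [zero_smul]; exact hO.mem_nhds h0W
      filter_upwards [this] with s hs
      have h4 : ι (s • ((q.1, 0) : M3)) = ((ξ₀ + s • L (q.1, 0), 0), 0) := by
        simp only [ι, ← map_smul]
        simp
      change (φ (ι (s • ((q.1, 0) : M3)))).1 = _
      have hs' : ι (s • ((q.1, 0) : M3)) ∈ W := hs
      rw [h4] at hs' ⊢
      rw [hφ0 _ hs']
    have h2 : fderiv ℝ Ψ 0 (0, 1) = L (0, 1) := by
      rw [h.fderiv, ContinuousLinearMap.comp_apply, hΨ'1 0 h0O, hL]
      change v (Ψ 0) = _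
      have : Ψ 0 = ξ₀ := by change (Ψ' 0).1 = _; rw [hΨ'0]
      rw [this]
    rw [← h.fderiv]
    have hL' : (L : M3 →L[ℝ] M3) q = L q := rfl
    rw [hL']
    calc fderiv ℝ Ψ 0 q = fderiv ℝ Ψ 0 ((q.1, 0) + q.2 • ((0 : ℝ × ℝ), (1:ℝ))) := by rw [← hq]
      _ = L (q.1, 0) + q.2 • L (0, 1) := by rw [map_add, map_smul, h1, h2]
      _ = L ((q.1, 0) + q.2 • ((0 : ℝ × ℝ), (1:ℝ))) := by rw [map_add, map_smul]
      _ = L q := by rw [← hq]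
  obtain ⟨e, hemem, heO, hcoe, hsymm, hder⟩ := exists_inverse Ψ O hOo hΨc 0 h0O L hΨL
  have hΨ0 : Ψ 0 = ξ₀ := by change (Ψ' 0).1 = _; rw [hΨ'0]
  have heξ : e 0 = ξ₀ := by rw [hcoe]; exact hΨ0
  have hsO : ∀ ξ ∈ e.target, e.symm ξ ∈ O := fun ξ hξ => heO (e.map_target hξ)
  have hright : ∀ ξ ∈ e.target, Ψ (e.symm ξ) = ξ := fun ξ hξ => by
    rw [← hcoe]; exact e.right_inv hξ
  have hv1 : ∀ q ∈ O, fderiv ℝ Ψ q (0, 1) = v (Ψ q) := by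
    intro q hq
    rw [(hΨd q hq).fderiv, ContinuousLinearMap.comp_apply, hΨ'1 q hq]; rfl
  have hzc : ContDiffOn ℝ ∞ (fun ξ => (Ψ' (e.symm ξ)).2) e.target :=
    contDiff_snd.comp_contDiffOn (hΨ'.comp hsymm (fun ξ hξ => (hsO ξ hξ).1))
  have gen : ∀ {G : Type} [NormedAddCommGroup G] [NormedSpace ℝ G] (h : M3 → G) (k : M3 → G),
      ∀ ξ ∈ e.target, DifferentiableAt ℝ h ξ → (∀ q ∈ e.source, h (Ψ q) = k q) →
      fderiv ℝ h ξ (v ξ) = fderiv ℝ k (e.symm ξ) (0, 1) := by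
    intro G _ _ h k ξ hξ hd hk
    have hq := hsO ξ hξ
    have h1 : HasFDerivAt h (fderiv ℝ h ξ) (Ψ (e.symm ξ)) := by
      rw [hright ξ hξ]; exact hd.hasFDerivAt
    have h2 := h1.comp (e.symm ξ) (hΨd _ hq)
    have h3 : HasFDerivAt k _ (e.symm ξ) := h2.congr_of_eventuallyEq (by
      filter_upwards [e.open_source.mem_nhds (e.map_target hξ)] with q hq
      exact (hk q hq).symm)
    rw [h3.fderiv, ← (hΨd _ hq).fderiv, ContinuousLinearMap.comp_apply, hv1 _ hq, hright ξ hξ]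
  have hid : ∀ ξ ∈ e.target, HasFDerivAt e.symm (fderiv ℝ e.symm ξ) ξ := fun ξ hξ =>
    ((hsymm.contDiffAt (e.open_target.mem_nhds hξ)).differentiableAt (by simp)).hasFDerivAt
  refine ⟨e.symm, fun ξ => (Ψ' (e.symm ξ)).2, ?_, ?_, hsymm, ?_, hzc, ?_, ?_, ?_, ?_⟩
  · rw [← heξ]; exact e.map_source hemem
  · intro ξ hξ
    have h1 := (hsO ξ hξ).2
    have h2 := hright ξ hξ
    rw [← h2]; exact hNU h1
  · rw [e.symm_symm, hcoe]; exact hΨc.mono heO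
  · intro ξ hξ
    obtain ⟨fx, hfx⟩ := hder _ (e.map_target hξ)
    have h1 : HasFDerivAt e.symm (fx.symm : M3 →L[ℝ] M3) ξ := by
      refine e.hasFDerivAt_symm hξ ?_
      rw [hcoe]; exact hfx
    rw [h1.fderiv]
    exact fx.symm.bijective
  · intro ξ hξ
    rw [gen e.symm id ξ hξ (hid ξ hξ).differentiableAt (fun q hq => by
      rw [← hcoe]; exact e.left_inv hq)]
    simp
  · intro ξ hξ
    have hd : DifferentiableAt ℝ (fun ξ => (Ψ' (e.symm ξ)).2) ξ :=
      (hzc.contDiffAt (e.open_target.mem_nhds hξ)).differentiableAt (by simp)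
    rw [gen _ (fun q => (Ψ' q).2) ξ hξ hd (fun q hq => by
      have : e.symm (Ψ q) = q := by rw [← hcoe]; exact e.left_inv hq
      rw [this])]
    have hq := hsO ξ hξ
    have h1 : HasFDerivAt (fun q => (Ψ' q).2)
        ((ContinuousLinearMap.snd ℝ M3 ℝ).comp (fderiv ℝ Ψ' (e.symm ξ))) (e.symm ξ) :=
      (ContinuousLinearMap.snd ℝ M3 ℝ).hasFDerivAt.comp _ (hΨ'd _ hq).differentiableAt.hasFDerivAt
    rw [h1.fderiv, ContinuousLinearMap.comp_apply, hΨ'1 _ hq]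
    change r (Ψ (e.symm ξ)) = _
    rw [hright ξ hξ]
  · intro q hq
    rw [e.symm_symm, hcoe]
    exact hv1 q (heO hq)

end FlowAux
namespace FlowAux
open Filter Topology
open scoped ContDiff

lemma diffAt {E F : Type} [NormedAddCommGroup E] [NormedSpace ℝ E] [NormedAddCommGroup F]
    [NormedSpace ℝ F] {O : Set E} (hO : IsOpen O) {h : E → F} (hh : ContDiffOn ℝ ∞ h O) {ξ : E}
    (hξ : ξ ∈ O) : DifferentiableAt ℝ h ξ :=
  (hh.contDiffAt (hO.mem_nhds hξ)).differentiableAt (by simp)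

lemma smooth_fderiv {E F : Type} [NormedAddCommGroup E] [NormedSpace ℝ E] [NormedAddCommGroup F]
    [NormedSpace ℝ F] {O : Set E} (hO : IsOpen O) {h : E → F} (hh : ContDiffOn ℝ ∞ h O) :
    ContDiffOn ℝ ∞ (fderiv ℝ h) O := hh.fderiv_of_isOpen hO (by simp)

lemma smooth_lieD {O : Set M3} (hO : IsOpen O) {A : M3 → M3} {h : M3 → ℝ}
    (hA : ContDiffOn ℝ ∞ A O) (hh : ContDiffOn ℝ ∞ h O) : ContDiffOn ℝ ∞ (lieD A h) O :=
  (smooth_fderiv hO hh).clm_apply hA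

lemma smooth_lieB {O : Set M3} (hO : IsOpen O) {A B : M3 → M3}
    (hA : ContDiffOn ℝ ∞ A O) (hB : ContDiffOn ℝ ∞ B O) : ContDiffOn ℝ ∞ (lieB A B) O :=
  ((smooth_fderiv hO hB).clm_apply hA).sub ((smooth_fderiv hO hA).clm_apply hB)

lemma lieD_congr {O : Set M3} (hO : IsOpen O) {A : M3 → M3} {h k : M3 → ℝ}
    (hk : ∀ ξ ∈ O, h ξ = k ξ) {ξ : M3} (hξ : ξ ∈ O) : lieD A h ξ = lieD A k ξ := by
  have : h =ᶠ[𝓝 ξ] k := by filter_upwards [hO.mem_nhds hξ] with y hy using hk y hy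
  simp only [lieD, this.fderiv_eq]

lemma lieD_add {A : M3 → M3} {h k : M3 → ℝ} {ξ : M3} (hh : DifferentiableAt ℝ h ξ)
    (hk : DifferentiableAt ℝ k ξ) :
    lieD A (fun η => h η + k η) ξ = lieD A h ξ + lieD A k ξ := by
  simp only [lieD]
  have h2 : HasFDerivAt (fun η => h η + k η) _ ξ := hh.hasFDerivAt.add hk.hasFDerivAt
  rw [h2.fderiv]; rfl

lemma lieD_sub {A : M3 → M3} {h k : M3 → ℝ} {ξ : M3} (hh : DifferentiableAt ℝ h ξ)
    (hk : DifferentiableAt ℝ k ξ) :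
    lieD A (fun η => h η - k η) ξ = lieD A h ξ - lieD A k ξ := by
  simp only [lieD]
  have h2 : HasFDerivAt (fun η => h η - k η) _ ξ := hh.hasFDerivAt.sub hk.hasFDerivAt
  rw [h2.fderiv]; rfl

lemma lieD_mul {A : M3 → M3} {h k : M3 → ℝ} {ξ : M3} (hh : DifferentiableAt ℝ h ξ)
    (hk : DifferentiableAt ℝ k ξ) :
    lieD A (fun η => h η * k η) ξ = lieD A h ξ * k ξ + h ξ * lieD A k ξ := by
  simp only [lieD]
  have h2 : HasFDerivAt (fun η => h η * k η) _ ξ := hh.hasFDerivAt.mul hk.hasFDerivAt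
  rw [h2.fderiv]
  simp only [add_apply, smul_apply, smul_eq_mul]
  ring

lemma lieD_comp {A : M3 → M3} {c : ℝ → ℝ} {c' : ℝ} {h : M3 → ℝ} {ξ : M3}
    (hc : HasDerivAt c c' (h ξ)) (hh : DifferentiableAt ℝ h ξ) :
    lieD A (fun η => c (h η)) ξ = c' * lieD A h ξ := by
  simp only [lieD]
  have := hc.comp_hasFDerivAt ξ hh.hasFDerivAt
  have h2 : HasFDerivAt (fun η => c (h η)) _ ξ := this
  rw [h2.fderiv]; simp

lemma lieD_const_mul {A : M3 → M3} {c : ℝ} {h : M3 → ℝ} {ξ : M3}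
    (hh : DifferentiableAt ℝ h ξ) :
    lieD A (fun η => c * h η) ξ = c * lieD A h ξ := by
  simp only [lieD]
  rw [(hh.hasFDerivAt.const_mul c).fderiv]; simp

lemma lieD_lieB {O : Set M3} (hO : IsOpen O) {A B : M3 → M3} {h : M3 → ℝ}
    (hA : ContDiffOn ℝ ∞ A O) (hB : ContDiffOn ℝ ∞ B O) (hh : ContDiffOn ℝ ∞ h O) {ξ : M3}
    (hξ : ξ ∈ O) :
    lieD (lieB A B) h ξ = lieD A (lieD B h) ξ - lieD B (lieD A h) ξ := by
  have hd := (diffAt hO (smooth_fderiv hO hh) hξ).hasFDerivAt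
  have e1 : ∀ C : M3 → M3, ContDiffOn ℝ ∞ C O → ∀ X, fderiv ℝ (lieD C h) ξ X
      = fderiv ℝ (fderiv ℝ h) ξ X (C ξ) + fderiv ℝ h ξ (fderiv ℝ C ξ X) := by
    intro C hC X
    have := hd.clm_apply (diffAt hO hC hξ).hasFDerivAt
    have h2 : HasFDerivAt (lieD C h) _ ξ := this
    rw [h2.fderiv]
    simp [add_comm]
  have hs : IsSymmSndFDerivAt ℝ h ξ :=
    (hh.contDiffAt (hO.mem_nhds hξ)).isSymmSndFDerivAt (by simpa using (WithTop.coe_le_coe.2 (le_top : (2 : ℕ∞) ≤ ⊤) : ((2 : ℕ∞) : WithTop ℕ∞) ≤ ∞))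
  have e2 := hs (A ξ) (B ξ)
  change fderiv ℝ h ξ (fderiv ℝ B ξ (A ξ) - fderiv ℝ A ξ (B ξ))
    = fderiv ℝ (lieD B h) ξ (A ξ) - fderiv ℝ (lieD A h) ξ (B ξ)
  rw [e1 B hB, e1 A hA, map_sub, e2]
  ring

/-- For a first integral `X` of `g`, iterated `L_g` of `L_f X`. -/
lemma first_integral {O : Set M3} (hO : IsOpen O) {f g : M3 → M3} {X : M3 → ℝ}
    (hf : ContDiffOn ℝ ∞ f O) (hg : ContDiffOn ℝ ∞ g O) (hX : ContDiffOn ℝ ∞ X O)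
    (h0 : ∀ ξ ∈ O, lieD g X ξ = 0) :
    (∀ ξ ∈ O, lieD g (lieD f X) ξ = lieD (lieB g f) X ξ) := by
  intro ξ hξ
  rw [lieD_lieB hO hg hf hX hξ, lieD_congr hO h0 hξ]
  simp [lieD]

lemma first_integral3 {O : Set M3} (hO : IsOpen O) {f g : M3 → M3} {X ρ τ σ : M3 → ℝ}
    (hf : ContDiffOn ℝ ∞ f O) (hg : ContDiffOn ℝ ∞ g O) (hX : ContDiffOn ℝ ∞ X O)
    (hdec : ∀ ξ ∈ O, lieB g (lieB g (lieB g f)) ξ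
      = ρ ξ • lieB g (lieB g f) ξ + τ ξ • lieB g f ξ + σ ξ • g ξ)
    (h0 : ∀ ξ ∈ O, lieD g X ξ = 0) :
    (∀ ξ ∈ O, lieD g (lieD f X) ξ = lieD (lieB g f) X ξ) ∧
    (∀ ξ ∈ O, lieD g (lieD g (lieD f X)) ξ = lieD (lieB g (lieB g f)) X ξ) ∧
    (∀ ξ ∈ O, lieD g (lieD g (lieD g (lieD f X))) ξ
      = ρ ξ * lieD g (lieD g (lieD f X)) ξ + τ ξ * lieD g (lieD f X) ξ) := by
  have a1 := first_integral hO hf hg hX h0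
  have hf1 := smooth_lieB hO hg hf
  have hf2 := smooth_lieB hO hg hf1
  have a2 : ∀ ξ ∈ O, lieD g (lieD g (lieD f X)) ξ = lieD (lieB g (lieB g f)) X ξ := by
    intro ξ hξ
    rw [lieD_congr hO a1 hξ, first_integral hO hf1 hg hX h0 ξ hξ]
  refine ⟨a1, a2, ?_⟩
  intro ξ hξ
  rw [lieD_congr hO a2 hξ, first_integral hO hf2 hg hX h0 ξ hξ, a2 ξ hξ, a1 ξ hξ]
  have := h0 ξ hξ
  simp only [lieD] at this ⊢
  rw [hdec ξ hξ]
  simp [this]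

/-- `(βD)³` in terms of `D`. -/
lemma scaled3 {O : Set M3} (hO : IsOpen O) {g : M3 → M3} {P β : M3 → ℝ}
    (hg : ContDiffOn ℝ ∞ g O) (hP : ContDiffOn ℝ ∞ P O) (hβ : ContDiffOn ℝ ∞ β O) :
    (∀ ξ ∈ O, lieD g (fun η => β η * lieD g P η) ξ
      = lieD g β ξ * lieD g P ξ + β ξ * lieD g (lieD g P) ξ) ∧
    (∀ ξ ∈ O, lieD g (fun η => β η * lieD g (fun η' => β η' * lieD g P η') η) ξ
      = β ξ ^ 2 * lieD g (lieD g (lieD g P)) ξ + 3 * β ξ * lieD g β ξ * lieD g (lieD g P) ξ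
        + (lieD g β ξ ^ 2 + β ξ * lieD g (lieD g β) ξ) * lieD g P ξ) := by
  have s1 := smooth_lieD hO hg hP
  have s2 := smooth_lieD hO hg s1
  have b1 := smooth_lieD hO hg hβ
  have a1 : ∀ ξ ∈ O, lieD g (fun η => β η * lieD g P η) ξ
      = lieD g β ξ * lieD g P ξ + β ξ * lieD g (lieD g P) ξ := fun ξ hξ =>
    lieD_mul (diffAt hO hβ hξ) (diffAt hO s1 hξ)
  refine ⟨a1, ?_⟩
  intro ξ hξ
  have dβ := diffAt hO hβ hξ
  have db1 := diffAt hO b1 hξ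
  have ds1 := diffAt hO s1 hξ
  have ds2 := diffAt hO s2 hξ
  have a2 : ∀ η ∈ O, β η * lieD g (fun η' => β η' * lieD g P η') η
      = β η * (lieD g β η * lieD g P η + β η * lieD g (lieD g P) η) := fun η hη => by
    rw [a1 η hη]
  rw [lieD_congr hO a2 hξ, lieD_mul dβ (by fun_prop), lieD_add (by fun_prop) (by fun_prop),
    lieD_mul db1 ds1, lieD_mul dβ ds2]
  ring

end FlowAux
namespace FlowAux
open Filter Topology
open scoped ContDiff

lemma li_iff_det (A B : ℝ × ℝ) :
    LinearIndependent ℝ ![A, B] ↔ A.1 * B.2 - A.2 * B.1 ≠ 0 := by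
  rw [LinearIndependent.pair_iff]
  constructor
  · intro h hd
    have h1 := h B.1 (-A.1) (by ext <;> simp <;> linarith)
    have h2 := h B.2 (-A.2) (by ext <;> simp <;> linarith)
    have hA : A = 0 := by
      ext
      · simpa using h1.2
      · simpa using h2.2
    have h3 := h 1 0 (by simp [hA])
    simp at h3
  · intro hd s t hst
    have e1 : s * A.1 + t * B.1 = 0 := by simpa using congrArg Prod.fst hst
    have e2 : s * A.2 + t * B.2 = 0 := by simpa using congrArg Prod.snd hst
    have s0 : s * (A.1 * B.2 - A.2 * B.1) = 0 := by linear_combination B.2 * e1 - B.1 * e2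
    have t0 : t * (A.1 * B.2 - A.2 * B.1) = 0 := by linear_combination A.1 * e2 - A.2 * e1
    exact ⟨(mul_eq_zero.1 s0).resolve_right hd, (mul_eq_zero.1 t0).resolve_right hd⟩

/-- One differentiation step of a combination `k₁(w) a + k₂(w) b + c`. -/
lemma shape_step {O : Set M3} (hO : IsOpen O) {g : M3 → M3} {β w a b c Q : M3 → ℝ}
    {k₁ k₂ l₁ l₂ : ℝ → ℝ} (h1 : ∀ t, HasDerivAt k₁ (l₁ t) t) (h2 : ∀ t, HasDerivAt k₂ (l₂ t) t)
    (hw : ContDiffOn ℝ ∞ w O)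
    (ha : ContDiffOn ℝ ∞ a O) (hb : ContDiffOn ℝ ∞ b O) (hc : ContDiffOn ℝ ∞ c O)
    (hw1 : ∀ ξ ∈ O, β ξ * lieD g w ξ = 1)
    (ha0 : ∀ ξ ∈ O, lieD g a ξ = 0) (hb0 : ∀ ξ ∈ O, lieD g b ξ = 0)
    (hc0 : ∀ ξ ∈ O, lieD g c ξ = 0)
    (hQ : ∀ ξ ∈ O, Q ξ = k₁ (w ξ) * a ξ + k₂ (w ξ) * b ξ + c ξ) :
    ∀ ξ ∈ O, β ξ * lieD g Q ξ = l₁ (w ξ) * a ξ + l₂ (w ξ) * b ξ := by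
  intro ξ hξ
  have dw := diffAt hO hw hξ
  have da := diffAt hO ha hξ
  have db := diffAt hO hb hξ
  have dc := diffAt hO hc hξ
  have d1 : DifferentiableAt ℝ (fun η => k₁ (w η)) ξ :=
    (h1 (w ξ)).differentiableAt.comp ξ dw
  have d2 : DifferentiableAt ℝ (fun η => k₂ (w η)) ξ :=
    (h2 (w ξ)).differentiableAt.comp ξ dw
  have d3 : DifferentiableAt ℝ (fun η => k₁ (w η) * a η) ξ := d1.mul da
  have d4 : DifferentiableAt ℝ (fun η => k₂ (w η) * b η) ξ := d2.mul db
  have d5 : DifferentiableAt ℝ (fun η => k₁ (w η) * a η + k₂ (w η) * b η) ξ := d3.add d4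
  rw [lieD_congr hO hQ hξ, lieD_add d5 dc, lieD_add d3 d4, lieD_mul d1 da, lieD_mul d2 db, lieD_comp (h1 _) dw, lieD_comp (h2 _) dw,
    ha0 ξ hξ, hb0 ξ hξ, hc0 ξ hξ]
  linear_combination (l₁ (w ξ) * a ξ + l₂ (w ξ) * b ξ) * hw1 ξ hξ

/-- Data of a shape `c₁, c₂`, with derivatives `d`, `e` and `e' = κ d`. -/
structure Shape (c₁ c₂ d₁ d₂ e₁ e₂ : ℝ → ℝ) (κ W : ℝ) : Prop where
  c1 : ∀ t, HasDerivAt c₁ (d₁ t) t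
  c2 : ∀ t, HasDerivAt c₂ (d₂ t) t
  d1 : ∀ t, HasDerivAt d₁ (e₁ t) t
  d2 : ∀ t, HasDerivAt d₂ (e₂ t) t
  e1 : ∀ t, HasDerivAt e₁ (κ * d₁ t) t
  e2 : ∀ t, HasDerivAt e₂ (κ * d₂ t) t
  wr : ∀ t, d₁ t * e₂ t - d₂ t * e₁ t = W
  ne : W ≠ 0

lemma forward {U : Set M3} (hU : IsOpen U) {ξ₀ : M3} (hξ₀ : ξ₀ ∈ U)
    {f g : M3 → M3} (hf : ContDiffOn ℝ ∞ f U) (hg : ContDiffOn ℝ ∞ g U)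
    {ρ τ σ : M3 → ℝ}
    (hρ : ContDiffOn ℝ ∞ ρ U)
    (hdec : ∀ ξ ∈ U, lieB g (lieB g (lieB g f)) ξ
      = ρ ξ • lieB g (lieB g f) ξ + τ ξ • lieB g f ξ + σ ξ • g ξ)
    {c₁ c₂ d₁ d₂ e₁ e₂ : ℝ → ℝ} {κ W : ℝ} (hS : Shape c₁ c₂ d₁ d₂ e₁ e₂ κ W)
    (hE : EquivToQuadClass f g ξ₀ c₁ c₂) :
    ∃ (O : Set M3) (β : M3 → ℝ), IsOpen O ∧ ξ₀ ∈ O ∧ O ⊆ U ∧ (∀ ξ ∈ O, β ξ ≠ 0) ∧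
      ∀ ξ ∈ O, β ξ ^ 2 * (3 * lieD g ρ ξ - 2 * ρ ξ ^ 2 - 9 * τ ξ) = -9 * κ := by
  obtain ⟨A, B, C, V2, hV2, hA, hB, hC, hLI, Φ, α, β, U', hU', hξ', hΦ, hbij, hmap, hα, hβ, hβ0,
    hff, hgg⟩ := hE
  have hO : IsOpen (U ∩ U') := hU.inter hU'
  refine ⟨U ∩ U', β, hO, ⟨hξ₀, hξ'⟩, inter_subset_left, fun ξ hξ => hβ0 ξ hξ.2, ?_⟩
  generalize hOdef : U ∩ U' = O at hO
  have hOU : O ⊆ U := hOdef ▸ inter_subset_left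
  have hOU' : O ⊆ U' := hOdef ▸ inter_subset_right
  replace hf := hf.mono hOU
  replace hg := hg.mono hOU
  replace hρ := hρ.mono hOU
  replace hΦ := hΦ.mono hOU'
  replace hβ := hβ.mono hOU'
  have hx : ContDiffOn ℝ ∞ (fun ξ => (Φ ξ).1) O := contDiff_fst.comp_contDiffOn hΦ
  have hw : ContDiffOn ℝ ∞ (fun ξ => (Φ ξ).2) O := contDiff_snd.comp_contDiffOn hΦ
  have hxV : ∀ ξ ∈ O, (Φ ξ).1 ∈ V2 := fun ξ hξ => (hmap ξ (hOU' hξ)).1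
  have dx : ∀ ξ ∈ O, HasFDerivAt (fun ξ => (Φ ξ).1)
      ((ContinuousLinearMap.fst ℝ (ℝ × ℝ) ℝ).comp (fderiv ℝ Φ ξ)) ξ := fun ξ hξ =>
    (ContinuousLinearMap.fst ℝ (ℝ × ℝ) ℝ).hasFDerivAt.comp ξ (diffAt hO hΦ hξ).hasFDerivAt
  have dw : ∀ ξ ∈ O, HasFDerivAt (fun ξ => (Φ ξ).2)
      ((ContinuousLinearMap.snd ℝ (ℝ × ℝ) ℝ).comp (fderiv ℝ Φ ξ)) ξ := fun ξ hξ =>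
    (ContinuousLinearMap.snd ℝ (ℝ × ℝ) ℝ).hasFDerivAt.comp ξ (diffAt hO hΦ hξ).hasFDerivAt
  have hg1 : ∀ ξ ∈ O, (fderiv ℝ Φ ξ (g ξ)).1 = 0 := by
    intro ξ hξ
    have h := congrArg Prod.fst (hgg ξ (hOU' hξ))
    rw [map_smul] at h
    exact (smul_eq_zero.1 h).resolve_left (hβ0 ξ (hOU' hξ))
  have hw1 : ∀ ξ ∈ O, β ξ * lieD g (fun ξ => (Φ ξ).2) ξ = 1 := by
    intro ξ hξ
    have h := congrArg Prod.snd (hgg ξ (hOU' hξ))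
    rw [map_smul] at h
    simp only [lieD]
    rw [(dw ξ hξ).fderiv]
    exact h
  have first : ∀ H : ℝ × ℝ → ℝ, ContDiffOn ℝ ∞ H V2 →
      ContDiffOn ℝ ∞ (fun ξ => H (Φ ξ).1) O ∧ ∀ ξ ∈ O, lieD g (fun ξ => H (Φ ξ).1) ξ = 0 := by
    intro H hH
    refine ⟨hH.comp hx hxV, fun ξ hξ => ?_⟩
    have h1 : HasFDerivAt (fun ξ => H (Φ ξ).1) _ ξ :=
      (diffAt hV2 hH (hxV ξ hξ)).hasFDerivAt.comp ξ (dx ξ hξ)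
    simp only [lieD]
    rw [h1.fderiv]
    simp [hg1 ξ hξ]
  -- one component
  have comp : ∀ π : ℝ × ℝ →L[ℝ] ℝ, ∃ P : M3 → ℝ,
      ∀ ξ ∈ O, (β ξ * lieD g P ξ = d₁ (Φ ξ).2 * π (A (Φ ξ).1) + d₂ (Φ ξ).2 * π (B (Φ ξ).1)) ∧
        (β ξ * (lieD g β ξ * lieD g P ξ + β ξ * lieD g (lieD g P) ξ)
          = e₁ (Φ ξ).2 * π (A (Φ ξ).1) + e₂ (Φ ξ).2 * π (B (Φ ξ).1)) ∧
        (β ξ * ρ ξ + 3 * lieD g β ξ) * (β ξ * lieD g (lieD g P) ξ) +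
          (β ξ ^ 2 * τ ξ + lieD g β ξ ^ 2 + β ξ * lieD g (lieD g β) ξ - κ) * lieD g P ξ = 0 := by
    intro π
    obtain ⟨sX, zX⟩ := first π π.contDiff.contDiffOn
    obtain ⟨sa, za⟩ := first (fun x => π (A x)) (π.contDiff.comp_contDiffOn hA)
    obtain ⟨sb, zb⟩ := first (fun x => π (B x)) (π.contDiff.comp_contDiffOn hB)
    obtain ⟨sc, zc⟩ := first (fun x => π (C x)) (π.contDiff.comp_contDiffOn hC)
    have z0 : ContDiffOn ℝ ∞ (fun _ : M3 => (0:ℝ)) O := contDiffOn_const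
    have zz : ∀ ξ ∈ O, lieD g (fun _ : M3 => (0:ℝ)) ξ = 0 := fun ξ _ => by simp [lieD]
    obtain ⟨-, -, f3⟩ := first_integral3 hO hf hg sX (fun ξ hξ => hdec ξ (hOU hξ)) zX
    have sP := smooth_lieD hO hf sX
    obtain ⟨g1, g2⟩ := scaled3 hO hg sP hβ
    have hP : ∀ ξ ∈ O, lieD f (fun ξ => π (Φ ξ).1) ξ
        = c₁ (Φ ξ).2 * π (A (Φ ξ).1) + c₂ (Φ ξ).2 * π (B (Φ ξ).1) + π (C (Φ ξ).1) := by
      intro ξ hξ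
      have h1 : HasFDerivAt (fun ξ => π (Φ ξ).1) _ ξ := π.hasFDerivAt.comp ξ (dx ξ hξ)
      have h2 := congrArg Prod.fst (hff ξ (hOU' hξ))
      rw [map_add, map_smul] at h2
      have h3 : (fderiv ℝ Φ ξ (f ξ)).1
          = c₁ (Φ ξ).2 • A (Φ ξ).1 + c₂ (Φ ξ).2 • B (Φ ξ).1 + C (Φ ξ).1 := by
        refine Eq.trans ?_ h2
        simp [hg1 ξ hξ]
      simp only [lieD]
      rw [h1.fderiv]
      simp [h3]
    have t1 := shape_step hO hS.c1 hS.c2 hw sa sb sc hw1 za zb zc hP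
    have t2 := shape_step (Q := fun η => β η * lieD g (lieD f (fun ξ => π (Φ ξ).1)) η) hO hS.d1 hS.d2 hw sa sb z0 hw1 za zb zz
      (fun ξ hξ => by rw [add_zero]; exact t1 ξ hξ)
    have t3 := shape_step (Q := fun η => β η * lieD g (fun η' => β η' *
      lieD g (lieD f (fun ξ => π (Φ ξ).1)) η') η) hO hS.e1 hS.e2 hw sa sb z0 hw1 za zb zz
      (fun ξ hξ => by rw [add_zero]; exact t2 ξ hξ)
    refine ⟨lieD f (fun ξ => π (Φ ξ).1), fun ξ hξ => ⟨t1 ξ hξ, ?_, ?_⟩⟩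
    · rw [← t2 ξ hξ, g1 ξ hξ]
    · have h3 := t3 ξ hξ
      rw [g2 ξ hξ, f3 ξ hξ] at h3
      have h1 := t1 ξ hξ
      have hb := hβ0 ξ (hOU' hξ)
      refine mul_left_cancel₀ hb ?_
      linear_combination h3 - κ * h1
  obtain ⟨P, hP⟩ := comp (ContinuousLinearMap.fst ℝ ℝ ℝ)
  obtain ⟨Q, hQ⟩ := comp (ContinuousLinearMap.snd ℝ ℝ ℝ)
  have key : ∀ ξ ∈ O, β ξ * ρ ξ + 3 * lieD g β ξ = 0 ∧
      β ξ ^ 2 * τ ξ + lieD g β ξ ^ 2 + β ξ * lieD g (lieD g β) ξ - κ = 0 := by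
    intro ξ hξ
    obtain ⟨p1, p2, p3⟩ := hP ξ hξ
    obtain ⟨q1, q2, q3⟩ := hQ ξ hξ
    have hb := hβ0 ξ (hOU' hξ)
    have hdet := (li_iff_det _ _).1 (hLI _ (hxV ξ hξ))
    simp only [ContinuousLinearMap.coe_fst', ContinuousLinearMap.coe_snd'] at p1 p2 q1 q2
    have hwr := hS.wr (Φ ξ).2
    have hD : lieD g P ξ * lieD g (lieD g Q) ξ - lieD g Q ξ * lieD g (lieD g P) ξ ≠ 0 := by
      intro h0
      have h1 : W * ((A (Φ ξ).1).1 * (B (Φ ξ).1).2 - (A (Φ ξ).1).2 * (B (Φ ξ).1).1) = 0 := by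
        rw [← hwr]
        have : (β ξ * lieD g P ξ) * (β ξ * (lieD g β ξ * lieD g Q ξ + β ξ * lieD g (lieD g Q) ξ))
          - (β ξ * lieD g Q ξ) * (β ξ * (lieD g β ξ * lieD g P ξ + β ξ * lieD g (lieD g P) ξ))
          = 0 := by linear_combination β ξ ^ 3 * h0
        rw [p1, p2, q1, q2] at this
        linear_combination this
      exact (mul_ne_zero hS.ne hdet) h1
    constructor
    · have : (β ξ * ρ ξ + 3 * lieD g β ξ) * (β ξ *
        (lieD g P ξ * lieD g (lieD g Q) ξ - lieD g Q ξ * lieD g (lieD g P) ξ)) = 0 := by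
        linear_combination lieD g P ξ * q3 - lieD g Q ξ * p3
      exact (mul_eq_zero.1 this).resolve_right (mul_ne_zero hb hD)
    · have : (β ξ ^ 2 * τ ξ + lieD g β ξ ^ 2 + β ξ * lieD g (lieD g β) ξ - κ) *
        (lieD g P ξ * lieD g (lieD g Q) ξ - lieD g Q ξ * lieD g (lieD g P) ξ) = 0 := by
        linear_combination lieD g (lieD g Q) ξ * p3 - lieD g (lieD g P) ξ * q3
      exact (mul_eq_zero.1 this).resolve_right hD
  intro ξ hξ
  obtain ⟨k1, k2⟩ := key ξ hξ
  have dβ := diffAt hO hβ hξ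
  have dρ := diffAt hO hρ hξ
  have dβ1 := diffAt hO (smooth_lieD hO hg hβ) hξ
  have k3 := lieD_congr (A := g) hO (fun ξ hξ => (key ξ hξ).1) hξ
  rw [lieD_add (by fun_prop) (by fun_prop), lieD_mul dβ dρ, lieD_const_mul dβ1] at k3
  have k4 : lieD g (fun _ : M3 => (0:ℝ)) ξ = 0 := by simp [lieD]
  rw [k4] at k3
  linear_combination (-9) * k2 + 3 * β ξ * k3 + (3 * lieD g β ξ - 2 * β ξ * ρ ξ) * k1

end FlowAux
namespace FlowAux
open Filter Topology
open scoped ContDiff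

/-- A function killed by `v` is constant along the last flow-box coordinate. -/
lemma const_along (e : OpenPartialHomeomorph M3 M3) {v : M3 → M3} {h : M3 → ℝ}
    (hes : ContDiffOn ℝ ∞ e.symm e.target) (hh : ContDiffOn ℝ ∞ h e.source)
    (hv : ∀ q ∈ e.target, fderiv ℝ e.symm q (0, 1) = v (e.symm q))
    (h0 : ∀ ξ ∈ e.source, fderiv ℝ h ξ (v ξ) = 0)
    {x : ℝ × ℝ} {w₀ ε : ℝ} (hbox : ∀ t ∈ Metric.ball w₀ ε, (x, t) ∈ e.target)
    {t : ℝ} (ht : t ∈ Metric.ball w₀ ε) :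
    h (e.symm (x, t)) = h (e.symm (x, w₀)) := by
  have hε : 0 < ε := Metric.pos_of_mem_ball ht
  have hd : ∀ s ∈ Metric.ball w₀ ε, HasDerivAt (fun s : ℝ => h (e.symm (x, s))) 0 s := by
    intro s hs
    have hq := hbox s hs
    have h1 : HasDerivAt (fun s : ℝ => ((x, s) : M3)) ((0, 1) : M3) s :=
      (hasDerivAt_const s x).prodMk (hasDerivAt_id s)
    have h2 := (diffAt e.open_target hes hq).hasFDerivAt.comp_hasDerivAt s h1
    have h3 : HasDerivAt (fun s : ℝ => h (e.symm (x, s))) _ s :=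
      (diffAt e.open_source hh (e.map_target hq)).hasFDerivAt.comp_hasDerivAt s h2
    rw [hv _ hq, h0 _ (e.map_target hq)] at h3
    exact h3
  exact Metric.isOpen_ball.is_const_of_deriv_eq_zero (convex_ball w₀ ε).isPreconnected
    (fun s hs => (hd s hs).differentiableAt.differentiableWithinAt)
    (fun s hs => (hd s hs).deriv) ht (Metric.mem_ball_self hε)

/-- Smoothness of a shape. -/
structure ShapeSmooth (c₁ c₂ d₁ d₂ e₁ e₂ : ℝ → ℝ) : Prop where
  c1 : ContDiff ℝ ∞ c₁
  c2 : ContDiff ℝ ∞ c₂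
  d1 : ContDiff ℝ ∞ d₁
  d2 : ContDiff ℝ ∞ d₂
  e1 : ContDiff ℝ ∞ e₁
  e2 : ContDiff ℝ ∞ e₂

/-- `k₁(w) p + k₂(w) q` derivative. -/
lemma lin_step {O : Set M3} (hO : IsOpen O) {g : M3 → M3} {w p q : M3 → ℝ} {k₁ k₂ l₁ l₂ : ℝ → ℝ}
    (h1 : ∀ t, HasDerivAt k₁ (l₁ t) t) (h2 : ∀ t, HasDerivAt k₂ (l₂ t) t)
    (hw : ContDiffOn ℝ ∞ w O) (hp : ContDiffOn ℝ ∞ p O) (hq : ContDiffOn ℝ ∞ q O) {ξ : M3}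
    (hξ : ξ ∈ O) :
    lieD g (fun η => k₁ (w η) * p η - k₂ (w η) * q η) ξ
      = (l₁ (w ξ) * lieD g w ξ) * p ξ + k₁ (w ξ) * lieD g p ξ
        - ((l₂ (w ξ) * lieD g w ξ) * q ξ + k₂ (w ξ) * lieD g q ξ) := by
  have dw := diffAt hO hw hξ
  have dp := diffAt hO hp hξ
  have dq := diffAt hO hq hξ
  have d1 : DifferentiableAt ℝ (fun η => k₁ (w η)) ξ :=
    (h1 (w ξ)).differentiableAt.comp ξ dw
  have d2 : DifferentiableAt ℝ (fun η => k₂ (w η)) ξ :=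
    (h2 (w ξ)).differentiableAt.comp ξ dw
  have d3 : DifferentiableAt ℝ (fun η => k₁ (w η) * p η) ξ := d1.mul dp
  have d4 : DifferentiableAt ℝ (fun η => k₂ (w η) * q η) ξ := d2.mul dq
  rw [lieD_sub d3 d4, lieD_mul d1 dp, lieD_mul d2 dq, lieD_comp (h1 _) dw, lieD_comp (h2 _) dw]

/-- Solving for the coefficients. -/
lemma coeffs {O : Set M3} (hO : IsOpen O) {g : M3 → M3} {β w P P1 P2 : M3 → ℝ}
    (hw : ContDiffOn ℝ ∞ w O)
    (sP : ContDiffOn ℝ ∞ P O) (s1 : ContDiffOn ℝ ∞ P1 O) (s2 : ContDiffOn ℝ ∞ P2 O)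
    (hβ0 : ∀ ξ ∈ O, β ξ ≠ 0)
    (hw1 : ∀ ξ ∈ O, β ξ * lieD g w ξ = 1)
    {c₁ c₂ d₁ d₂ e₁ e₂ : ℝ → ℝ} {κ W : ℝ} (hS : Shape c₁ c₂ d₁ d₂ e₁ e₂ κ W)
    (hSS : ShapeSmooth c₁ c₂ d₁ d₂ e₁ e₂)
    (h1 : ∀ ξ ∈ O, β ξ * lieD g P ξ = P1 ξ)
    (h2 : ∀ ξ ∈ O, β ξ * lieD g P1 ξ = P2 ξ)
    (h3 : ∀ ξ ∈ O, β ξ * lieD g P2 ξ = κ * P1 ξ) :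
    ∃ a b c : M3 → ℝ, ContDiffOn ℝ ∞ a O ∧ ContDiffOn ℝ ∞ b O ∧ ContDiffOn ℝ ∞ c O ∧
      (∀ ξ ∈ O, lieD g a ξ = 0) ∧ (∀ ξ ∈ O, lieD g b ξ = 0) ∧ (∀ ξ ∈ O, lieD g c ξ = 0) ∧
      (∀ ξ ∈ O, P ξ = c₁ (w ξ) * a ξ + c₂ (w ξ) * b ξ + c ξ) ∧
      (∀ ξ ∈ O, W * a ξ = e₂ (w ξ) * P1 ξ - d₂ (w ξ) * P2 ξ) ∧
      (∀ ξ ∈ O, W * b ξ = d₁ (w ξ) * P2 ξ - e₁ (w ξ) * P1 ξ) := by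
  have hW := hS.ne
  have sa0 : ContDiffOn ℝ ∞ (fun η => e₂ (w η) * P1 η - d₂ (w η) * P2 η) O :=
    ((hSS.e2.comp_contDiffOn hw).mul s1).sub ((hSS.d2.comp_contDiffOn hw).mul s2)
  have sb0 : ContDiffOn ℝ ∞ (fun η => d₁ (w η) * P2 η - e₁ (w η) * P1 η) O :=
    ((hSS.d1.comp_contDiffOn hw).mul s2).sub ((hSS.e1.comp_contDiffOn hw).mul s1)
  have za0 : ∀ ξ ∈ O, lieD g (fun η => e₂ (w η) * P1 η - d₂ (w η) * P2 η) ξ = 0 := by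
    intro ξ hξ
    rw [lin_step hO hS.e2 hS.d2 hw s1 s2 hξ]
    refine mul_left_cancel₀ (hβ0 ξ hξ) ?_
    linear_combination (κ * d₂ (w ξ) * P1 ξ - e₂ (w ξ) * P2 ξ) * hw1 ξ hξ
      + e₂ (w ξ) * h2 ξ hξ - d₂ (w ξ) * h3 ξ hξ
  have zb0 : ∀ ξ ∈ O, lieD g (fun η => d₁ (w η) * P2 η - e₁ (w η) * P1 η) ξ = 0 := by
    intro ξ hξ
    rw [lin_step hO hS.d1 hS.e1 hw s2 s1 hξ]
    refine mul_left_cancel₀ (hβ0 ξ hξ) ?_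
    linear_combination (e₁ (w ξ) * P2 ξ - κ * d₁ (w ξ) * P1 ξ) * hw1 ξ hξ
      - e₁ (w ξ) * h2 ξ hξ + d₁ (w ξ) * h3 ξ hξ
  obtain ⟨a, ha⟩ : ∃ a : M3 → ℝ, a = fun η => W⁻¹ * (e₂ (w η) * P1 η - d₂ (w η) * P2 η) := ⟨_, rfl⟩
  obtain ⟨b, hb⟩ : ∃ b : M3 → ℝ, b = fun η => W⁻¹ * (d₁ (w η) * P2 η - e₁ (w η) * P1 η) := ⟨_, rfl⟩
  have sa : ContDiffOn ℝ ∞ a O := by rw [ha]; exact contDiffOn_const.mul sa0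
  have sb : ContDiffOn ℝ ∞ b O := by rw [hb]; exact contDiffOn_const.mul sb0
  have za : ∀ ξ ∈ O, lieD g a ξ = 0 := fun ξ hξ => by
    rw [ha, lieD_const_mul (diffAt hO sa0 hξ), za0 ξ hξ, mul_zero]
  have zb : ∀ ξ ∈ O, lieD g b ξ = 0 := fun ξ hξ => by
    rw [hb, lieD_const_mul (diffAt hO sb0 hξ), zb0 ξ hξ, mul_zero]
  have ea : ∀ ξ, W * a ξ = e₂ (w ξ) * P1 ξ - d₂ (w ξ) * P2 ξ := fun ξ => by
    rw [ha]; exact mul_inv_cancel_left₀ hW _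
  have eb : ∀ ξ, W * b ξ = d₁ (w ξ) * P2 ξ - e₁ (w ξ) * P1 ξ := fun ξ => by
    rw [hb]; exact mul_inv_cancel_left₀ hW _
  have sq : ContDiffOn ℝ ∞ (fun η => c₁ (w η) * a η + c₂ (w η) * b η + 0) O :=
    (((hSS.c1.comp_contDiffOn hw).mul sa).add ((hSS.c2.comp_contDiffOn hw).mul sb)).add
      contDiffOn_const
  refine ⟨a, b, fun η => P η - (c₁ (w η) * a η + c₂ (w η) * b η + 0), sa, sb, sP.sub sq, za, zb, ?_,
    fun ξ _ => by ring, fun ξ _ => ea ξ, fun ξ _ => eb ξ⟩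
  intro ξ hξ
  rw [lieD_sub (diffAt hO sP hξ) (diffAt hO sq hξ)]
  have t := shape_step (Q := fun η => c₁ (w η) * a η + c₂ (w η) * b η + 0) hO hS.c1 hS.c2 hw sa sb
    (contDiffOn_const (c := (0:ℝ))) hw1 za zb (fun ξ _ => by simp [lieD]) (fun _ _ => rfl) ξ hξ
  refine mul_left_cancel₀ (mul_ne_zero hW (hβ0 ξ hξ)) ?_
  linear_combination W * h1 ξ hξ - W * t - d₁ (w ξ) * ea ξ - d₂ (w ξ) * eb ξ - P1 ξ * hS.wr (w ξ)

lemma backward {U : Set M3} (hU : IsOpen U) {ξ₀ : M3} (hξ₀ : ξ₀ ∈ U)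
    {f g : M3 → M3} (hf : ContDiffOn ℝ ∞ f U) (hg : ContDiffOn ℝ ∞ g U)
    (hC1 : LinearIndependent ℝ ![g ξ₀, lieB g f ξ₀, lieB g (lieB g f) ξ₀])
    {ρ τ σ β : M3 → ℝ}
    (hρ : ContDiffOn ℝ ∞ ρ U)
    (hdec : ∀ ξ ∈ U, lieB g (lieB g (lieB g f)) ξ
      = ρ ξ • lieB g (lieB g f) ξ + τ ξ • lieB g f ξ + σ ξ • g ξ)
    {c₁ c₂ d₁ d₂ e₁ e₂ : ℝ → ℝ} {κ W : ℝ} (hS : Shape c₁ c₂ d₁ d₂ e₁ e₂ κ W)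
    (hSS : ShapeSmooth c₁ c₂ d₁ d₂ e₁ e₂)
    (hβ : ContDiffOn ℝ ∞ β U) (hβ0 : ∀ ξ ∈ U, β ξ ≠ 0)
    (hβ1 : ∀ ξ ∈ U, lieD g β ξ = (-1/3) * (ρ ξ * β ξ))
    (hχ : ∀ ξ ∈ U, β ξ ^ 2 * (3 * lieD g ρ ξ - 2 * ρ ξ ^ 2 - 9 * τ ξ) = -9 * κ) :
    EquivToQuadClass f g ξ₀ c₁ c₂ := by
  have hg0 : g ξ₀ ≠ 0 := by simpa using hC1.ne_zero 0
  obtain ⟨e, -, hmem, hsub, he, hes, -, hbij, hev, -, hsv⟩ :=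
    exists_flowbox (fun ξ => β ξ • g ξ) (fun _ => 0) U hU ξ₀ hξ₀ (hβ.smul hg) contDiffOn_const
      (smul_ne_zero (hβ0 ξ₀ hξ₀) hg0)
  have hO := e.open_source
  replace hf := hf.mono hsub
  replace hg := hg.mono hsub
  replace hρ := hρ.mono hsub
  replace hβ := hβ.mono hsub
  replace hβ0 := fun ξ hξ => hβ0 ξ (hsub hξ)
  replace hβ1 := fun ξ hξ => hβ1 ξ (hsub hξ)
  replace hχ := fun ξ hξ => hχ ξ (hsub hξ)
  replace hdec := fun ξ hξ => hdec ξ (hsub hξ)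
  clear hU hξ₀ hsub
  have hx : ContDiffOn ℝ ∞ (fun ξ => (e ξ).1) e.source := contDiff_fst.comp_contDiffOn he
  have hw : ContDiffOn ℝ ∞ (fun ξ => (e ξ).2) e.source := contDiff_snd.comp_contDiffOn he
  have dX : ∀ (π : ℝ × ℝ →L[ℝ] ℝ) (Y : M3 → M3), ∀ ξ ∈ e.source,
      lieD Y (fun ξ => π (e ξ).1) ξ = π (fderiv ℝ e ξ (Y ξ)).1 := by
    intro π Y ξ hξ
    have h1 : HasFDerivAt (fun ξ => π (e ξ).1)
        (π.comp ((ContinuousLinearMap.fst ℝ (ℝ × ℝ) ℝ).comp (fderiv ℝ e ξ))) ξ :=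
      π.hasFDerivAt.comp ξ ((ContinuousLinearMap.fst ℝ (ℝ × ℝ) ℝ).hasFDerivAt.comp ξ
        (diffAt hO he hξ).hasFDerivAt)
    simp only [lieD]
    rw [h1.fderiv]; rfl
  have dw : ∀ (Y : M3 → M3), ∀ ξ ∈ e.source,
      lieD Y (fun ξ => (e ξ).2) ξ = (fderiv ℝ e ξ (Y ξ)).2 := by
    intro Y ξ hξ
    have h1 : HasFDerivAt (fun ξ => (e ξ).2)
        ((ContinuousLinearMap.snd ℝ (ℝ × ℝ) ℝ).comp (fderiv ℝ e ξ)) ξ :=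
      (ContinuousLinearMap.snd ℝ (ℝ × ℝ) ℝ).hasFDerivAt.comp ξ
        (diffAt hO he hξ).hasFDerivAt
    simp only [lieD]
    rw [h1.fderiv]; rfl
  have hg1 : ∀ ξ ∈ e.source, (fderiv ℝ e ξ (g ξ)).1 = 0 := by
    intro ξ hξ
    have h := congrArg Prod.fst (hev ξ hξ)
    rw [map_smul] at h
    exact (smul_eq_zero.1 h).resolve_left (hβ0 ξ hξ)
  have hw1 : ∀ ξ ∈ e.source, β ξ * lieD g (fun ξ => (e ξ).2) ξ = 1 := by
    intro ξ hξ
    have h := congrArg Prod.snd (hev ξ hξ)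
    rw [map_smul] at h
    rw [dw g ξ hξ]
    exact h
  have hβ2 : ∀ ξ ∈ e.source, lieD g (lieD g β) ξ
      = (-1/3) * (lieD g ρ ξ * β ξ + ρ ξ * ((-1/3) * (ρ ξ * β ξ))) := by
    intro ξ hξ
    have dρ := diffAt hO hρ hξ
    have dβ := diffAt hO hβ hξ
    rw [lieD_congr hO hβ1 hξ, lieD_const_mul (by fun_prop), lieD_mul dρ dβ, hβ1 ξ hξ]
  have comp : ∀ π : ℝ × ℝ →L[ℝ] ℝ, ∃ a b c : M3 → ℝ,
      ContDiffOn ℝ ∞ a e.source ∧ ContDiffOn ℝ ∞ b e.source ∧ ContDiffOn ℝ ∞ c e.source ∧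
      (∀ ξ ∈ e.source, lieD g a ξ = 0) ∧ (∀ ξ ∈ e.source, lieD g b ξ = 0) ∧
      (∀ ξ ∈ e.source, lieD g c ξ = 0) ∧
      (∀ ξ ∈ e.source, π (fderiv ℝ e ξ (f ξ)).1
        = c₁ (e ξ).2 * a ξ + c₂ (e ξ).2 * b ξ + c ξ) ∧
      (∀ ξ ∈ e.source, W * a ξ = e₂ (e ξ).2 * (β ξ * π (fderiv ℝ e ξ (lieB g f ξ)).1)
        - d₂ (e ξ).2 * (β ξ * (lieD g β ξ * π (fderiv ℝ e ξ (lieB g f ξ)).1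
          + β ξ * π (fderiv ℝ e ξ (lieB g (lieB g f) ξ)).1))) ∧
      (∀ ξ ∈ e.source, W * b ξ = d₁ (e ξ).2 * (β ξ * (lieD g β ξ * π (fderiv ℝ e ξ (lieB g f ξ)).1
          + β ξ * π (fderiv ℝ e ξ (lieB g (lieB g f) ξ)).1))
        - e₁ (e ξ).2 * (β ξ * π (fderiv ℝ e ξ (lieB g f ξ)).1)) := by
    intro π
    have sX : ContDiffOn ℝ ∞ (fun ξ => π (e ξ).1) e.source := π.contDiff.comp_contDiffOn hx
    have zX : ∀ ξ ∈ e.source, lieD g (fun ξ => π (e ξ).1) ξ = 0 := fun ξ hξ => by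
      rw [dX π g ξ hξ, hg1 ξ hξ, map_zero]
    obtain ⟨f1, f2, f3⟩ := first_integral3 hO hf hg sX hdec zX
    have sP := smooth_lieD hO hf sX
    obtain ⟨g1, g2⟩ := scaled3 hO hg sP hβ
    have s1 : ContDiffOn ℝ ∞ (fun η => β η * lieD g (lieD f (fun ξ => π (e ξ).1)) η) e.source :=
      hβ.mul (smooth_lieD hO hg sP)
    have s2 : ContDiffOn ℝ ∞ (fun η => β η * lieD g (fun η => β η *
        lieD g (lieD f (fun ξ => π (e ξ).1)) η) η) e.source :=
      hβ.mul (smooth_lieD hO hg s1)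
    obtain ⟨a, b, c, sa, sb, sc, za, zb, zc, eP, ea, eb⟩ := coeffs (β := β) hO hw sP s1 s2 hβ0 hw1
      hS hSS (fun _ _ => rfl) (fun _ _ => rfl) (fun ξ hξ => by
        rw [g2 ξ hξ, f3 ξ hξ, hβ2 ξ hξ, hβ1 ξ hξ]
        linear_combination (-1/9) * β ξ * lieD g (lieD f (fun ξ => π (e ξ).1)) ξ * hχ ξ hξ)
    refine ⟨a, b, c, sa, sb, sc, za, zb, zc, fun ξ hξ => ?_, fun ξ hξ => ?_, fun ξ hξ => ?_⟩
    · rw [← dX π f ξ hξ]; exact eP ξ hξ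
    · rw [← dX π (lieB g f) ξ hξ, ← dX π (lieB g (lieB g f)) ξ hξ, ← f1 ξ hξ, ← f2 ξ hξ, ← g1 ξ hξ]
      exact ea ξ hξ
    · rw [← dX π (lieB g f) ξ hξ, ← dX π (lieB g (lieB g f)) ξ hξ, ← f1 ξ hξ, ← f2 ξ hξ, ← g1 ξ hξ]
      exact eb ξ hξ
  obtain ⟨a, b, c, sa, sb, sc, za, zb, zc, eP, ea, eb⟩ := comp (ContinuousLinearMap.fst ℝ ℝ ℝ)
  obtain ⟨a', b', c', sa', sb', sc', za', zb', zc', eP', ea', eb'⟩ :=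
    comp (ContinuousLinearMap.snd ℝ ℝ ℝ)
  simp only [ContinuousLinearMap.coe_fst', ContinuousLinearMap.coe_snd'] at eP ea eb eP' ea' eb'
  have hdet0 : a ξ₀ * b' ξ₀ - a' ξ₀ * b ξ₀ ≠ 0 := by
    have hli : LinearIndependent ℝ ![(fderiv ℝ e ξ₀ (lieB g f ξ₀)).1,
        (fderiv ℝ e ξ₀ (lieB g (lieB g f) ξ₀)).1] := by
      rw [LinearIndependent.pair_iff]
      intro s t hst
      have hz : fderiv ℝ e ξ₀ (s • lieB g f ξ₀ + t • lieB g (lieB g f) ξ₀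
          - (fderiv ℝ e ξ₀ (s • lieB g f ξ₀ + t • lieB g (lieB g f) ξ₀)).2 • (β ξ₀ • g ξ₀)) = 0 := by
        rw [map_sub, map_smul _ _ (β ξ₀ • g ξ₀), hev ξ₀ hmem]
        ext1
        · simpa using hst
        · simp
      have hz2 := (map_eq_zero_iff (fderiv ℝ e ξ₀) (hbij ξ₀ hmem).1).1 hz
      generalize (fderiv ℝ e ξ₀ (s • lieB g f ξ₀ + t • lieB g (lieB g f) ξ₀)).2 = m at hz2
      have hl := Fintype.linearIndependent_iff.1 hC1 ![-(m * β ξ₀), s, t] (by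
        rw [Fin.sum_univ_three]
        simp only [Matrix.cons_val_zero, Matrix.cons_val_one, Matrix.cons_val]
        rw [← hz2]
        module)
      exact ⟨by simpa using hl 1, by simpa using hl 2⟩
    have h1 := (li_iff_det _ _).1 hli
    have hb := hβ0 ξ₀ hmem
    intro h0
    have h2 : W * (β ξ₀ ^ 3 * ((fderiv ℝ e ξ₀ (lieB g f ξ₀)).1.1 *
        (fderiv ℝ e ξ₀ (lieB g (lieB g f) ξ₀)).1.2 - (fderiv ℝ e ξ₀ (lieB g f ξ₀)).1.2 *
        (fderiv ℝ e ξ₀ (lieB g (lieB g f) ξ₀)).1.1)) = 0 := by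
      have h3 : (W * a ξ₀) * (W * b' ξ₀) - (W * a' ξ₀) * (W * b ξ₀) = 0 := by
        linear_combination W ^ 2 * h0
      rw [ea ξ₀ hmem, eb ξ₀ hmem, ea' ξ₀ hmem, eb' ξ₀ hmem] at h3
      rw [← hS.wr (e ξ₀).2]
      linear_combination h3
    exact mul_ne_zero hS.ne (mul_ne_zero (pow_ne_zero 3 hb) h1) h2
  -- the box
  have hdc : ContinuousOn (fun ξ => a ξ * b' ξ - a' ξ * b ξ) e.source :=
    ((sa.continuousOn.mul sb'.continuousOn).sub (sa'.continuousOn.mul sb.continuousOn))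
  have hT : ∀ᶠ q in 𝓝 (e ξ₀), q ∈ e.target ∧
      a (e.symm q) * b' (e.symm q) - a' (e.symm q) * b (e.symm q) ≠ 0 := by
    have h1 := e.map_source hmem
    refine (e.open_target.eventually_mem h1).and ?_
    have h2 : ContinuousAt (fun q => a (e.symm q) * b' (e.symm q) - a' (e.symm q) * b (e.symm q))
        (e ξ₀) := by
      have h3 : ContinuousAt (fun ξ => a ξ * b' ξ - a' ξ * b ξ) (e.symm (e ξ₀)) := by
        rw [e.left_inv hmem]; exact hdc.continuousAt (hO.mem_nhds hmem)
      exact h3.comp (e.continuousAt_symm h1)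
    refine h2.eventually_ne ?_
    rw [e.left_inv hmem]; exact hdet0
  obtain ⟨ε, hε, hbox⟩ := Metric.eventually_nhds_iff_ball.1 hT
  obtain ⟨⟨x₀, w₀⟩, hp⟩ : ∃ q, e ξ₀ = q := ⟨_, rfl⟩
  rw [hp] at hbox
  have hbox' : ∀ x ∈ Metric.ball x₀ ε, ∀ t ∈ Metric.ball w₀ ε, ((x, t) : M3) ∈ Metric.ball (x₀, w₀) ε := by
    intro x hx t ht
    rw [← ball_prod_same]; exact ⟨hx, ht⟩
  have hw₀ : w₀ ∈ Metric.ball w₀ ε := Metric.mem_ball_self hε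
  have hins : ContDiffOn ℝ ∞ (fun x : ℝ × ℝ => e.symm (x, w₀)) (Metric.ball x₀ ε) :=
    hes.comp (contDiff_id.prodMk contDiff_const).contDiffOn
      (fun x hx => (hbox _ (hbox' x hx w₀ hw₀)).1)
  have hinm : ∀ x ∈ Metric.ball x₀ ε, e.symm (x, w₀) ∈ e.source :=
    fun x hx => e.map_target (hbox _ (hbox' x hx w₀ hw₀)).1
  have hcst : ∀ h : M3 → ℝ, ContDiffOn ℝ ∞ h e.source → (∀ ξ ∈ e.source, lieD g h ξ = 0) →
      ∀ ξ ∈ e.source, e ξ ∈ Metric.ball (x₀, w₀) ε → h (e.symm ((e ξ).1, w₀)) = h ξ := by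
    intro h sh zh ξ hξ hb
    rw [← ball_prod_same] at hb
    have := const_along e (h := h) (x := (e ξ).1) (t := (e ξ).2) hes sh hsv (fun η hη => by
      rw [map_smul]
      have h1 : fderiv ℝ h η (g η) = 0 := zh η hη
      rw [h1, smul_zero]) (fun t ht => (hbox _ (hbox' _ hb.1 t ht)).1) hb.2
    rw [← this]
    change h (e.symm (e ξ)) = h ξ
    rw [e.left_inv hξ]
  refine ⟨fun x => (a (e.symm (x, w₀)), a' (e.symm (x, w₀))),
    fun x => (b (e.symm (x, w₀)), b' (e.symm (x, w₀))),
    fun x => (c (e.symm (x, w₀)), c' (e.symm (x, w₀))), Metric.ball x₀ ε, Metric.isOpen_ball,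
    (sa.comp hins hinm).prodMk (sa'.comp hins hinm), (sb.comp hins hinm).prodMk (sb'.comp hins hinm),
    (sc.comp hins hinm).prodMk (sc'.comp hins hinm), ?_, e, 
    fun ξ => -(β ξ * lieD f (fun ξ => (e ξ).2) ξ), β,
    e.source ∩ e ⁻¹' (Metric.ball (x₀, w₀) ε), e.isOpen_inter_preimage Metric.isOpen_ball,
    ⟨hmem, by rw [mem_preimage, hp]; exact Metric.mem_ball_self hε⟩, he.mono inter_subset_left,
    fun ξ hξ => hbij ξ hξ.1, ?_, ?_, hβ.mono inter_subset_left, fun ξ hξ => hβ0 ξ hξ.1, ?_, ?_⟩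
  · intro x hx
    rw [li_iff_det]
    exact (hbox _ (hbox' x hx w₀ hw₀)).2
  · rintro ξ ⟨hξ, hb⟩
    rw [mem_preimage, ← ball_prod_same] at hb
    exact ⟨hb.1, mem_univ _⟩
  · exact (hβ.mul (smooth_lieD hO hf hw)).neg.mono inter_subset_left
  · rintro ξ ⟨hξ, hb⟩
    simp only [hcst a sa za ξ hξ hb, hcst a' sa' za' ξ hξ hb, hcst b sb zb ξ hξ hb,
      hcst b' sb' zb' ξ hξ hb, hcst c sc zc ξ hξ hb, hcst c' sc' zc' ξ hξ hb]
    rw [map_add, map_smul]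
    have h1 := hg1 ξ hξ
    have h2 := hw1 ξ hξ
    rw [dw g ξ hξ] at h2
    rw [dw f ξ hξ]
    refine Prod.ext (Prod.ext ?_ ?_) ?_
    · simp [h1, eP ξ hξ]
    · simp [h1, eP' ξ hξ]
    · simp only [Prod.snd_add, Prod.smul_snd, smul_eq_mul]
      linear_combination (-(fderiv ℝ e ξ (f ξ)).2) * h2
  · rintro ξ ⟨hξ, hb⟩
    exact hev ξ hξ

end FlowAux
namespace FlowAux
open Filter Topology
open scoped ContDiff

lemma shapeE : Shape Real.cos Real.sin (fun w => -Real.sin w) Real.cos (fun w => -Real.cos w)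
    (fun w => -Real.sin w) (-1) 1 where
  c1 := Real.hasDerivAt_cos
  c2 := Real.hasDerivAt_sin
  d1 t := (Real.hasDerivAt_sin t).neg
  d2 := Real.hasDerivAt_cos
  e1 t := by simpa using (Real.hasDerivAt_cos t).fun_neg
  e2 t := by simpa using (Real.hasDerivAt_sin t).fun_neg
  wr t := by linear_combination Real.sin_sq_add_cos_sq t
  ne := one_ne_zero

lemma shapeE' : ShapeSmooth Real.cos Real.sin (fun w => -Real.sin w) Real.cos (fun w => -Real.cos w)
    (fun w => -Real.sin w) where
  c1 := Real.contDiff_cos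
  c2 := Real.contDiff_sin
  d1 := Real.contDiff_sin.neg
  d2 := Real.contDiff_cos
  e1 := Real.contDiff_cos.neg
  e2 := Real.contDiff_sin.neg

lemma shapeH : Shape Real.cosh Real.sinh Real.sinh Real.cosh Real.cosh Real.sinh 1 (-1) where
  c1 := Real.hasDerivAt_cosh
  c2 := Real.hasDerivAt_sinh
  d1 := Real.hasDerivAt_sinh
  d2 := Real.hasDerivAt_cosh
  e1 t := by simpa using Real.hasDerivAt_cosh t
  e2 t := by simpa using Real.hasDerivAt_sinh t
  wr t := by linear_combination -(Real.cosh_sq_sub_sinh_sq t)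
  ne := by norm_num

lemma shapeH' : ShapeSmooth Real.cosh Real.sinh Real.sinh Real.cosh Real.cosh Real.sinh where
  c1 := Real.contDiff_cosh
  c2 := Real.contDiff_sinh
  d1 := Real.contDiff_sinh
  d2 := Real.contDiff_cosh
  e1 := Real.contDiff_cosh
  e2 := Real.contDiff_sinh

lemma shapeP : Shape (fun w => w ^ 2) (fun w => w) (fun w => 2 * w) (fun _ => 1) (fun _ => 2)
    (fun _ => 0) 0 (-2) where
  c1 t := by simpa using hasDerivAt_pow 2 t
  c2 t := hasDerivAt_id t
  d1 t := by simpa using (hasDerivAt_id t).const_mul (2:ℝ)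
  d2 t := hasDerivAt_const t _
  e1 t := by simpa using hasDerivAt_const t (2:ℝ)
  e2 t := by simpa using hasDerivAt_const t (0:ℝ)
  wr t := by ring
  ne := by norm_num

lemma shapeP' : ShapeSmooth (fun w => w ^ 2) (fun w => w) (fun w => 2 * w) (fun _ => 1) (fun _ => 2)
    (fun _ => 0) where
  c1 := by fun_prop
  c2 := by fun_prop
  d1 := by fun_prop
  d2 := by fun_prop
  e1 := by fun_prop
  e2 := by fun_prop

lemma back_signed {U : Set M3} (hU : IsOpen U) {ξ₀ : M3} (hξ₀ : ξ₀ ∈ U)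
    {f g : M3 → M3} (hf : ContDiffOn ℝ ∞ f U) (hg : ContDiffOn ℝ ∞ g U)
    (hC1 : LinearIndependent ℝ ![g ξ₀, lieB g f ξ₀, lieB g (lieB g f) ξ₀])
    {ρ τ σ : M3 → ℝ}
    (hρ : ContDiffOn ℝ ∞ ρ U) (hτ : ContDiffOn ℝ ∞ τ U)
    (hdec : ∀ ξ ∈ U, lieB g (lieB g (lieB g f)) ξ
      = ρ ξ • lieB g (lieB g f) ξ + τ ξ • lieB g f ξ + σ ξ • g ξ)
    (hC2 : ∀ ξ ∈ U, lieD g (fun η => 3 * lieD g ρ η - 2 * ρ η ^ 2 - 9 * τ η) ξ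
      - (2 / 3) * ρ ξ * (3 * lieD g ρ ξ - 2 * ρ ξ ^ 2 - 9 * τ ξ) = 0)
    {c₁ c₂ d₁ d₂ e₁ e₂ : ℝ → ℝ} {κ W : ℝ} (hS : Shape c₁ c₂ d₁ d₂ e₁ e₂ κ W)
    (hSS : ShapeSmooth c₁ c₂ d₁ d₂ e₁ e₂) (hκ : κ ^ 2 = 1)
    (hpos : 0 < -κ * (3 * lieD g ρ ξ₀ - 2 * ρ ξ₀ ^ 2 - 9 * τ ξ₀)) :
    EquivToQuadClass f g ξ₀ c₁ c₂ := by
  obtain ⟨χ, hχ⟩ : ∃ χ : M3 → ℝ, χ = fun η => 3 * lieD g ρ η - 2 * ρ η ^ 2 - 9 * τ η := ⟨_, rfl⟩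
  have hχ' : ∀ η, 3 * lieD g ρ η - 2 * ρ η ^ 2 - 9 * τ η = χ η := fun η => by rw [hχ]
  have sχ0 : ContDiffOn ℝ ∞ χ U := by
    rw [hχ]
    exact ((contDiffOn_const.mul (smooth_lieD hU hg hρ)).sub (contDiffOn_const.mul (hρ.pow 2))).sub
      (contDiffOn_const.mul hτ)
  rw [← hχ] at hC2
  simp only [hχ'] at hC2 hpos
  have sχ : ContDiffOn ℝ ∞ (fun η => -κ * χ η) U := contDiffOn_const.mul sχ0
  have hN : IsOpen (U ∩ (fun η => -κ * χ η) ⁻¹' Ioi 0) :=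
    sχ.continuousOn.isOpen_inter_preimage hU isOpen_Ioi
  have hsub : U ∩ (fun η => -κ * χ η) ⁻¹' Ioi 0 ⊆ U := inter_subset_left
  refine backward (β := fun ξ => 3 / √(-κ * χ ξ)) hN ⟨hξ₀, hpos⟩ (hf.mono hsub) (hg.mono hsub) hC1
    (hρ.mono hsub) (fun ξ hξ => hdec ξ (hsub hξ)) hS hSS ?_ ?_ ?_ ?_
  · refine contDiffOn_const.div ((sχ.mono hsub).sqrt fun ξ hξ => ?_) fun ξ hξ => ?_
    · exact ne_of_gt hξ.2
    · exact ne_of_gt (Real.sqrt_pos.2 hξ.2)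
  · intro ξ hξ
    exact div_ne_zero three_ne_zero (ne_of_gt (Real.sqrt_pos.2 hξ.2))
  · intro ξ hξ
    have hp : 0 < -κ * χ ξ := hξ.2
    have hsq := Real.sqrt_pos.2 hp
    have h1 : HasDerivAt (fun t : ℝ => 3 / √t) _ (-κ * χ ξ) :=
      (hasDerivAt_const (-κ * χ ξ) (3:ℝ)).fun_div (Real.hasDerivAt_sqrt (ne_of_gt hp)) (ne_of_gt hsq)
    have h2 := lieD_comp (A := g) (h := fun η => -κ * χ η) h1 (diffAt hU sχ hξ.1)
    rw [h2, lieD_const_mul (diffAt hU sχ0 hξ.1)]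
    have h3 : lieD g χ ξ = (2 / 3) * ρ ξ * χ ξ := by linarith [hC2 ξ hξ.1]
    rw [h3, Real.sq_sqrt hp.le]
    have h4 : -κ * χ ξ = √(-κ * χ ξ) ^ 2 := (Real.sq_sqrt hp.le).symm
    have h5 : -κ * (2 / 3 * ρ ξ * χ ξ) = (2 / 3) * ρ ξ * (-κ * χ ξ) := by ring
    rw [h5]
    generalize √(-κ * χ ξ) = r at *
    rw [h4]
    field_simp
    ring
  · intro ξ hξ
    have hp : 0 < -κ * χ ξ := hξ.2
    rw [hχ', div_pow, Real.sq_sqrt hp.le]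
    have hκ0 : κ ≠ 0 := by rintro rfl; simp at hp
    have hχ0 : χ ξ ≠ 0 := by intro h; rw [h] at hp; simp at hp
    field_simp
    linear_combination 9 * hκ

lemma back_zero {U : Set M3} (hU : IsOpen U) {ξ₀ : M3} (hξ₀ : ξ₀ ∈ U)
    {f g : M3 → M3} (hf : ContDiffOn ℝ ∞ f U) (hg : ContDiffOn ℝ ∞ g U)
    (hC1 : LinearIndependent ℝ ![g ξ₀, lieB g f ξ₀, lieB g (lieB g f) ξ₀])
    {ρ τ σ : M3 → ℝ}
    (hρ : ContDiffOn ℝ ∞ ρ U)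
    (hdec : ∀ ξ ∈ U, lieB g (lieB g (lieB g f)) ξ
      = ρ ξ • lieB g (lieB g f) ξ + τ ξ • lieB g f ξ + σ ξ • g ξ)
    (hz : ∀ ξ ∈ U, 3 * lieD g ρ ξ - 2 * ρ ξ ^ 2 - 9 * τ ξ = 0) :
    EquivToQuadClass f g ξ₀ (fun w => w ^ 2) (fun w => w) := by
  have hg0 : g ξ₀ ≠ 0 := by simpa using hC1.ne_zero 0
  obtain ⟨e, z, hmem, hsub, -, -, hzs, -, -, hz1, -⟩ :=
    exists_flowbox g (fun ξ => (-1/3) * ρ ξ) U hU ξ₀ hξ₀ hg (contDiffOn_const.mul hρ) hg0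
  refine backward (β := fun ξ => Real.exp (z ξ)) e.open_source hmem (hf.mono hsub) (hg.mono hsub)
    hC1 (hρ.mono hsub) (fun ξ hξ => hdec ξ (hsub hξ)) shapeP shapeP' hzs.exp
    (fun ξ _ => Real.exp_ne_zero _) ?_ ?_
  · intro ξ hξ
    rw [lieD_comp (Real.hasDerivAt_exp (z ξ)) (diffAt e.open_source hzs hξ)]
    have := hz1 ξ hξ
    simp only [lieD]
    rw [this]; ring
  · intro ξ hξ
    rw [hz ξ (hsub hξ)]; ring

end FlowAux

/-- under (C1)–(C2) (with structure functions `ρ, τ, σ` of the decomposition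
`ad_g³f = ρ·ad_g²f + τ·ad_g f + σ·g` and `χ = 3L_gρ − 2ρ² − 9τ`), the system `ξ̇ = f + gu`
is locally feedback equivalent at `ξ₀` to an elliptic system `Σ_E` iff `χ(ξ₀) > 0`, to a
hyperbolic system `Σ_H` iff `χ(ξ₀) < 0`, and to a parabolic system `Σ_P` iff `χ ≡ 0` near
`ξ₀`. -/
theorem stmt_6 (U : Set M3) (hU : IsOpen U) (ξ₀ : M3) (hξ₀ : ξ₀ ∈ U)
    (f g : M3 → M3) (hf : ContDiffOn ℝ (⊤ : ℕ∞) f U) (hg : ContDiffOn ℝ (⊤ : ℕ∞) g U)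
    (hC1 : LinearIndependent ℝ ![g ξ₀, lieB g f ξ₀, lieB g (lieB g f) ξ₀])
    (ρ τ σ : M3 → ℝ)
    (hρ : ContDiffOn ℝ (⊤ : ℕ∞) ρ U) (hτ : ContDiffOn ℝ (⊤ : ℕ∞) τ U) (hσ : ContDiffOn ℝ (⊤ : ℕ∞) σ U)
    (hdec : ∀ ξ ∈ U, lieB g (lieB g (lieB g f)) ξ
      = ρ ξ • lieB g (lieB g f) ξ + τ ξ • lieB g f ξ + σ ξ • g ξ)
    (hC2 : ∀ ξ ∈ U, lieD g (fun η => 3 * lieD g ρ η - 2 * ρ η ^ 2 - 9 * τ η) ξ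
      - (2 / 3) * ρ ξ * (3 * lieD g ρ ξ - 2 * ρ ξ ^ 2 - 9 * τ ξ) = 0) :
    (EquivToQuadClass f g ξ₀ Real.cos Real.sin ↔
      0 < 3 * lieD g ρ ξ₀ - 2 * ρ ξ₀ ^ 2 - 9 * τ ξ₀) ∧
    (EquivToQuadClass f g ξ₀ Real.cosh Real.sinh ↔
      3 * lieD g ρ ξ₀ - 2 * ρ ξ₀ ^ 2 - 9 * τ ξ₀ < 0) ∧
    (EquivToQuadClass f g ξ₀ (fun w => w ^ 2) (fun w => w) ↔
      ∃ V : Set M3, IsOpen V ∧ ξ₀ ∈ V ∧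
        ∀ ξ ∈ V, 3 * lieD g ρ ξ - 2 * ρ ξ ^ 2 - 9 * τ ξ = 0) := by
  refine ⟨⟨fun h => ?_, fun h => ?_⟩, ⟨fun h => ?_, fun h => ?_⟩, ⟨fun h => ?_, fun h => ?_⟩⟩
  · obtain ⟨O, β, -, h0, -, hb, hχ⟩ := FlowAux.forward hU hξ₀ hf hg hρ hdec FlowAux.shapeE h
    have hb2 : 0 < β ξ₀ ^ 2 := by have := hb ξ₀ h0; positivity
    have h1 := hχ ξ₀ h0
    refine (pos_iff_pos_of_mul_pos ?_).1 hb2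
    rw [h1]; norm_num
  · exact FlowAux.back_signed hU hξ₀ hf hg hC1 hρ hτ hdec hC2 FlowAux.shapeE FlowAux.shapeE'
      (by norm_num) (by linarith)
  · obtain ⟨O, β, -, h0, -, hb, hχ⟩ := FlowAux.forward hU hξ₀ hf hg hρ hdec FlowAux.shapeH h
    have hb2 : 0 < β ξ₀ ^ 2 := by have := hb ξ₀ h0; positivity
    have h1 := hχ ξ₀ h0
    by_contra hc
    have := mul_nonneg hb2.le (not_lt.1 hc)
    linarith
  · exact FlowAux.back_signed hU hξ₀ hf hg hC1 hρ hτ hdec hC2 FlowAux.shapeH FlowAux.shapeH'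
      (by norm_num) (by linarith)
  · obtain ⟨O, β, hO, h0, -, hb, hχ⟩ := FlowAux.forward hU hξ₀ hf hg hρ hdec FlowAux.shapeP h
    refine ⟨O, hO, h0, fun ξ hξ => ?_⟩
    have h1 := hχ ξ hξ
    rw [mul_zero] at h1
    exact (mul_eq_zero.1 h1).resolve_left (pow_ne_zero 2 (hb ξ hξ))
  · obtain ⟨V, hV, h0, hz⟩ := h
    have hs : U ∩ V ⊆ U := inter_subset_left
    exact FlowAux.back_zero (hU.inter hV) ⟨hξ₀, h0⟩ (hf.mono hs) (hg.mono hs) hC1 (hρ.mono hs)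
      (fun ξ hξ => hdec ξ hξ.1) (fun ξ hξ => hz ξ hξ.2)
end
end
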